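/- Let G = (V,E) be a finite graph. Then the linear system { x(C) + z(E \ C) ≥ 1 for every cycle C of G ; x ≥ 0 ; z ≥ 0 } in edge variables x, z ∈ ℝ^E is totally dual dyadic: for every pair of integral objective vectors for which the corresponding covering linear program min{wᵀx + vᵀz : x(C) + z(E\C) ≥ 1 for all cycles C, x ≥ 0, z ≥ 0} has an optimal solution, its dual max{1ᵀy : Σ_{C : e ∈ C} y_C ≤ w_e and Σ_{C : e ∉ C} y_C ≤ v_e for all e ∈ E, y ≥ 0} (one variable y_C per cycle C) has an optimal solution all of whose entries are dyadic rationals. -/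

import Mathlib

open Finset

attribute [local instance] Classical.propDecidable

/-- A real number is dyadic if it has the form `a / 2^k` for integers `a, k`, `k ≥ 0`. -/
def IsDyadic (r : ℝ) : Prop := ∃ (a : ℤ) (k : ℕ), r = (a : ℝ) / (2 : ℝ) ^ k

/-- In the multigraph with edge set `E` and endpoint map `ends`, `C` is a cycle if every
vertex is incident with an even number of edges of `C` (the empty set is a cycle). -/
def IsCycleSet {V E : Type} [Fintype V] [Fintype E] (ends : E → Sym2 V)
    (C : Finset E) : Prop :=
  ∀ v : V, Even ((Finset.univ.filter (fun e => e ∈ C ∧ v ∈ ends e)).card)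

set_option linter.unusedSectionVars false
set_option linter.unusedVariables false
set_option linter.unusedSimpArgs false

namespace TDD

/-- crossing indicator -/
noncomputable def cr {V E : Type} (s t : E → V) (S : Finset V) (e : E) : ℤ :=
  if (s e ∈ S ↔ t e ∈ S) then 0 else 1

/-- cut value -/
noncomputable def cut {V E : Type} [Fintype E] (s t : E → V) (S : Finset V) (x : E → ℤ) : ℤ :=
  ∑ e, cr s t S e * x e

/-- the r-graph type condition -/
structure RV {V E : Type} [Fintype V] [Fintype E] (s t : E → V) (c : E → ℤ) (τ : ℤ) : Prop where
  nonneg : ∀ e, 0 ≤ c e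
  loop : ∀ e, s e = t e → c e = 0
  star : ∀ v, cut s t {v} c = τ
  odd : ∀ S : Finset V, Odd S.card → τ ≤ cut s t S c

/-- incidence vectors of perfect matchings -/
def PM {V E : Type} [Fintype V] [Fintype E] (s t : E → V) : Set (E → ℤ) :=
  {m | (∀ e, 0 ≤ m e) ∧ (∀ e, s e = t e → m e = 0) ∧ ∀ v, cut s t {v} m = 1}

section basic
variable {V E : Type} [Fintype V] [Fintype E] {s t : E → V}

lemma cr_nonneg (S : Finset V) (e : E) : 0 ≤ cr s t S e := by
  unfold cr; split_ifs <;> simp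

lemma cr_compl (S : Finset V) (e : E) : cr s t Sᶜ e = cr s t S e := by
  unfold cr; simp only [mem_compl]
  by_cases h1 : s e ∈ S <;> by_cases h2 : t e ∈ S <;> simp [h1, h2]

lemma cut_compl (S : Finset V) (x : E → ℤ) : cut s t Sᶜ x = cut s t S x := by
  unfold cut; simp only [cr_compl]

lemma cut_add (S : Finset V) (x y : E → ℤ) : cut s t S (x + y) = cut s t S x + cut s t S y := by
  unfold cut; rw [← sum_add_distrib]; refine sum_congr rfl fun e _ => ?_
  simp [mul_add]

lemma cut_smul (S : Finset V) (a : ℤ) (x : E → ℤ) : cut s t S (a • x) = a * cut s t S x := by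
  unfold cut; rw [mul_sum]; refine sum_congr rfl fun e _ => ?_
  simp; ring

lemma cut_nsmul (S : Finset V) (a : ℕ) (x : E → ℤ) : cut s t S (a • x) = a * cut s t S x := by
  rw [← cut_smul, natCast_zsmul]

lemma cut_neg (S : Finset V) (x : E → ℤ) : cut s t S (-x) = - cut s t S x := by
  have := cut_smul (s := s) (t := t) S (-1) x
  simpa using this

lemma cut_sub (S : Finset V) (x y : E → ℤ) : cut s t S (x - y) = cut s t S x - cut s t S y := by
  rw [sub_eq_add_neg, cut_add, cut_neg, sub_eq_add_neg]

@[simp] lemma cut_zero (S : Finset V) : cut s t S (0 : E → ℤ) = 0 := by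
  simp [cut]

@[simp] lemma cut_empty (x : E → ℤ) : cut s t (∅ : Finset V) x = 0 := by
  simp [cut, cr]

@[simp] lemma cut_univ (x : E → ℤ) : cut s t (univ : Finset V) x = 0 := by
  simp [cut, cr]

lemma cut_nonneg (S : Finset V) {x : E → ℤ} (hx : ∀ e, 0 ≤ x e) : 0 ≤ cut s t S x :=
  sum_nonneg fun e _ => mul_nonneg (cr_nonneg S e) (hx e)

lemma pot {A : Type*} [AddCommGroup A] (x : E → ℤ) (hx : ∀ e, s e = t e → x e = 0) (b : V → A) :
    ∑ v, cut s t {v} x • b v = ∑ e, x e • (b (s e) + b (t e)) := by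
  unfold cut
  simp only [sum_smul]
  rw [sum_comm]
  refine sum_congr rfl fun e _ => ?_
  by_cases h : s e = t e
  · simp [hx e h]
  · have : ∀ v, (cr s t {v} e * x e) • b v =
      (if v = s e then x e • b v else 0) + (if v = t e then x e • b v else 0) := by
      intro v
      unfold cr
      by_cases h1 : v = s e
      · subst h1; simp [h, Ne.symm h]
      · by_cases h2 : v = t e
        · subst h2; simp [h, Ne.symm h]
        · simp [h1, h2, Ne.symm h1, Ne.symm h2]
    simp only [this, sum_add_distrib]
    simp

/-- number of ends in `X`. -/
noncomputable def ne (s t : E → V) (X : Finset V) (e : E) : ℤ :=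
  (if s e ∈ X then 1 else 0) + (if t e ∈ X then 1 else 0)

lemma pot_card {x : E → ℤ} (hx : ∀ e, s e = t e → x e = 0) {τ : ℤ}
    (hst : ∀ v, cut s t {v} x = τ) (X : Finset V) :
    τ * (X.card : ℤ) = ∑ e, x e * ne s t X e := by
  have := pot (s := s) (t := t) x hx (fun v => if v ∈ X then (1:ℤ) else 0)
  simp only [hst, smul_eq_mul] at this
  unfold ne
  rw [← this, ← mul_sum]
  congr 1
  simp

lemma cut_parity {x : E → ℤ} (hx : ∀ e, s e = t e → x e = 0) {τ : ℤ}
    (hst : ∀ v, cut s t {v} x = τ) (X : Finset V) : Even (τ * X.card - cut s t X x) := by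
  rw [pot_card hx hst X, cut, ← sum_sub_distrib]
  refine Finset.even_sum _ fun e _ => ?_
  unfold ne cr
  by_cases h1 : s e ∈ X <;> by_cases h2 : t e ∈ X <;> simp [h1, h2]

lemma RV.add {c d : E → ℤ} {τ σ : ℤ} (hc : RV s t c τ) (hd : RV s t d σ) :
    RV s t (c + d) (τ + σ) where
  nonneg e := add_nonneg (hc.nonneg e) (hd.nonneg e)
  loop e h := by simp [hc.loop e h, hd.loop e h]
  star v := by rw [cut_add, hc.star, hd.star]
  odd S hS := by rw [cut_add]; exact add_le_add (hc.odd S hS) (hd.odd S hS)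

lemma RV.zero : RV s t (0 : E → ℤ) 0 where
  nonneg e := le_rfl
  loop e h := by simp
  star v := by simp
  odd S hS := by simp

lemma PM.rv {m : E → ℤ} (hm : m ∈ PM s t) : RV s t m 1 := by
  obtain ⟨h1, h2, h3⟩ := hm
  refine ⟨h1, h2, h3, fun S hS => ?_⟩
  have h0 := cut_nonneg (s := s) (t := t) S h1
  rcases h0.lt_or_eq with h | h
  · omega
  · exfalso
    have := cut_parity h2 h3 S
    rw [← h] at this
    simp at this
    exact (Nat.not_even_iff_odd.2 hS) this

lemma closure_rv {x : E → ℤ} (hx : x ∈ AddSubmonoid.closure (PM s t)) : ∃ τ, RV s t x τ := by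
  induction hx using AddSubmonoid.closure_induction with
  | mem x h => exact ⟨1, PM.rv h⟩
  | zero => exact ⟨0, RV.zero⟩
  | add x y _ _ hx hy =>
    obtain ⟨a, ha⟩ := hx
    obtain ⟨b, hb⟩ := hy
    exact ⟨_, ha.add hb⟩

lemma RV.smul {c : E → ℤ} {τ : ℤ} (hc : RV s t c τ) {n : ℤ} (hn : 0 ≤ n) :
    RV s t (n • c) (n * τ) where
  nonneg e := mul_nonneg hn (hc.nonneg e)
  loop e h := by simp [hc.loop e h]
  star v := by rw [cut_smul, hc.star]
  odd S hS := by rw [cut_smul]; exact mul_le_mul_of_nonneg_left (hc.odd S hS) hn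

lemma RV.even_card {c : E → ℤ} {τ : ℤ} (hc : RV s t c τ) (hτ : 0 < τ) :
    Even (Fintype.card V) := by
  by_contra h
  rw [Nat.not_even_iff_odd] at h
  have := hc.odd univ (by simpa using h)
  simp at this; omega

lemma cut_eq_zero_of {S : Finset V} {x : E → ℤ} (h : ∀ e, cr s t S e * x e = 0) :
    cut s t S x = 0 := sum_eq_zero fun e _ => h e

lemma uncross1 (X Y : Finset V) {x : E → ℤ} (hx : ∀ e, 0 ≤ x e) :
    cut s t (X ∩ Y) x + cut s t (X ∪ Y) x ≤ cut s t X x + cut s t Y x := by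
  unfold cut
  rw [← sum_add_distrib, ← sum_add_distrib]
  refine sum_le_sum fun e _ => ?_
  rw [← add_mul, ← add_mul]
  refine mul_le_mul_of_nonneg_right ?_ (hx e)
  unfold cr
  simp only [mem_inter, mem_union]
  by_cases h1 : s e ∈ X <;> by_cases h2 : t e ∈ X <;> by_cases h3 : s e ∈ Y <;>
    by_cases h4 : t e ∈ Y <;> simp [h1, h2, h3, h4]

end basic

end TDD

namespace TDD

lemma argmin {ι : Type*} (I : Finset ι) (hI : I.Nonempty) (f g : ι → ℤ) (hg : ∀ i ∈ I, 0 < g i) :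
    ∃ k ∈ I, ∀ j ∈ I, f k * g j ≤ f j * g k := by
  obtain ⟨k, hk, h⟩ := exists_min_image I (fun i => (f i : ℚ) / g i) hI
  refine ⟨k, hk, fun j hj => ?_⟩
  have := h j hj
  have h1 : (0:ℚ) < g k := by exact_mod_cast hg k hk
  have h2 : (0:ℚ) < g j := by exact_mod_cast hg j hj
  rw [div_le_div_iff₀ h1 h2] at this
  exact_mod_cast this

lemma bigN {ι : Type*} (I : Finset ι) (f g : ι → ℤ) :
    ∃ N : ℤ, 0 < N ∧ ∀ k ∈ I, 0 < f k → 0 < N * f k + g k := by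
  refine ⟨1 + ∑ k ∈ I, |g k|, by positivity, fun k hk h => ?_⟩
  have h1 : |g k| ≤ ∑ k ∈ I, |g k| := single_le_sum (f := fun k => |g k|) (fun i _ => abs_nonneg _) hk
  have h2 := neg_abs_le (g k)
  nlinarith [abs_nonneg (g k)]

section poly
variable {M ι : Type} [AddCommGroup M]

lemma facet (W : AddSubgroup M) (φ : ι → M →+ ℤ) (I : Finset ι) (hI : I.Nonempty) (c : M)
    (hcW : c ∈ W) (hc : ∀ i ∈ I, 0 < φ i c) :
    ∃ x ∈ W, (∀ i ∈ I, 0 ≤ φ i x) ∧ (∃ i ∈ I, φ i x = 0) ∧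
      ∀ i ∈ I, ∀ j ∈ I, φ i x = 0 → φ j x = 0 → ∀ w ∈ W, φ i c * φ j w = φ j c * φ i w := by
  let P : ℕ → Prop := fun n => ∃ x ∈ W, (∀ i ∈ I, 0 ≤ φ i x) ∧ (∃ i ∈ I, φ i x = 0) ∧
    (I.filter (fun i => φ i x = 0)).card = n
  have hP : ∃ n, P n := by
    obtain ⟨i, hi⟩ := hI
    exact ⟨_, 0, W.zero_mem, by simp, ⟨i, hi, by simp⟩, rfl⟩
  obtain ⟨x, hxW, hx0, hxZ, hcard⟩ := Nat.find_spec hP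
  have hmin : ∀ n, P n → Nat.find hP ≤ n := fun n hn => Nat.find_min' hP hn
  refine ⟨x, hxW, hx0, hxZ, ?_⟩
  -- core contradiction
  have core : ∀ i ∈ I, ∀ j ∈ I, φ i x = 0 → φ j x = 0 → ∀ e ∈ W, φ i e = 0 → 0 < φ j e → False := by
    intro i hi j hj hix hjx e he hie hje
    set Z := I.filter (fun i => φ i x = 0) with hZ
    have hjZ : j ∈ Z := by simp [hZ, hj, hjx]
    obtain ⟨k, hk, hkmin⟩ := argmin Z ⟨j, hjZ⟩ (fun k => - φ k e) (fun k => φ k c)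
      (fun k hk => hc k (mem_filter.1 hk).1)
    have hkI := (mem_filter.1 hk).1
    have hkx := (mem_filter.1 hk).2
    have hke : 0 < φ k e := by
      have h1 := hkmin j hjZ
      have h2 := hc k hkI
      have h3 := hc j hj
      by_contra hn
      push Not at hn
      nlinarith
    obtain ⟨N, hN, hNI⟩ := bigN I (fun k => φ k x) (fun i => φ k e * φ i c - φ k c * φ i e)
    have hval : ∀ i, φ i (N • x + (φ k e • c - φ k c • e)) =
        N * φ i x + (φ k e * φ i c - φ k c * φ i e) := by
      intro i; simp
    have hlt : (I.filter (fun i => φ i (N • x + (φ k e • c - φ k c • e)) = 0)).card < Z.card := by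
      apply card_lt_card
      rw [Finset.ssubset_iff_of_subset]
      · refine ⟨i, by simp [hZ, hi, hix], ?_⟩
        simp only [mem_filter, hval, not_and]
        intro _
        rw [hix, hie]
        have := mul_pos hke (hc i hi)
        simp; exact ⟨hke.ne', (hc i hi).ne'⟩
      · intro l hl
        simp only [mem_filter, hval] at hl
        simp only [hZ, mem_filter]
        refine ⟨hl.1, ?_⟩
        by_contra hne
        have : 0 < φ l x := lt_of_le_of_ne (hx0 l hl.1) (Ne.symm hne)
        have := hNI l hl.1 this
        omega
    have := hmin _ ⟨N • x + (φ k e • c - φ k c • e), ?_, ?_, ⟨k, hkI, ?_⟩, rfl⟩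
    · omega
    · exact W.add_mem (W.zsmul_mem hxW _) (W.sub_mem (W.zsmul_mem hcW _) (W.zsmul_mem he _))
    · intro l hl
      rw [hval]
      rcases (hx0 l hl).lt_or_eq with h | h
      · exact (hNI l hl h).le
      · have := hkmin l (by simp [hZ, hl, h.symm])
        rw [← h]; nlinarith
    · rw [hval, hkx]; ring
  intro i hi j hj hix hjx w hw
  by_contra hne
  have heW : φ i c • w - φ i w • c ∈ W := W.sub_mem (W.zsmul_mem hw _) (W.zsmul_mem hcW _)
  rcases lt_or_gt_of_ne hne with h | h
  · refine core i hi j hj hix hjx _ (W.neg_mem heW) ?_ ?_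
    · simp; ring
    · simp; nlinarith
  · refine core i hi j hj hix hjx _ heW ?_ ?_
    · simp; ring
    · simp; nlinarith

lemma ridge (W : AddSubgroup M) (φ : ι → M →+ ℤ) (I : Finset ι) (c : M)
    (hcW : c ∈ W) (hc : ∀ i ∈ I, 0 < φ i c) (x1 : M) (h1W : x1 ∈ W) (h1 : ∀ i ∈ I, 0 ≤ φ i x1)
    (i0 : ι) (hi0 : i0 ∈ I) (hi0x : φ i0 x1 = 0)
    (hprop : ∀ j ∈ I, φ j x1 = 0 → ∀ w ∈ W, φ i0 c * φ j w = φ j c * φ i0 w)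
    (hk : ∃ k ∈ I, 0 < φ k x1) :
    ∃ x2 ∈ W, ∃ j0 ∈ I, ∃ x3 ∈ W, (∀ i ∈ I, 0 ≤ φ i x2) ∧ φ i0 x2 = 0 ∧ φ j0 x2 = 0 ∧ 0 < φ j0 x1 ∧
      (∀ k ∈ I, φ k x2 = 0 → ∃ p q r : ℤ, 0 < p ∧ 0 ≤ q ∧ 0 ≤ r ∧ ∀ w ∈ W,
        p * φ k w = q * φ i0 w + r * φ j0 w) ∧
      (∀ i ∈ I, 0 ≤ φ i x3) ∧ φ j0 x3 = 0 ∧ 0 < φ i0 x3 ∧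
      (∀ k ∈ I, φ k x3 = 0 → ∀ w ∈ W, φ j0 c * φ k w = φ k c * φ j0 w) := by
  set I1 := I.filter (fun k => 0 < φ k x1) with hI1
  set W1 := W ⊓ (φ i0).ker with hW1
  have hI1n : I1.Nonempty := by
    obtain ⟨k, hk, hk'⟩ := hk
    exact ⟨k, by simp [hI1, hk, hk']⟩
  obtain ⟨x2, hx2W, hx2, ⟨j1, hj1, hj1x⟩, hZ⟩ := facet W1 φ I1 hI1n x1
    (by simp [hW1, h1W, AddMonoidHom.mem_ker, hi0x]) (fun i hi => (mem_filter.1 hi).2)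
  have hx2i0 : φ i0 x2 = 0 := by
    have := hx2W.2
    simpa [AddMonoidHom.mem_ker] using this
  have hx2W' : x2 ∈ W := hx2W.1
  set Z := I1.filter (fun k => φ k x2 = 0) with hZdef
  have hj1Z : j1 ∈ Z := by simp [hZdef, hj1, hj1x]
  obtain ⟨j0, hj0, hj0min⟩ := argmin Z ⟨j1, hj1Z⟩ (fun k => φ k c) (fun k => φ k x1)
    (fun k hk => (mem_filter.1 (mem_filter.1 hk).1).2)
  have hj0I1 := (mem_filter.1 hj0).1
  have hj0x2 := (mem_filter.1 hj0).2
  have hj0I := (mem_filter.1 hj0I1).1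
  have hj0x1 := (mem_filter.1 hj0I1).2
  have key : ∀ k ∈ Z, ∀ w ∈ W, φ j0 x1 * φ i0 c * φ k w = 
      (φ j0 x1 * φ k c - φ k x1 * φ j0 c) * φ i0 w + φ k x1 * φ i0 c * φ j0 w := by
    intro k hk w hw
    have hw' : φ i0 c • w - φ i0 w • c ∈ W1 := by
      refine ⟨W.sub_mem (W.zsmul_mem hw _) (W.zsmul_mem hcW _), ?_⟩
      change φ i0 _ = 0
      simp; ring
    have := hZ j0 hj0I1 k (mem_filter.1 hk).1 hj0x2 (mem_filter.1 hk).2 _ hw'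
    simp at this
    linear_combination this
  have hzero : ∀ k ∈ I, k ∉ I1 → φ k x1 = 0 := by
    intro k hk hk1
    have := h1 k hk
    simp only [hI1, mem_filter, not_and, hk, true_implies] at hk1
    omega
  have hx2c : ∀ i ∈ I, 0 ≤ φ i x2 := by
    intro i hi
    by_cases h : i ∈ I1
    · exact hx2 i h
    · have := hprop i hi (hzero i hi h) x2 hx2W'
      rw [hx2i0, mul_zero] at this
      have h2 := hc i0 hi0
      rcases mul_eq_zero.1 this with h3 | h3
      · omega
      · omega
  obtain ⟨N, hN, hNI⟩ := bigN I (fun k => φ k x2) (fun i => φ j0 x1 * φ i c - φ j0 c * φ i x1)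
  have hval : ∀ i, φ i (N • x2 + (φ j0 x1 • c - φ j0 c • x1)) =
      N * φ i x2 + (φ j0 x1 * φ i c - φ j0 c * φ i x1) := by
    intro i; simp
  have hi0c := hc i0 hi0
  have hj0c := hc j0 hj0I
  refine ⟨x2, hx2W', j0, hj0I, N • x2 + (φ j0 x1 • c - φ j0 c • x1), ?_, hx2c, hx2i0, hj0x2, hj0x1,
    ?_, ?_, ?_, ?_, ?_⟩
  · exact W.add_mem (W.zsmul_mem hx2W' _) (W.sub_mem (W.zsmul_mem hcW _) (W.zsmul_mem h1W _))
  · intro k hk hkx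
    by_cases h : k ∈ I1
    · have hkZ : k ∈ Z := by simp [hZdef, h, hkx]
      have h3 := hj0min k hkZ
      have h4 := (mem_filter.1 h).2
      refine ⟨φ j0 x1 * φ i0 c, φ j0 x1 * φ k c - φ k x1 * φ j0 c, φ k x1 * φ i0 c,
        mul_pos hj0x1 hi0c, ?_, (mul_pos h4 hi0c).le, key k hkZ⟩
      nlinarith
    · refine ⟨φ i0 c, φ k c, 0, hi0c, (hc k hk).le, le_rfl, fun w hw => ?_⟩
      rw [hprop k hk (hzero k hk h) w hw]; ring
  · intro l hl
    rw [hval]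
    rcases (hx2c l hl).lt_or_eq with h | h
    · exact (hNI l hl h).le
    · rw [← h]
      by_cases h' : l ∈ I1
      · have := hj0min l (by simp [hZdef, h', h.symm])
        nlinarith
      · rw [hzero l hl h']
        have := mul_pos hj0x1 (hc l hl)
        simpa using this.le
  · rw [hval, hj0x2]; ring
  · rw [hval, hx2i0, hi0x]
    have := mul_pos hj0x1 hi0c
    simpa using this
  · intro k hk hkx w hw
    rw [hval] at hkx
    rcases (hx2c k hk).lt_or_eq with h | h
    · have := hNI k hk h
      omega
    · by_cases h' : k ∈ I1
      · have h2 := key k (by simp [hZdef, h', h.symm]) w hw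
        rw [← h] at hkx
        have h3 : φ j0 x1 * φ k c - φ k x1 * φ j0 c = 0 := by linarith
        rw [h3] at h2
        have h4 : φ j0 x1 * φ i0 c * (φ j0 c * φ k w) = φ j0 x1 * φ i0 c * (φ k c * φ j0 w) := by
          linear_combination φ j0 c * h2 - φ i0 c * φ j0 w * h3
        exact mul_left_cancel₀ (mul_pos hj0x1 hi0c).ne' h4
      · rw [hzero k hk h', ← h] at hkx
        have := mul_pos hj0x1 (hc k hk)
        simp at hkx
        have := hc k hk
        omega

end poly

end TDD

namespace TDD

lemma extendHom {A : Type} [AddCommGroup A] [DivisibleBy A ℤ] {M N : Type} [AddCommGroup M]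
    [AddCommGroup N] (f : M →+ N) (g : M →+ A) (h : ∀ x, f x = 0 → g x = 0) :
    ∃ k : N →+ A, ∀ x, k (f x) = g x := by
  obtain ⟨k, hk⟩ := (Module.Baer.of_divisible A).extension_property_addMonoidHom
    (QuotientAddGroup.kerLift f) (QuotientAddGroup.kerLift_injective f)
    (QuotientAddGroup.lift f.ker g (fun x hx => h x hx))
  refine ⟨k, fun x => ?_⟩
  have := DFunLike.congr_fun hk (QuotientAddGroup.mk x)
  exact this

/-- dyadic rationals -/
def dy : AddSubgroup ℚ where
  carrier := {q | ∃ (k : ℕ) (n : ℤ), 2 ^ k * q = n}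
  zero_mem' := ⟨0, 0, by simp⟩
  add_mem' := by
    rintro a b ⟨k, n, h⟩ ⟨k', n', h'⟩
    refine ⟨k + k', 2 ^ k' * n + 2 ^ k * n', ?_⟩
    push_cast
    rw [← h, ← h']; ring
  neg_mem' := by
    rintro a ⟨k, n, h⟩
    exact ⟨k, -n, by push_cast; rw [← h]; ring⟩

/-- rationals modulo dyadics -/
abbrev QD : Type := ℚ ⧸ dy

noncomputable instance : DivisibleBy QD ℤ :=
  letI : DivisibleBy ℚ ℕ := AddGroup.divisibleByNatOfDivisibleByInt ℚ
  letI : DivisibleBy QD ℕ := QuotientAddGroup.divisibleBy dy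
  AddGroup.divisibleByIntOfDivisibleByNat QD

lemma QD_two {a : QD} (h : (2 : ℤ) • a = 0) : a = 0 := by
  induction a using QuotientAddGroup.induction_on with
  | H q =>
    rw [← QuotientAddGroup.mk_zsmul, QuotientAddGroup.eq_zero_iff] at h
    rw [QuotientAddGroup.eq_zero_iff]
    obtain ⟨k, n, h⟩ := h
    refine ⟨k + 1, n, ?_⟩
    rw [← h]; simp; ring

lemma separate {G : Type} [AddCommGroup G] (L : AddSubgroup G) (c : G)
    (h : ∀ ℓ : G →+ QD, (∀ x ∈ L, ℓ x = 0) → ℓ c = 0) : ∃ j : ℕ, (2 ^ j : ℤ) • c ∈ L := by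
  by_contra hn
  push Not at hn
  let f : ℤ →+ G ⧸ L := zmultiplesHom _ (QuotientAddGroup.mk c)
  have hf : ∀ k : ℤ, f k = 0 ↔ k • c ∈ L := by
    intro k
    simp only [f, zmultiplesHom_apply]
    rw [← QuotientAddGroup.mk_zsmul, QuotientAddGroup.eq_zero_iff]
  obtain ⟨n, hnn⟩ := Int.subgroup_cyclic f.ker
  have hn' : ∀ k : ℤ, k • c ∈ L ↔ n ∣ k := by
    intro k
    rw [← hf, ← AddMonoidHom.mem_ker, hnn, AddSubgroup.mem_closure_singleton]
    constructor
    · rintro ⟨a, rfl⟩; simp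
    · rintro ⟨a, rfl⟩; exact ⟨a, by simp [mul_comm]⟩
  obtain ⟨q, hq1, hq2⟩ : ∃ q : ℚ, q ∉ dy ∧ n • q ∈ dy := by
    by_cases h0 : n = 0
    · refine ⟨1 / 3, ?_, by simp [h0]⟩
      rintro ⟨k, m, hk⟩
      have h1 : (2 : ℚ) ^ k = 3 * m := by linarith
      have h2 : (2 : ℤ) ^ k = 3 * m := by exact_mod_cast h1
      have h3 : (3 : ℤ) ∣ 2 ^ k := ⟨m, h2⟩
      have := Int.Prime.dvd_pow' (n := 2) (k := k) (p := 3) (by norm_num) (by exact_mod_cast h3)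
      norm_num at this
    · refine ⟨1 / n, ?_, ⟨0, 1, ?_⟩⟩
      · rintro ⟨k, m, hk⟩
        have h1 : (2 : ℚ) ^ k = n * m := by
          have : (n : ℚ) ≠ 0 := by exact_mod_cast h0
          field_simp at hk
          linarith
        have h2 : (2 : ℤ) ^ k = n * m := by exact_mod_cast h1
        exact hn k ((hn' _).2 ⟨m, h2⟩)
      · have : (n : ℚ) ≠ 0 := by exact_mod_cast h0
        simp [this]
  obtain ⟨k, hk⟩ := extendHom f (zmultiplesHom QD (QuotientAddGroup.mk q)) (by
    intro x hx
    rw [hf, hn'] at hx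
    obtain ⟨y, rfl⟩ := hx
    simp only [zmultiplesHom_apply]
    rw [mul_comm, mul_smul, ← QuotientAddGroup.mk_zsmul, (QuotientAddGroup.eq_zero_iff _).2 hq2]
    simp)
  have h1 := h (k.comp (QuotientAddGroup.mk' L)) (by
    intro x hx
    simp [(QuotientAddGroup.eq_zero_iff x).2 hx])
  have h2 := hk 1
  simp only [f, zmultiplesHom_apply, one_smul] at h2
  apply hq1
  rw [← QuotientAddGroup.eq_zero_iff, ← h2]
  exact h1

section pots
variable {V E : Type} [Fintype V] [Fintype E] {s t : E → V}

lemma cut_single (S : Finset V) (e : E) : cut s t S (Pi.single e 1) = cr s t S e := by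
  unfold cut
  rw [sum_eq_single e]
  · simp
  · intro b _ hb; simp [Pi.single_eq_of_ne hb]
  · simp

lemma hom_sum {A : Type} [AddCommGroup A] (ℓ : (E → ℤ) →+ A) (x : E → ℤ) :
    ℓ x = ∑ e, x e • ℓ (Pi.single e 1) := by
  conv_lhs => rw [← Finset.univ_sum_single x]
  rw [map_sum]
  refine sum_congr rfl fun e _ => ?_
  rw [← map_zsmul]
  congr 1
  rw [← Pi.single_smul]; simp

lemma potentials {A : Type} [AddCommGroup A] [DivisibleBy A ℤ] (hnl : ∀ e, s e ≠ t e) (S : Finset V)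
    (ℓ : (E → ℤ) →+ A)
    (h : ∀ d : E → ℤ, (∀ v, cut s t {v} d = 0) → cut s t S d = 0 → ℓ d = 0) :
    ∃ (a : A) (b : V → A), ∀ e, ℓ (Pi.single e 1) = cr s t S e • a + (b (s e) + b (t e)) := by
  let T : (E → ℤ) →+ (V → ℤ) × ℤ :=
    { toFun := fun x => (fun v => cut s t {v} x, cut s t S x)
      map_zero' := by simp; rfl
      map_add' := by
        intro x y; ext <;> simp [cut_add] }
  obtain ⟨k, hk⟩ := extendHom T ℓ (by
    intro x hx
    have h1 : (fun v => cut s t {v} x) = 0 := congrArg Prod.fst hx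
    have h2 : cut s t S x = 0 := congrArg Prod.snd hx
    exact h x (fun v => congrFun h1 v) h2)
  refine ⟨k (0, 1), fun v => k (Pi.single v 1, 0), fun e => ?_⟩
  rw [← hk]
  have : T (Pi.single e 1) = cr s t S e • (0, 1) + ((Pi.single (s e) 1, 0) + (Pi.single (t e) 1, 0)) := by
    ext v
    · have h2 := hnl e
      simp only [T, AddMonoidHom.coe_mk, ZeroHom.coe_mk, cut_single, Prod.fst_add, Prod.smul_fst,
        smul_zero, Pi.add_apply, cr, mem_singleton]
      by_cases h1 : s e = v
      · subst h1; simp [Ne.symm h2, h2]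
      · by_cases h3 : t e = v
        · subst h3; simp [h2, Ne.symm h2]
        · simp [h1, h3, Ne.symm h1, Ne.symm h3]
    · simp [T, cut_single]
  rw [this, map_add, map_add, map_zsmul]

lemma hom_eval {A : Type} [AddCommGroup A] (hnl : ∀ e, s e ≠ t e) (S : Finset V)
    (ℓ : (E → ℤ) →+ A) (a : A) (b : V → A)
    (h : ∀ e, ℓ (Pi.single e 1) = cr s t S e • a + (b (s e) + b (t e))) (x : E → ℤ) :
    ℓ x = cut s t S x • a + ∑ v, cut s t {v} x • b v := by
  rw [pot x (fun e he => absurd he (hnl e)), hom_sum ℓ x, cut, sum_smul, ← sum_add_distrib]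
  refine sum_congr rfl fun e _ => ?_
  rw [h, smul_add, smul_smul, mul_comm]

end pots

end TDD

namespace TDD

section brick
variable {V E : Type} [Fintype V] [Fintype E] {s t : E → V}

/-- nontrivial odd sets -/
def NT (S : Finset V) : Prop := Odd S.card ∧ 3 ≤ S.card ∧ 3 ≤ Sᶜ.card

/-- brick situation -/
structure Brick (s t : E → V) (c : E → ℤ) (τ : ℤ) : Prop where
  nev : Nonempty V
  nl : ∀ e, s e ≠ t e
  pos : ∀ e, 0 < c e
  rv : RV s t c τ
  tpos : 0 < τ
  strict : ∀ S : Finset V, NT S → τ < cut s t S c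
  hB : ∀ x σ, RV s t x σ → ((∃ e, x e = 0) ∨ ∃ S, NT S ∧ cut s t S x = σ) →
    ∃ k : ℕ, (2 ^ k : ℤ) • x ∈ AddSubmonoid.closure (PM s t)

/-- regular vectors -/
def WW (s t : E → V) : AddSubgroup ((E → ℤ) × ℤ) where
  carrier := {p | ∀ v, cut s t {v} p.1 = p.2}
  zero_mem' := by intro v; simp
  add_mem' := by
    intro a b ha hb v
    simp [cut_add, ha v, hb v]
  neg_mem' := by
    intro a ha v
    simp [cut_neg, ha v]

lemma mem_WW {p : (E → ℤ) × ℤ} : p ∈ WW s t ↔ ∀ v, cut s t {v} p.1 = p.2 := Iff.rfl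

/-- the functionals -/
noncomputable def ph (s t : E → V) : E ⊕ Finset V → ((E → ℤ) × ℤ →+ ℤ)
  | .inl e => { toFun := fun p => p.1 e, map_zero' := rfl, map_add' := fun _ _ => rfl }
  | .inr S => { toFun := fun p => cut s t S p.1 - p.2, map_zero' := by simp
                map_add' := by intro a b; simp [cut_add]; ring }

@[simp] lemma ph_inl (e : E) (p : (E → ℤ) × ℤ) : ph s t (.inl e) p = p.1 e := rfl
@[simp] lemma ph_inr (S : Finset V) (p : (E → ℤ) × ℤ) :
    ph s t (.inr S) p = cut s t S p.1 - p.2 := rfl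

/-- index set -/
noncomputable def II (V E : Type) [Fintype V] [Fintype E] : Finset (E ⊕ Finset V) :=
  univ.filter (fun i => match i with | .inl _ => True | .inr S => NT S)

@[simp] lemma mem_II_inl (e : E) : (Sum.inl e : E ⊕ Finset V) ∈ II V E := by simp [II]
@[simp] lemma mem_II_inr (S : Finset V) : (Sum.inr S : E ⊕ Finset V) ∈ II V E ↔ NT S := by simp [II]

variable {c : E → ℤ} {τ : ℤ}

lemma odd_compl (hV : Even (Fintype.card V)) {S : Finset V} (h : Odd S.card) : Odd Sᶜ.card := by
  rw [card_compl]
  have := card_le_univ S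
  exact Nat.Even.sub_odd this hV h

lemma NT.compl (hV : Even (Fintype.card V)) {S : Finset V} (h : NT S) : NT Sᶜ :=
  ⟨odd_compl hV h.1, h.2.2, by simpa using h.2.1⟩

lemma cone_rv (hb : Brick s t c τ) {p : (E → ℤ) × ℤ} (hp : p ∈ WW s t)
    (h : ∀ i ∈ II V E, 0 ≤ ph s t i p) : RV s t p.1 p.2 := by
  have hV := hb.rv.even_card hb.tpos
  refine ⟨fun e => by simpa using h (.inl e) (by simp), fun e he => absurd he (hb.nl e), hp,
    fun S hS => ?_⟩
  by_cases h1 : S.card = 1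
  · obtain ⟨v, rfl⟩ := card_eq_one.1 h1
    exact (hp v).ge
  by_cases h2 : Sᶜ.card = 1
  · obtain ⟨v, hv⟩ := card_eq_one.1 h2
    rw [← cut_compl, hv]
    exact (hp v).ge
  have h3 := odd_compl hV hS
  have : NT S := ⟨hS, by obtain ⟨k, hk⟩ := hS; omega, by obtain ⟨k, hk⟩ := h3; omega⟩
  have := h (.inr S) (by simpa using this)
  simpa using this

lemma cone_of_rv {x : E → ℤ} {σ : ℤ} (h : RV s t x σ) : ∀ i ∈ II V E, 0 ≤ ph s t i (x, σ) := by
  rintro (e | S) hi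
  · simpa using h.nonneg e
  · simp only [mem_II_inr] at hi
    simpa using h.odd S hi.1

lemma mem_of_rv {x : E → ℤ} {σ : ℤ} (h : RV s t x σ) : (x, σ) ∈ WW s t := h.star

lemma Brick.interior (hb : Brick s t c τ) : ∀ i ∈ II V E, 0 < ph s t i (c, τ) := by
  rintro (e | S) hi
  · simpa using hb.pos e
  · simp only [mem_II_inr] at hi
    simpa using hb.strict S hi

lemma bdry (hb : Brick s t c τ) {p : (E → ℤ) × ℤ} (hp : p ∈ WW s t)
    (h : ∀ i ∈ II V E, 0 ≤ ph s t i p) (h0 : ∃ i ∈ II V E, ph s t i p = 0) :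
    ∃ k : ℕ, (2 ^ k : ℤ) • p.1 ∈ AddSubmonoid.closure (PM s t) := by
  refine hb.hB _ _ (cone_rv hb hp h) ?_
  obtain ⟨e | S, hi, h0⟩ := h0
  · exact Or.inl ⟨e, by simpa using h0⟩
  · simp only [mem_II_inr] at hi
    exact Or.inr ⟨S, hi, by simpa [sub_eq_zero] using h0⟩

lemma PM_of_closure (hV : Nonempty V) {y : E → ℤ} {σ : ℤ} (hσ : σ ≠ 0) (hy : ∀ v, cut s t {v} y = σ)
    (h : y ∈ AddSubmonoid.closure (PM s t)) : (PM s t).Nonempty := by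
  by_contra hn
  rw [Set.not_nonempty_iff_eq_empty] at hn
  rw [hn, AddSubmonoid.closure_empty, AddSubmonoid.mem_bot] at h
  obtain ⟨v⟩ := hV
  have := hy v
  rw [h] at this; simp at this; exact hσ this.symm

lemma single_le_star (x : E → ℤ) (hx : ∀ e, 0 ≤ x e) (hnl : ∀ e, s e ≠ t e) (f : E) :
    x f ≤ cut s t {s f} x := by
  have h1 : cr s t {s f} f = 1 := by simp [cr, Ne.symm (hnl f)]
  have := single_le_sum (f := fun e => cr s t {s f} e * x e) (s := univ)
    (fun e _ => mul_nonneg (cr_nonneg _ e) (hx e)) (mem_univ f)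
  simp only [h1, one_mul] at this
  exact this

lemma all_tau (hb : Brick s t c τ) (hd : ∀ d : E → ℤ, (∀ v, cut s t {v} d = 0) → d = 0) (f : E) :
    c f = τ := by
  have hV := hb.rv.even_card hb.tpos
  have hle : c f ≤ τ := by
    rw [← hb.rv.star (s f)]; exact single_le_star c hb.rv.nonneg hb.nl f
  have hpos := hb.pos f
  let ℓ : (E → ℤ) →+ ℚ :=
    { toFun := fun x => (x f : ℚ), map_zero' := by simp, map_add' := by intro x y; simp }
  obtain ⟨a, b, hab⟩ := potentials hb.nl ∅ ℓ (by
    intro d h1 _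
    simp [ℓ, hd d h1])
  have hab' : ∀ e, e ≠ f → b (s e) + b (t e) = 0 := by
    intro e he
    have := hab e
    simp [ℓ, cr, Ne.symm he] at this
    linarith
  have habf : b (s f) + b (t f) = 1 := by
    have := hab f
    simp [ℓ, cr] at this
    linarith
  set X : Finset V := univ.filter (fun v => |b v| = |b (s f)|) with hX
  have hmX : ∀ v, v ∈ X ↔ |b v| = |b (s f)| := by intro v; simp [hX]
  have hsf : s f ∈ X := by simp [hX]
  have hnc : ∀ e, e ≠ f → (s e ∈ X ↔ t e ∈ X) := by
    intro e he
    have h1 : b (s e) = - b (t e) := by linarith [hab' e he]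
    rw [hmX, hmX, h1, abs_neg]
  by_cases hcross : t f ∈ X
  · -- f inside
    have hcut : cut s t X c = 0 := by
      apply cut_eq_zero_of
      intro e
      by_cases he : e = f
      · subst he; simp [cr, hsf, hcross]
      · simp [cr, hnc e he]
    have hXe : Even X.card := by
      by_contra hodd
      have := hb.rv.odd X (Nat.not_even_iff_odd.1 hodd)
      have := hb.tpos
      omega
    have heq : b (s f) = 1/2 := by
      have h1 := (hmX _).1 hcross
      rcases abs_eq_abs.1 h1 with h | h <;> linarith
    have hbX : ∀ v ∈ X, b v = 1/2 ∨ b v = -(1/2) := by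
      intro v hv
      rw [hmX, heq] at hv
      exact abs_eq_abs.1 hv
    have hp := pot (s := s) (t := t) c (fun e he => absurd he (hb.nl e))
      (fun v => if v ∈ X then b v else 0)
    have hR : ∑ e, c e • ((if s e ∈ X then b (s e) else 0) + (if t e ∈ X then b (t e) else 0)) =
        (c f : ℚ) := by
      rw [sum_eq_single f]
      · simp [hsf, hcross, habf]
      · intro e _ he
        by_cases h1 : s e ∈ X
        · simp [h1, (hnc e he).1 h1, hab' e he]
        · have h2 : t e ∉ X := fun h => h1 ((hnc e he).2 h)
          simp [h1, h2]
      · simp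
    rw [hR] at hp
    simp only [hb.rv.star] at hp
    have hsum : ∑ v, (if v ∈ X then b v else 0) =
        ((X.filter (fun v => b v = 1/2)).card : ℚ) - X.card / 2 := by
      rw [← sum_filter]
      have h1 : univ.filter (fun v => v ∈ X) = X := by ext; simp
      rw [h1]
      have h2 : ∀ v ∈ X, b v = (if b v = 1/2 then (1:ℚ) else 0) - 1/2 := by
        intro v hv
        rcases hbX v hv with h | h <;> rw [h] <;> norm_num
      rw [sum_congr rfl h2, sum_sub_distrib]
      simp
      ring
    rw [← smul_sum, hsum] at hp
    obtain ⟨k, hk⟩ := hXe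
    rw [hk] at hp
    have hp' : τ * (((X.filter (fun v => b v = 1/2)).card : ℤ) - k) = c f := by
      have : (τ : ℚ) * (((X.filter (fun v => b v = 1/2)).card : ℚ) - k) = c f := by
        rw [← hp]; simp
      exact_mod_cast this
    have hd : τ ∣ c f := ⟨_, hp'.symm⟩
    have := Int.le_of_dvd hpos hd
    omega
  · have hcutX : cut s t X c = c f := by
      unfold cut
      rw [sum_eq_single f]
      · simp [cr, hsf, hcross]
      · intro e _ he; simp [cr, hnc e he]
      · simp
    by_cases hodd : Odd X.card
    · have := hb.rv.odd X hodd
      omega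
    · exfalso
      rw [Nat.not_odd_iff_even] at hodd
      have h1 := hb.rv.odd (insert (t f) X) (by
        rw [card_insert_of_notMem hcross]; exact hodd.add_one)
      have h2 : cut s t (insert (t f) X) c = cut s t {t f} c - c f := by
        unfold cut
        rw [← sum_erase_add _ _ (mem_univ f), ← sum_erase_add _ (fun e => cr s t {t f} e * c e) (mem_univ f)]
        have h3 : cr s t (insert (t f) X) f = 0 := by simp [cr, hsf]
        have h4 : cr s t {t f} f = 1 := by simp [cr, hb.nl f]
        rw [h3, h4]
        have : ∑ x ∈ univ.erase f, cr s t (insert (t f) X) x * c x =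
          ∑ x ∈ univ.erase f, cr s t {t f} x * c x := by
          refine sum_congr rfl fun e he => ?_
          have he' := ne_of_mem_erase he
          congr 1
          have h5 := hnc e he'
          unfold cr
          simp only [mem_insert, mem_singleton]
          by_cases h6 : s e = t f
          · have h7 : t e ≠ t f := fun h => hb.nl e (h6.trans h.symm)
            have h8 : s e ∉ X := by rw [h6]; exact hcross
            have h9 : t e ∉ X := fun h => h8 (h5.2 h)
            simp [h6, h7, h9]
          · by_cases h7 : t e = t f
            · have h8 : t e ∉ X := by rw [h7]; exact hcross
              have h9 : s e ∉ X := fun h => h8 (h5.1 h)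
              simp [h6, h7, h9]
            · simp [h6, h7, h5]
        rw [this]; ring
      rw [hb.rv.star] at h2
      omega

lemma exists_PM (hb : Brick s t c τ) : (PM s t).Nonempty := by
  by_cases hd : ∀ d : E → ℤ, (∀ v, cut s t {v} d = 0) → d = 0
  · have h := all_tau hb hd
    have h1 : c = τ • (fun _ => (1 : ℤ)) := by ext e; simp [h e]
    refine ⟨fun _ => 1, by simp, fun e he => absurd he (hb.nl e), fun v => ?_⟩
    have h2 := hb.rv.star v
    rw [h1, cut_smul] at h2
    have := hb.tpos
    exact mul_left_cancel₀ this.ne' (by rw [h2]; simp)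
  · push Not at hd
    obtain ⟨d, hd, hd0⟩ := hd
    have hneg : ∃ e, d e < 0 := by
      by_contra hn
      push Not at hn
      apply hd0
      ext e
      have h1 := single_le_star d hn hb.nl e
      rw [hd] at h1
      have := hn e
      simp; omega
    obtain ⟨e0, he0⟩ := hneg
    obtain ⟨k, hk, hmin⟩ := argmin ((II V E).filter (fun i => ph s t i (d, 0) < 0))
      ⟨.inl e0, by simp [he0]⟩ (fun i => ph s t i (c, τ)) (fun i => - ph s t i (d, 0)) (by
        intro i hi
        have := (mem_filter.1 hi).2
        omega)
    have hkI := (mem_filter.1 hk).1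
    have hkd := (mem_filter.1 hk).2
    have hdW : ((d, 0) : (E → ℤ) × ℤ) ∈ WW s t := hd
    have hcW := mem_of_rv hb.rv
    obtain ⟨j, hj⟩ := bdry hb (p := (- ph s t k (d, 0)) • (c, τ) + ph s t k (c, τ) • (d, 0))
      ((WW s t).add_mem ((WW s t).zsmul_mem hcW _) ((WW s t).zsmul_mem hdW _)) (by
        intro i hi
        rw [map_add, map_zsmul, map_zsmul]
        have h1 := hb.interior i hi
        have h2 := hb.interior k hkI
        simp only [smul_eq_mul]
        by_cases hi' : ph s t i (d, 0) < 0
        · have := hmin i (mem_filter.2 ⟨hi, hi'⟩)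
          nlinarith
        · nlinarith) ⟨k, hkI, by rw [map_add, map_zsmul, map_zsmul]; simp only [smul_eq_mul]; ring⟩
    refine PM_of_closure hb.nev (σ := 2 ^ j * (-(ph s t k (d, 0)) * τ)) ?_ ?_ hj
    · have := hb.tpos
      have h2 : 0 < -(ph s t k (d, 0)) := by omega
      positivity
    · intro v
      rw [cut_smul]
      congr 1
      simp only [Prod.fst_add, Prod.smul_fst]
      rw [cut_add, cut_smul, cut_smul, hd, hb.rv.star]
      ring

lemma ratCone (hb : Brick s t c τ) {x : E → ℤ} {σ : ℤ} (hx : RV s t x σ) :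
    ∃ D : ℕ, 0 < D ∧ D • x ∈ AddSubmonoid.closure (PM s t) := by
  by_cases h0 : ∃ i ∈ II V E, ph s t i (x, σ) = 0
  · obtain ⟨k, hk⟩ := bdry hb (mem_of_rv hx) (cone_of_rv hx) h0
    refine ⟨2 ^ k, by positivity, ?_⟩
    rw [← natCast_zsmul]; push_cast; exact hk
  push Not at h0
  have hpos : ∀ i ∈ II V E, 0 < ph s t i (x, σ) := fun i hi =>
    lt_of_le_of_ne (cone_of_rv hx i hi) (Ne.symm (h0 i hi))
  obtain ⟨m, hm⟩ := exists_PM hb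
  have hmr := PM.rv hm
  have hme : ∃ e, 0 < m e := by
    by_contra hn
    push Not at hn
    obtain ⟨v⟩ := hb.nev
    have h1 : m = 0 := by
      ext e; have := hn e; have := hmr.nonneg e; simp; omega
    have := hmr.star v
    rw [h1] at this; simp at this
  obtain ⟨e0, he0⟩ := hme
  obtain ⟨k, hk, hmin⟩ := argmin ((II V E).filter (fun i => 0 < ph s t i (m, 1)))
    ⟨.inl e0, by simp [he0]⟩ (fun i => ph s t i (x, σ)) (fun i => ph s t i (m, 1))
    (fun i hi => (mem_filter.1 hi).2)
  have hkI := (mem_filter.1 hk).1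
  have hkd := (mem_filter.1 hk).2
  obtain ⟨j, hj⟩ := bdry hb (p := ph s t k (m, 1) • (x, σ) - ph s t k (x, σ) • (m, 1))
      ((WW s t).sub_mem ((WW s t).zsmul_mem (mem_of_rv hx) _) ((WW s t).zsmul_mem (mem_of_rv hmr) _)) (by
        intro i hi
        rw [map_sub, map_zsmul, map_zsmul]
        have h1 := hpos i hi
        have h2 := hpos k hkI
        have h3 := cone_of_rv hmr i hi
        simp only [smul_eq_mul]
        by_cases hi' : 0 < ph s t i (m, 1)
        · have := hmin i (mem_filter.2 ⟨hi, hi'⟩)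
          nlinarith
        · nlinarith) ⟨k, hkI, by rw [map_sub, map_zsmul, map_zsmul]; simp only [smul_eq_mul]; ring⟩
  have hxk := hpos k hkI
  set α := ph s t k (m, 1) with hα
  set β := ph s t k (x, σ) with hβ
  lift α to ℕ using hkd.le with α'
  lift β to ℕ using hxk.le with β'
  have hα' : 0 < α' := by exact_mod_cast hkd
  refine ⟨2 ^ j * α', by positivity, ?_⟩
  have h1 : (2 ^ j * α') • x = (2 ^ j : ℤ) • ((α' : ℤ) • (x, σ) - (β' : ℤ) • (m, (1:ℤ))).1 +
      (2 ^ j * β') • m := by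
    ext e; simp; ring
  rw [h1]
  exact AddSubmonoid.add_mem _ hj (AddSubmonoid.nsmul_mem _ (AddSubmonoid.subset_closure hm) _)

lemma combine (hb : Brick s t c τ) (h : ∃ j : ℕ, (2 ^ j : ℤ) • c ∈ AddSubgroup.closure (PM s t)) :
    ∃ k : ℕ, (2 ^ k : ℤ) • c ∈ AddSubmonoid.closure (PM s t) := by
  obtain ⟨j, hj⟩ := h
  have hrep : ∀ x ∈ AddSubgroup.closure (PM s t), ∃ u ∈ AddSubmonoid.closure (PM s t),
      ∃ w ∈ AddSubmonoid.closure (PM s t), x = u - w := by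
    intro x hx
    induction hx using AddSubgroup.closure_induction with
    | mem x h => exact ⟨x, AddSubmonoid.subset_closure h, 0, AddSubmonoid.zero_mem _, by simp⟩
    | zero => exact ⟨0, AddSubmonoid.zero_mem _, 0, AddSubmonoid.zero_mem _, by simp⟩
    | add x y _ _ hx hy =>
      obtain ⟨u, hu, w, hw, rfl⟩ := hx
      obtain ⟨u', hu', w', hw', rfl⟩ := hy
      exact ⟨u + u', add_mem hu hu', w + w', add_mem hw hw', by abel⟩
    | neg x _ hx =>
      obtain ⟨u, hu, w, hw, rfl⟩ := hx
      exact ⟨w, hw, u, hu, by abel⟩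
  obtain ⟨u, hu, w, hw, huw⟩ := hrep _ hj
  obtain ⟨σ, hσ⟩ := closure_rv hw
  obtain ⟨N, hN, hNI⟩ := bigN (II V E) (fun i => ph s t i (c, τ)) (fun i => - ph s t i (w, σ))
  have hrv := cone_rv hb (p := N • (c, τ) - (w, σ))
    ((WW s t).sub_mem ((WW s t).zsmul_mem (mem_of_rv hb.rv) _) (mem_of_rv hσ)) (by
      intro i hi
      have := hNI i hi (hb.interior i hi)
      rw [map_sub, map_zsmul]
      simp only [smul_eq_mul]; omega)
  obtain ⟨D, hD, hq⟩ := ratCone hb hrv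
  lift N to ℕ using hN.le with N'
  have hN' : 0 < N' := by exact_mod_cast hN
  set Q := D * N' with hQ
  have hQpos : 0 < Q := by positivity
  obtain ⟨m, hm⟩ : ∃ m : ℕ, Q * Q ≤ 2 ^ m := ⟨Q * Q, Nat.lt_two_pow_self.le⟩
  have hdiv : Q ≤ 2 ^ m / Q := (Nat.le_div_iff_mul_le hQpos).2 hm
  have hmod : 2 ^ m % Q < Q := Nat.mod_lt _ hQpos
  have hdm := Nat.div_add_mod (2 ^ m) Q
  set r := 2 ^ m % Q with hr
  set z := 2 ^ m / Q with hz
  refine ⟨j + m, ?_⟩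
  have hle : r ≤ 2 ^ j * z * D := by
    calc r ≤ z := by omega
      _ = 1 * z * 1 := by ring
      _ ≤ 2 ^ j * z * D := by gcongr; exact Nat.one_le_two_pow; omega
  have key : (2 ^ (j + m) : ℤ) • c = r • u + (2 ^ j * z * D - r) • w +
      (2 ^ j * z) • (D • ((N' : ℤ) • (c, τ) - (w, σ)).1) := by
    ext e
    have h1 := congrFun huw e
    simp at h1
    simp only [Pi.smul_apply, Pi.add_apply, smul_eq_mul, nsmul_eq_mul, Prod.fst_sub, Prod.smul_fst,
      Pi.sub_apply]
    have h2 : ((2 ^ j * z * D - r : ℕ) : ℤ) = 2 ^ j * z * D - r := by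
      rw [Nat.cast_sub hle]; push_cast; ring
    have h3 : (D * N' : ℤ) * z + r = 2 ^ m := by exact_mod_cast hdm
    simp only [nsmul_eq_mul, Pi.mul_apply, Pi.natCast_apply, h2]
    push_cast
    rw [pow_add]
    have h4 : ((N' : ℤ) • c - w) e = N' * c e - w e := by simp
    rw [h4]
    linear_combination r * h1 - 2 ^ j * c e * h3
  rw [key]
  exact add_mem (add_mem (AddSubmonoid.nsmul_mem _ hu _) (AddSubmonoid.nsmul_mem _ hw _))
    (AddSubmonoid.nsmul_mem _ hq _)

end brick

end TDD

namespace TDD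

section brick2
variable {V E : Type} [Fintype V] [Fintype E] {s t : E → V} {c : E → ℤ} {τ : ℤ}

lemma closure_split {y : E → ℤ} (hy : y ∈ AddSubmonoid.closure (PM s t)) :
    ∀ e, 0 < y e → ∃ M ∈ PM s t, 0 < M e ∧ ∃ z ∈ AddSubmonoid.closure (PM s t), y = M + z := by
  induction hy using AddSubmonoid.closure_induction with
  | mem x h => intro e he; exact ⟨x, h, he, 0, zero_mem _, by simp⟩
  | zero => intro e he; simp at he
  | add x y hx' hy' hx hy =>
    intro e he
    by_cases h : 0 < x e
    · obtain ⟨M, hM, hMe, z, hz, rfl⟩ := hx e h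
      exact ⟨M, hM, hMe, z + y, add_mem hz hy', by abel⟩
    · have : 0 < y e := by simp at he; omega
      obtain ⟨M, hM, hMe, z, hz, rfl⟩ := hy e this
      exact ⟨M, hM, hMe, x + z, add_mem hx' hz, by abel⟩

lemma exPM (hb : Brick s t c τ) {x : E → ℤ} {σ : ℤ} (hx : RV s t x σ) (e : E) (he : 0 < x e) :
    ∃ M ∈ PM s t, M e = 1 ∧ (∀ f, x f = 0 → M f = 0) ∧
      (∀ S : Finset V, Odd S.card → cut s t S x = σ → cut s t S M = 1) := by
  obtain ⟨D, hD, hDx⟩ := ratCone hb hx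
  obtain ⟨M, hM, hMe, z, hz, hyz⟩ := closure_split hDx e (by simp; positivity)
  have hMr := PM.rv hM
  obtain ⟨ζ, hζ⟩ := closure_rv hz
  refine ⟨M, hM, ?_, ?_, ?_⟩
  · have := single_le_star M hMr.nonneg hb.nl e
    rw [hMr.star] at this
    omega
  · intro f hf
    have := congrFun hyz f
    simp [hf] at this
    have h1 := hMr.nonneg f
    have h2 := hζ.nonneg f
    omega
  · intro S hS hSx
    have h1 : (D : ℤ) * σ = 1 + ζ := by
      have := congrArg (cut s t {s e}) hyz
      rwa [cut_nsmul, cut_add, hx.star, hMr.star, hζ.star] at this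
    have h2 := congrArg (cut s t S) hyz
    rw [cut_nsmul, cut_add, hSx] at h2
    have h3 := hMr.odd S hS
    have h4 := hζ.odd S hS
    omega

lemma Brick.exE (hb : Brick s t c τ) : Nonempty E := by
  by_contra hn
  rw [not_nonempty_iff] at hn
  obtain ⟨v⟩ := hb.nev
  have h1 := hb.rv.star v
  have h2 := hb.tpos
  simp [cut] at h1
  omega

lemma QD_pow {a : QD} {k : ℕ} (h : (2 ^ k : ℤ) • a = 0) : a = 0 := by
  induction k with
  | zero => simpa using h
  | succ k ih =>
    apply ih
    apply QD_two
    rw [smul_smul, ← pow_succ']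
    exact h

variable {ℓ : (E → ℤ) →+ QD}

lemma kill_closure (hℓ : ∀ m ∈ PM s t, ℓ m = 0) {y : E → ℤ}
    (hy : y ∈ AddSubmonoid.closure (PM s t)) : ℓ y = 0 := by
  induction hy using AddSubmonoid.closure_induction with
  | mem x h => exact hℓ x h
  | zero => simp
  | add x y _ _ hx hy => simp [hx, hy]

/-- facet points -/
structure FP (s t : E → V) (c : E → ℤ) (τ : ℤ) (x : (E → ℤ) × ℤ) (j : E ⊕ Finset V) : Prop where
  mem : x ∈ WW s t
  cone : ∀ i ∈ II V E, 0 ≤ ph s t i x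
  jI : j ∈ II V E
  zero : ph s t j x = 0
  prop : ∀ k ∈ II V E, ph s t k x = 0 → ∀ w ∈ WW s t,
    ph s t j (c, τ) * ph s t k w = ph s t k (c, τ) * ph s t j w

lemma kill_bdry (hb : Brick s t c τ) (hℓ : ∀ m ∈ PM s t, ℓ m = 0) {p : (E → ℤ) × ℤ} (hp : p ∈ WW s t)
    (h : ∀ i ∈ II V E, 0 ≤ ph s t i p) (h0 : ∃ i ∈ II V E, ph s t i p = 0) : ℓ p.1 = 0 := by
  obtain ⟨k, hk⟩ := bdry hb hp h h0
  have := kill_closure hℓ hk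
  rw [map_zsmul] at this
  exact QD_pow this

lemma facetKill (hb : Brick s t c τ) (hℓ : ∀ m ∈ PM s t, ℓ m = 0) {x : (E → ℤ) × ℤ}
    {j : E ⊕ Finset V} (hF : FP s t c τ x j) {d : (E → ℤ) × ℤ} (hd : d ∈ WW s t)
    (hjd : ph s t j d = 0) : ℓ d.1 = 0 := by
  obtain ⟨N, hN, hNI⟩ := bigN (II V E) (fun i => ph s t i x) (fun i => ph s t i d)
  have hjc := hb.interior j hF.jI
  have h1 : ℓ (N • x + d).1 = 0 := by
    refine kill_bdry hb hℓ ((WW s t).add_mem ((WW s t).zsmul_mem hF.mem _) hd) ?_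
      ⟨j, hF.jI, by rw [map_add, map_zsmul, hF.zero, hjd]; simp⟩
    intro i hi
    rw [map_add, map_zsmul]
    rcases (hF.cone i hi).lt_or_eq with h | h
    · exact (hNI i hi h).le
    · have := hF.prop i hi h.symm d hd
      rw [hjd, mul_zero] at this
      have h2 : ph s t i d = 0 := by
        rcases mul_eq_zero.1 this with h3 | h3
        · omega
        · exact h3
      rw [← h, h2]; simp
  have h2 : ℓ x.1 = 0 := kill_bdry hb hℓ hF.mem hF.cone ⟨j, hF.jI, hF.zero⟩
  rw [Prod.fst_add, Prod.smul_fst, map_add, map_zsmul, h2, smul_zero, zero_add] at h1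
  exact h1

lemma edgeFacet (hb : Brick s t c τ) (hℓ : ∀ m ∈ PM s t, ℓ m = 0) {x : (E → ℤ) × ℤ}
    {j : E ⊕ Finset V} (hF : FP s t c τ x j) {f : E} (hf : x.1 f = 0) : ℓ c = 0 := by
  obtain ⟨M, hM, hMf, -, -⟩ := exPM hb hb.rv f (hb.pos f)
  have hMr := PM.rv hM
  have hd : (c, τ) - c f • (M, (1:ℤ)) ∈ WW s t :=
    (WW s t).sub_mem (mem_of_rv hb.rv) ((WW s t).zsmul_mem (mem_of_rv hMr) _)
  have h1 := hF.prop (.inl f) (by simp) hf _ hd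
  have h2 : ph s t (.inl f) ((c, τ) - c f • (M, (1:ℤ))) = 0 := by
    simp [hMf]
  rw [h2, mul_zero] at h1
  have h3 : ph s t j ((c, τ) - c f • (M, (1:ℤ))) = 0 := by
    have := hb.pos f
    rcases mul_eq_zero.1 h1.symm with h3 | h3
    · simp at h3; omega
    · exact h3
  have h4 := facetKill hb hℓ hF hd h3
  rw [Prod.fst_sub, Prod.smul_fst, map_sub, map_zsmul, hℓ M hM, smul_zero, sub_zero] at h4
  exact h4

lemma FP.rv (hb : Brick s t c τ) {x : (E → ℤ) × ℤ} {j : E ⊕ Finset V} (hF : FP s t c τ x j) :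
    RV s t x.1 x.2 := cone_rv hb hF.mem hF.cone

lemma FP_pot (hb : Brick s t c τ) (hℓ : ∀ m ∈ PM s t, ℓ m = 0) (hc : ℓ c ≠ 0) {x : (E → ℤ) × ℤ}
    {S : Finset V} (hF : FP s t c τ x (.inr S)) :
    NT S ∧ (∀ e, 0 < x.1 e) ∧ cut s t S x.1 = x.2 ∧ ∃ (a : QD) (b : V → QD), a ≠ 0 ∧
      (∀ e, ℓ (Pi.single e 1) = cr s t S e • a + (b (s e) + b (t e))) ∧
      ∀ M ∈ PM s t, (cut s t S M - 1) • a = 0 := by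
  have hS : NT S := by simpa using hF.jI
  have hpos : ∀ e, 0 < x.1 e := by
    intro e
    rcases ((hF.rv hb).nonneg e).lt_or_eq with h | h
    · exact h
    · exact absurd (edgeFacet hb hℓ hF h.symm) hc
  have htight : cut s t S x.1 = x.2 := by simpa [sub_eq_zero] using hF.zero
  refine ⟨hS, hpos, htight, ?_⟩
  obtain ⟨a, b, hab⟩ := potentials hb.nl S ℓ (by
    intro d h1 h2
    exact facetKill hb hℓ hF (d := (d, 0)) h1 (by simp [h2]))
  have hev := hom_eval hb.nl S ℓ a b hab
  obtain ⟨e⟩ := hb.exE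
  obtain ⟨M0, hM0, -, -, hM0S⟩ := exPM hb (hF.rv hb) e (hpos e)
  have hM0S := hM0S S hS.1 htight
  have hM : ∀ M ∈ PM s t, cut s t S M • a + ∑ v, b v = 0 := by
    intro M hM
    have := hev M
    rw [hℓ M hM] at this
    simp only [(PM.rv hM).star, one_smul] at this
    exact this.symm
  refine ⟨a, b, ?_, hab, ?_⟩
  · rintro rfl
    apply hc
    have h1 := hM M0 hM0
    rw [smul_zero, zero_add] at h1
    rw [hev c]
    simp only [hb.rv.star, smul_zero, zero_add]
    rw [← smul_sum, h1, smul_zero]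
  · intro M hM'
    have h1 := hM M0 hM0
    have h2 := hM M hM'
    rw [hM0S] at h1
    rw [sub_smul, sub_eq_zero]
    exact add_right_cancel (h2.trans h1.symm)

/-- ridge data -/
structure RD (s t : E → V) (c : E → ℤ) (τ : ℤ) where
  S : Finset V
  S' : Finset V
  ntS : NT S
  ntS' : NT S'
  x1 : E → ℤ
  x2 : E → ℤ
  x3 : E → ℤ
  τ1 : ℤ
  τ2 : ℤ
  τ3 : ℤ
  rv1 : RV s t x1 τ1
  rv2 : RV s t x2 τ2
  rv3 : RV s t x3 τ3
  pos1 : ∀ e, 0 < x1 e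
  pos3 : ∀ e, 0 < x3 e
  t1 : cut s t S x1 = τ1
  t1' : τ1 < cut s t S' x1
  t2 : cut s t S x2 = τ2
  t2' : cut s t S' x2 = τ2
  t3 : τ3 < cut s t S x3
  t3' : cut s t S' x3 = τ3
  zr : ∀ f, x2 f = 0 → ∃ p q r : ℤ, 0 < p ∧ 0 < q ∧ 0 < r ∧ ∀ x σ, (∀ v, cut s t {v} x = σ) →
    p * x f = q * (cut s t S x - σ) + r * (cut s t S' x - σ)
  a : QD
  a' : QD
  b : V → QD
  ha : a ≠ 0
  ha' : a' ≠ 0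
  id : ∀ e, cr s t S e • a + cr s t S' e • a' = b (s e) + b (t e)
  hS : ∀ M ∈ PM s t, (cut s t S M - 1) • a = 0
  hS' : ∀ M ∈ PM s t, (cut s t S' M - 1) • a' = 0

/-- symmetry -/
def RD.swap (d : RD s t c τ) : RD s t c τ where
  S := d.S'
  S' := d.S
  ntS := d.ntS'
  ntS' := d.ntS
  x1 := d.x3
  x2 := d.x2
  x3 := d.x1
  τ1 := d.τ3
  τ2 := d.τ2
  τ3 := d.τ1
  rv1 := d.rv3
  rv2 := d.rv2
  rv3 := d.rv1
  pos1 := d.pos3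
  pos3 := d.pos1
  t1 := d.t3'
  t1' := d.t3
  t2 := d.t2'
  t2' := d.t2
  t3 := d.t1'
  t3' := d.t1
  zr := by
    intro f hf
    obtain ⟨p, q, r, hp, hq, hr, h⟩ := d.zr f hf
    exact ⟨p, r, q, hp, hr, hq, fun x σ hx => by rw [h x σ hx]; ring⟩
  a := d.a'
  a' := d.a
  b := d.b
  ha := d.ha'
  ha' := d.ha
  id := fun e => by rw [← d.id]; abel
  hS := d.hS'
  hS' := d.hS

/-- complementing the second cut -/
noncomputable def RD.compl (d : RD s t c τ) (hV : Even (Fintype.card V)) : RD s t c τ where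
  S := d.S
  S' := d.S'ᶜ
  ntS := d.ntS
  ntS' := d.ntS'.compl hV
  x1 := d.x1
  x2 := d.x2
  x3 := d.x3
  τ1 := d.τ1
  τ2 := d.τ2
  τ3 := d.τ3
  rv1 := d.rv1
  rv2 := d.rv2
  rv3 := d.rv3
  pos1 := d.pos1
  pos3 := d.pos3
  t1 := d.t1
  t1' := by rw [cut_compl]; exact d.t1'
  t2 := d.t2
  t2' := by rw [cut_compl]; exact d.t2'
  t3 := d.t3
  t3' := by rw [cut_compl]; exact d.t3'
  zr := by simp only [cut_compl]; exact d.zr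
  a := d.a
  a' := d.a'
  b := d.b
  ha := d.ha
  ha' := d.ha'
  id := by simp only [cr_compl]; exact d.id
  hS := d.hS
  hS' := by simp only [cut_compl]; exact d.hS'

lemma exists_RD (hb : Brick s t c τ) (hℓ : ∀ m ∈ PM s t, ℓ m = 0) (hc : ℓ c ≠ 0) :
    Nonempty (RD s t c τ) := by
  obtain ⟨e0⟩ := hb.exE
  have hcW : (c, τ) ∈ WW s t := mem_of_rv hb.rv
  obtain ⟨x1, h1W, h1, ⟨i0, hi0, hi0x⟩, hpr⟩ := facet (WW s t) (ph s t) (II V E)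
    ⟨.inl e0, by simp⟩ (c, τ) hcW hb.interior
  have hF1 : FP s t c τ x1 i0 := ⟨h1W, h1, hi0, hi0x, fun k hk hkx w hw => hpr i0 hi0 k hk hi0x hkx w hw⟩
  obtain f | S := i0
  · exact absurd (edgeFacet hb hℓ hF1 (f := f) hi0x) hc
  obtain ⟨hS, hpos1, ht1, a, b1, ha, hab1, htor1⟩ := FP_pot hb hℓ hc hF1
  obtain ⟨x2, h2W, j0, hj0, x3, h3W, h2, h2i, h2j, h1j, hZ, h3, h3j, h3i, hpr3⟩ :=
    ridge (WW s t) (ph s t) (II V E) (c, τ) hcW hb.interior x1 h1W h1 (.inr S) hi0 hi0x hF1.prop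
    ⟨.inl e0, by simp, hpos1 e0⟩
  have hF3 : FP s t c τ x3 j0 := ⟨h3W, h3, hj0, h3j, hpr3⟩
  obtain f | S' := j0
  · exact absurd (edgeFacet hb hℓ hF3 (f := f) h3j) hc
  obtain ⟨hS', hpos3, ht3, a2, b2, ha2, hab2, htor2⟩ := FP_pot hb hℓ hc hF3
  simp only [ph_inr] at h2i h2j h1j h3i
  refine ⟨{ S := S, S' := S', ntS := hS, ntS' := hS', x1 := x1.1, x2 := x2.1, x3 := x3.1
            τ1 := x1.2, τ2 := x2.2, τ3 := x3.2, rv1 := hF1.rv hb, rv2 := cone_rv hb h2W h2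
            rv3 := hF3.rv hb, pos1 := hpos1, pos3 := hpos3, t1 := ht1, t1' := by linarith
            t2 := by linarith, t2' := by linarith, t3 := by linarith, t3' := ht3
            zr := ?_, a := a, a' := -a2, b := fun v => b2 v - b1 v, ha := ha
            ha' := by simpa using ha2, id := ?_, hS := htor1, hS' := ?_ }⟩
  · intro f hf
    obtain ⟨p, q, r, hp, hq, hr, h⟩ := hZ (.inl f) (by simp) (by simpa using hf)
    have e1 := h x1 h1W
    have e3 := h x3 h3W
    simp only [ph_inl, ph_inr, ht1, sub_self, mul_zero, zero_add] at e1
    simp only [ph_inl, ph_inr, ht3, sub_self, mul_zero, add_zero] at e3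
    refine ⟨p, q, r, hp, ?_, ?_, ?_⟩
    · rcases hq.lt_or_eq with h | h
      · exact h
      · rw [← h] at e3
        have := mul_pos hp (hpos3 f)
        rw [e3] at this
        simp at this
    · rcases hr.lt_or_eq with h | h
      · exact h
      · rw [← h] at e1
        have := mul_pos hp (hpos1 f)
        rw [e1] at this
        simp at this
    · intro x σ hx
      have := h (x, σ) hx
      simpa using this
  · intro e
    have h1 := hab1 e
    have h2 := hab2 e
    rw [h1] at h2
    rw [smul_neg]
    have : cr s t S e • a - cr s t S' e • a2 = (b2 (s e) + b2 (t e)) - (b1 (s e) + b1 (t e)) := by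
      rw [sub_eq_sub_iff_add_eq_add, h2]; abel
    rw [← sub_eq_add_neg, this]; abel
  · intro M hM
    rw [smul_neg, htor2 M hM, neg_zero]

theorem brick_main (hb : Brick s t c τ) (hRD : RD s t c τ → False) :
    ∃ k : ℕ, (2 ^ k : ℤ) • c ∈ AddSubmonoid.closure (PM s t) := by
  apply combine hb
  apply separate
  intro ℓ hℓ
  by_contra hc
  obtain ⟨d⟩ := exists_RD hb (fun m hm => hℓ m (AddSubgroup.subset_closure hm)) hc
  exact hRD d

end brick2

end TDD

namespace TDD

section tools
variable {V E : Type} [Fintype V] [Fintype E] {s t : E → V} {c : E → ℤ} {τ : ℤ}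

/-- `e` joins `u` and `v`. -/
def J (s t : E → V) (e : E) (u v : V) : Prop := (s e = u ∧ t e = v) ∨ (s e = v ∧ t e = u)

lemma J.symm {e : E} {u v : V} (h : J s t e u v) : J s t e v u := Or.symm h
lemma J.st (e : E) : J s t e (s e) (t e) := Or.inl ⟨rfl, rfl⟩
lemma J.ts (e : E) : J s t e (t e) (s e) := Or.inr ⟨rfl, rfl⟩

lemma cr_eq_zero_iff {S : Finset V} {e : E} : cr s t S e = 0 ↔ (s e ∈ S ↔ t e ∈ S) := by
  unfold cr; split_ifs with h <;> simp [h]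

lemma cr_eq_one_iff {S : Finset V} {e : E} : cr s t S e = 1 ↔ ¬ (s e ∈ S ↔ t e ∈ S) := by
  unfold cr; split_ifs with h <;> simp [h]

lemma nocross_of_cut {X : Finset V} {x : E → ℤ} (hx : ∀ e, 0 ≤ x e) (h : cut s t X x ≤ 0) (e : E)
    (he : 0 < x e) : cr s t X e = 0 := by
  have h0 : ∀ e ∈ univ, 0 ≤ cr s t X e * x e := fun e _ => mul_nonneg (cr_nonneg X e) (hx e)
  have h1 : ∑ e, cr s t X e * x e = 0 := le_antisymm h (sum_nonneg h0)
  have := (sum_eq_zero_iff_of_nonneg h0).1 h1 e (mem_univ e)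
  rcases mul_eq_zero.1 this with h | h
  · exact h
  · omega

lemma Brick.conn (hb : Brick s t c τ) (h6 : 6 ≤ Fintype.card V) {X : Finset V}
    (h : ∀ e, cr s t X e = 0) : X = ∅ ∨ X = univ := by
  have hV := hb.rv.even_card hb.tpos
  have hτ := hb.tpos
  by_contra hn
  push Not at hn
  -- key: an even nonempty proper set without crossing edges has complement of size 2
  have key : ∀ Y : Finset V, (∀ e, cr s t Y e = 0) → Y.Nonempty → Y ≠ univ → Yᶜ.card = 2 := by
    intro Y hY hne hun
    have hYe : Even Y.card := by
      by_contra ho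
      have h1 := hb.rv.odd Y (Nat.not_even_iff_odd.1 ho)
      have h2 : cut s t Y c = 0 := cut_eq_zero_of (fun e => by simp [hY e])
      omega
    obtain ⟨v, hv⟩ : ∃ v, v ∉ Y := by
      by_contra hcon
      push Not at hcon
      exact hun (eq_univ_iff_forall.2 hcon)
    have hcard := card_insert_of_notMem hv
    have h1 : cut s t (insert v Y) c = τ := by
      rw [← hb.rv.star v]
      unfold cut
      refine sum_congr rfl fun e _ => ?_
      congr 1
      have h5 := cr_eq_zero_iff.1 (hY e)
      have h6 := hb.nl e
      unfold cr
      simp only [mem_insert, mem_singleton]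
      by_cases h7 : s e = v
      · have h8 : t e ≠ v := fun h => h6 (h7.trans h.symm)
        have h9 : t e ∉ Y := fun h => hv (h7 ▸ h5.2 h)
        simp [h7, h8, h9]
      · by_cases h8 : t e = v
        · have h9 : s e ∉ Y := fun h => hv (h8 ▸ h5.1 h)
          simp [h7, h8, h9]
        · simp [h7, h8, h5]
    have h2 : ¬ NT (insert v Y) := by
      intro hnt
      have := hb.strict _ hnt
      omega
    have hodd : Odd (insert v Y).card := by rw [hcard]; exact hYe.add_one
    have hodd2 := odd_compl hV hodd
    have hpos := hne.card_pos
    have e1 := card_compl (insert v Y)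
    have e2 := card_compl Y
    have e3 := card_le_univ (insert v Y)
    obtain ⟨k, hk⟩ := hYe
    obtain ⟨l, hl⟩ := hodd2
    by_contra hcon
    exact h2 ⟨hodd, by omega, by omega⟩
  have h1 := key X h hn.1 hn.2
  have h2 := key Xᶜ (fun e => by rw [cr_compl, h e]) (card_pos.1 (by omega)) (by
    rw [Ne, compl_eq_univ_iff]; exact hn.1.ne_empty)
  rw [compl_compl] at h2
  have := card_compl X
  omega

lemma Brick.bip (hb : Brick s t c τ) {x : E → ℤ} {σ : ℤ} (hx : RV s t x σ) (hσ : 0 < σ)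
    (hpos : ∀ e, 0 < x e) {A : Finset V} (hA : NT A) (hAx : cut s t A x = σ) (b : V → ℤ)
    (hb1 : ∀ e, |b (s e) + b (t e)| ≤ cr s t A e) (hb2 : ∑ v, b v ≠ 0) : False := by
  wlog hp : 0 < ∑ v, b v generalizing b
  · refine this (fun v => - b v) (fun e => ?_) ?_ ?_
    · rw [← neg_add, abs_neg]; exact hb1 e
    · simpa using hb2
    · simp; omega
  have hpt := pot (s := s) (t := t) x hx.loop b
  simp only [hx.star, smul_eq_mul] at hpt
  rw [← mul_sum] at hpt
  have hle : ∀ e, x e * (b (s e) + b (t e)) ≤ cr s t A e * x e := by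
    intro e
    rw [mul_comm]
    exact mul_le_mul_of_nonneg_right ((le_abs_self _).trans (hb1 e)) (hx.nonneg e)
  have hsum : ∑ e, x e * (b (s e) + b (t e)) ≤ ∑ e, cr s t A e * x e := sum_le_sum fun e _ => hle e
  have hsum2 : ∑ e, cr s t A e * x e = σ := hAx
  have h1 : ∑ v, b v = 1 := by
    have : σ * ∑ v, b v ≤ σ * 1 := by linarith
    have := le_of_mul_le_mul_left this hσ
    omega
  have heq : ∑ e, x e * (b (s e) + b (t e)) = ∑ e, cr s t A e * x e := by
    rw [← hpt, h1, hsum2]; ring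
  have hpw := (sum_eq_sum_iff_of_le (fun e _ => hle e)).1 heq
  have hcr : ∀ e, b (s e) + b (t e) = cr s t A e := by
    intro e
    have := hpw e (mem_univ e)
    rw [mul_comm] at this
    exact mul_right_cancel₀ (hpos e).ne' this
  have hpt2 := pot (s := s) (t := t) c hb.rv.loop b
  simp only [hb.rv.star, smul_eq_mul] at hpt2
  rw [← mul_sum, h1] at hpt2
  have hs := hb.strict A hA
  unfold cut at hs
  have : ∑ e, c e * (b (s e) + b (t e)) = ∑ e, cr s t A e * c e :=
    sum_congr rfl fun e _ => by rw [hcr e, mul_comm]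
  omega

lemma odd_sum_pm {A : Finset V} (b : V → ℤ) (h1 : ∀ v ∈ A, b v = 1 ∨ b v = -1)
    (h2 : ∀ v, v ∉ A → b v = 0) : Even (∑ v, b v - A.card) := by
  have : ∑ v, b v = ∑ v ∈ A, b v := (sum_subset (subset_univ A) (fun v _ hv => h2 v hv)).symm
  rw [this, card_eq_sum_ones]
  push_cast
  rw [← sum_sub_distrib]
  refine even_sum _ fun v hv => ?_
  rcases h1 v hv with h | h <;> rw [h] <;> decide

lemma Brick.bip' (hb : Brick s t c τ) {x : E → ℤ} {σ : ℤ} (hx : RV s t x σ) (hσ : 0 < σ)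
    (hpos : ∀ e, 0 < x e) {A : Finset V} (hA : NT A) (hAx : cut s t A x = σ) (b : V → ℤ)
    (h1 : ∀ v ∈ A, b v = 1 ∨ b v = -1)
    (h3 : ∀ e, s e ∈ A → t e ∈ A → b (s e) + b (t e) = 0) : False := by
  set b' : V → ℤ := fun v => if v ∈ A then b v else 0 with hb'
  refine hb.bip hx hσ hpos hA hAx b' ?_ ?_
  · intro e
    by_cases hs : s e ∈ A <;> by_cases ht : t e ∈ A
    · simp [hb', hs, ht, h3 e hs ht, cr]
    · rcases h1 _ hs with h | h <;> simp [hb', hs, ht, cr, h]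
    · rcases h1 _ ht with h | h <;> simp [hb', hs, ht, cr, h]
    · simp [hb', hs, ht, cr]
  · intro h0
    have := odd_sum_pm (A := A) b' (fun v hv => by simpa [hb', hv] using h1 v hv)
      (fun v hv => by simp [hb', hv])
    rw [h0, zero_sub, even_neg] at this
    have h2 : Even A.card := by exact_mod_cast this
    exact (Nat.not_even_iff_odd.2 hA.1) h2

lemma Brick.one (hb : Brick s t c τ) (h6 : 6 ≤ Fintype.card V) {x : E → ℤ} {σ : ℤ}
    (hx : RV s t x σ) (hσ : 0 < σ)
    (hpos : ∀ e, 0 < x e) {A X : Finset V} (hA : Odd A.card) (hAx : cut s t A x = σ)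
    (hdis : Disjoint X A) (hedge : ∀ e u v, J s t e u v → u ∈ X → v ∉ X → v ∈ A)
    (hne : X ∪ A ≠ univ) : X = ∅ := by
  have hcr : ∀ e, cr s t (X ∪ A) e = cr s t A e - cr s t X e := by
    intro e
    have e1 := hedge e _ _ (J.st e)
    have e2 := hedge e _ _ (J.ts e)
    have d1 : ∀ v, v ∈ X → v ∉ A := fun v h1 h2 => disjoint_left.1 hdis h1 h2
    have d2 := d1 (s e)
    have d3 := d1 (t e)
    unfold cr
    simp only [mem_union]
    by_cases h1 : s e ∈ X <;> by_cases h2 : t e ∈ X <;> by_cases h3 : s e ∈ A <;>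
      by_cases h4 : t e ∈ A <;> simp_all
  have hcut : cut s t (X ∪ A) x = σ - cut s t X x := by
    rw [← hAx]
    unfold cut
    rw [← sum_sub_distrib]
    exact sum_congr rfl fun e _ => by rw [hcr]; ring
  have hXu : X ≠ univ := by
    rintro rfl
    exact hne (by simp)
  by_cases ho : Odd X.card
  · exfalso
    have h1 := hx.odd X ho
    have h2 : cut s t (X ∪ A) x ≤ 0 := by omega
    rcases hb.conn h6 (X := X ∪ A) (fun e => nocross_of_cut hx.nonneg h2 e (hpos e)) with h | h
    · have : X = ∅ := by
        rw [union_eq_empty] at h; exact h.1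
      rw [this] at ho
      simp at ho
    · exact hne h
  · have h1 := hx.odd (X ∪ A) (by
      rw [card_union_of_disjoint hdis]
      exact (Nat.not_odd_iff_even.1 ho).add_odd hA)
    have h2 : cut s t X x ≤ 0 := by omega
    rcases hb.conn h6 (X := X) (fun e => nocross_of_cut hx.nonneg h2 e (hpos e)) with h | h
    · exact h
    · exact absurd h hXu

lemma QD_eq_neg {a : QD} (h : a = -a) : a = 0 := by
  apply QD_two
  rw [two_smul]
  nth_rewrite 1 [h]
  simp

lemma Brick.const0 (hb : Brick s t c τ) (h6 : 6 ≤ Fintype.card V) {x : E → ℤ} {σ : ℤ}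
    (hx : RV s t x σ) (hσ : 0 < σ)
    (hpos : ∀ e, 0 < x e) {A : Finset V} (hA : NT A) (hAx : cut s t A x = σ) (b : V → QD)
    (hin : ∀ e, s e ∈ A → t e ∈ A → b (s e) + b (t e) = 0) : ∀ v ∈ A, b v = 0 := by
  intro v0 hv0
  by_contra hne
  set a := b v0 with ha
  set Y := A.filter (fun v => b v = a ∨ b v = -a) with hY
  have hYA : Y ⊆ A := filter_subset _ _
  have hv0Y : v0 ∈ Y := by simp [hY, hv0, ha]
  have hclosed : ∀ e, s e ∈ A → t e ∈ A → (s e ∈ Y ↔ t e ∈ Y) := by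
    intro e h1 h2
    have h3 : b (s e) = - b (t e) := eq_neg_of_add_eq_zero_left (hin e h1 h2)
    simp only [hY, mem_filter, h1, h2, true_and, h3]
    rw [neg_inj, neg_eq_iff_eq_neg]
    exact or_comm
  have hcr : ∀ e, cr s t A e = cr s t Y e + cr s t (A \ Y) e := by
    intro e
    have h1 := hclosed e
    have h2 := @hYA (s e)
    have h3 := @hYA (t e)
    unfold cr
    simp only [mem_sdiff]
    by_cases h4 : s e ∈ A <;> by_cases h5 : t e ∈ A <;> by_cases h6 : s e ∈ Y <;>
      by_cases h7 : t e ∈ Y <;> simp_all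
  have hcut : cut s t A x = cut s t Y x + cut s t (A \ Y) x := by
    unfold cut
    rw [← sum_add_distrib]
    exact sum_congr rfl fun e _ => by rw [hcr]; ring
  have hcard := card_sdiff_add_card_eq_card hYA
  have hAu : A ≠ univ := by
    rintro rfl
    have := hA.2.2
    simp at this
  by_cases ho : Odd Y.card
  · have h1 := hx.odd Y ho
    have h2 : cut s t (A \ Y) x ≤ 0 := by omega
    rcases hb.conn h6 (X := A \ Y) (fun e => nocross_of_cut hx.nonneg h2 e (hpos e)) with h | h
    · have hAY : A = Y := subset_antisymm (sdiff_eq_empty_iff_subset.1 h) hYA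
      have hna : a ≠ -a := fun h => hne (QD_eq_neg h)
      refine hb.bip' hx hσ hpos hA hAx (fun v => if b v = a then 1 else -1) ?_ ?_
      · intro v hv
        split_ifs <;> simp
      · intro e h1 h2
        have h3 : b (s e) = - b (t e) := eq_neg_of_add_eq_zero_left (hin e h1 h2)
        have h4 : b (t e) = a ∨ b (t e) = -a := by
          rw [hAY] at h2; exact (mem_filter.1 h2).2
        rcases h4 with h4 | h4
        · simp [h3, h4, hna.symm]
        · simp [h3, h4, hna.symm]
    · exact hAu (univ_subset_iff.1 (h ▸ sdiff_subset))
  · have h0 : Odd (A \ Y).card := by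
      have := hA.1
      rw [← hcard] at this
      by_contra hcon
      exact (Nat.not_even_iff_odd.2 this) ((Nat.not_odd_iff_even.1 hcon).add (Nat.not_odd_iff_even.1 ho))
    have h1 := hx.odd _ h0
    have h2 : cut s t Y x ≤ 0 := by omega
    rcases hb.conn h6 (X := Y) (fun e => nocross_of_cut hx.nonneg h2 e (hpos e)) with h | h
    · rw [h] at hv0Y; simp at hv0Y
    · exact hAu (univ_subset_iff.1 (h ▸ hYA))

lemma Brick.constA (hb : Brick s t c τ) (h6 : 6 ≤ Fintype.card V) {x : E → ℤ} {σ : ℤ}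
    (hx : RV s t x σ) (hσ : 0 < σ)
    (hpos : ∀ e, 0 < x e) {A : Finset V} (hA : Odd A.card) (hA3 : 3 ≤ Aᶜ.card)
    (hAx : cut s t A x = σ) (b : V → QD)
    (hin : ∀ e, s e ∈ A → t e ∈ A → b (s e) + b (t e) = 0) :
    ∃ a0, (∀ v ∈ A, b v = a0) ∧ (A.card ≠ 1 → a0 = 0) := by
  by_cases h1 : A.card = 1
  · obtain ⟨v, rfl⟩ := card_eq_one.1 h1
    exact ⟨b v, by simp, by simp⟩
  · refine ⟨0, hb.const0 h6 hx hσ hpos ⟨hA, ?_, hA3⟩ hAx b hin, fun _ => rfl⟩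
    obtain ⟨k, hk⟩ := hA
    omega

end tools

end TDD

namespace TDD

section case2
variable {V E : Type} [Fintype V] [Fintype E] {s t : E → V} {c : E → ℤ} {τ : ℤ}

/-- join indicator -/
noncomputable def jn (s t : E → V) (X Y : Finset V) (e : E) : ℤ :=
  if (s e ∈ X ∧ t e ∈ Y) ∨ (s e ∈ Y ∧ t e ∈ X) then 1 else 0

/-- weight between two sets -/
noncomputable def ew (s t : E → V) (X Y : Finset V) (x : E → ℤ) : ℤ := ∑ e, jn s t X Y e * x e

lemma jn_nonneg (X Y : Finset V) (e : E) : 0 ≤ jn s t X Y e := by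
  unfold jn; split_ifs <;> simp

lemma ew_nonneg (X Y : Finset V) {x : E → ℤ} (hx : ∀ e, 0 ≤ x e) : 0 ≤ ew s t X Y x :=
  sum_nonneg fun e _ => mul_nonneg (jn_nonneg X Y e) (hx e)

lemma jn_zero_of_ew {X Y : Finset V} {x : E → ℤ} (hx : ∀ e, 0 < x e) (h : ew s t X Y x ≤ 0) (e : E) :
    jn s t X Y e = 0 := by
  have h0 : ∀ e ∈ univ, 0 ≤ jn s t X Y e * x e := fun e _ => mul_nonneg (jn_nonneg X Y e) (hx e).le
  have h1 : ∑ e, jn s t X Y e * x e = 0 := le_antisymm h (sum_nonneg h0)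
  have := (sum_eq_zero_iff_of_nonneg h0).1 h1 e (mem_univ e)
  rcases mul_eq_zero.1 this with h | h
  · exact h
  · have := hx e; omega

lemma ew_zero_of_jn {X Y : Finset V} {x : E → ℤ} (h : ∀ e, jn s t X Y e = 0) : ew s t X Y x = 0 :=
  sum_eq_zero fun e _ => by rw [h e, zero_mul]

section quad
variable (S S' : Finset V)

lemma crA (e : E) : cr s t (S ∩ S') e = jn s t (S ∩ S') (S \ S') e + jn s t (S ∩ S') (S' \ S) e +
    jn s t (S ∩ S') (S ∪ S')ᶜ e := by
  unfold cr jn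
  simp only [mem_inter, mem_sdiff, mem_compl, mem_union]
  by_cases h1 : s e ∈ S <;> by_cases h2 : t e ∈ S <;> by_cases h3 : s e ∈ S' <;>
    by_cases h4 : t e ∈ S' <;> simp [h1, h2, h3, h4]

lemma crD (e : E) : cr s t (S ∪ S')ᶜ e = jn s t (S ∪ S')ᶜ (S \ S') e + jn s t (S ∪ S')ᶜ (S' \ S) e +
    jn s t (S ∩ S') (S ∪ S')ᶜ e := by
  unfold cr jn
  simp only [mem_inter, mem_sdiff, mem_compl, mem_union]
  by_cases h1 : s e ∈ S <;> by_cases h2 : t e ∈ S <;> by_cases h3 : s e ∈ S' <;>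
    by_cases h4 : t e ∈ S' <;> simp [h1, h2, h3, h4]

lemma crB (e : E) : cr s t (S \ S') e = jn s t (S ∩ S') (S \ S') e + jn s t (S ∪ S')ᶜ (S \ S') e +
    jn s t (S \ S') (S' \ S) e := by
  unfold cr jn
  simp only [mem_inter, mem_sdiff, mem_compl, mem_union]
  by_cases h1 : s e ∈ S <;> by_cases h2 : t e ∈ S <;> by_cases h3 : s e ∈ S' <;>
    by_cases h4 : t e ∈ S' <;> simp [h1, h2, h3, h4]

lemma crS (e : E) : cr s t S e = jn s t (S ∩ S') (S' \ S) e + jn s t (S ∩ S') (S ∪ S')ᶜ e +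
    jn s t (S \ S') (S' \ S) e + jn s t (S ∪ S')ᶜ (S \ S') e := by
  unfold cr jn
  simp only [mem_inter, mem_sdiff, mem_compl, mem_union]
  by_cases h1 : s e ∈ S <;> by_cases h2 : t e ∈ S <;> by_cases h3 : s e ∈ S' <;>
    by_cases h4 : t e ∈ S' <;> simp [h1, h2, h3, h4]

lemma crS' (e : E) : cr s t S' e = jn s t (S ∩ S') (S \ S') e + jn s t (S ∩ S') (S ∪ S')ᶜ e +
    jn s t (S \ S') (S' \ S) e + jn s t (S ∪ S')ᶜ (S' \ S) e := by
  unfold cr jn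
  simp only [mem_inter, mem_sdiff, mem_compl, mem_union]
  by_cases h1 : s e ∈ S <;> by_cases h2 : t e ∈ S <;> by_cases h3 : s e ∈ S' <;>
    by_cases h4 : t e ∈ S' <;> simp [h1, h2, h3, h4]

variable (x : E → ℤ)
lemma cutA : cut s t (S ∩ S') x = ew s t (S ∩ S') (S \ S') x + ew s t (S ∩ S') (S' \ S) x +
    ew s t (S ∩ S') (S ∪ S')ᶜ x := by
  unfold cut ew
  simp only [← sum_add_distrib, ← add_mul, crA S S']

lemma cutD : cut s t (S ∪ S')ᶜ x = ew s t (S ∪ S')ᶜ (S \ S') x + ew s t (S ∪ S')ᶜ (S' \ S) x +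
    ew s t (S ∩ S') (S ∪ S')ᶜ x := by
  unfold cut ew
  simp only [← sum_add_distrib, ← add_mul, crD S S']

lemma cutS : cut s t S x = ew s t (S ∩ S') (S' \ S) x + ew s t (S ∩ S') (S ∪ S')ᶜ x +
    ew s t (S \ S') (S' \ S) x + ew s t (S ∪ S')ᶜ (S \ S') x := by
  unfold cut ew
  simp only [← sum_add_distrib, ← add_mul]
  exact sum_congr rfl fun e _ => by rw [crS S S']

lemma cutS' : cut s t S' x = ew s t (S ∩ S') (S \ S') x + ew s t (S ∩ S') (S ∪ S')ᶜ x +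
    ew s t (S \ S') (S' \ S) x + ew s t (S ∪ S')ᶜ (S' \ S) x := by
  unfold cut ew
  simp only [← sum_add_distrib, ← add_mul]
  exact sum_congr rfl fun e _ => by rw [crS' S S']

end quad

lemma RD.idJ (d : RD s t c τ) {e : E} {u v : V} (h : J s t e u v) :
    (if (u ∈ d.S ↔ v ∈ d.S) then 0 else d.a) + (if (u ∈ d.S' ↔ v ∈ d.S') then 0 else d.a') =
      d.b u + d.b v := by
  have := d.id e
  unfold cr at this
  rcases h with ⟨rfl, rfl⟩ | ⟨rfl, rfl⟩
  · rw [← this]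
    split_ifs <;> simp
  · rw [add_comm (d.b _), ← this]
    by_cases h1 : s e ∈ d.S <;> by_cases h2 : t e ∈ d.S <;> by_cases h3 : s e ∈ d.S' <;>
      by_cases h4 : t e ∈ d.S' <;> simp [h1, h2, h3, h4]

lemma RD.six (d : RD s t c τ) : 6 ≤ Fintype.card V := by
  have h1 := d.ntS
  have h2 := card_compl d.S
  have h3 := card_le_univ d.S
  have := h1.2
  omega

lemma RD.bside (hb : Brick s t c τ) (d : RD s t c τ) (hpos2 : ∀ e, 0 < d.x2 e)
    (hodd : Odd (d.S ∩ d.S').card) {x : E → ℤ} {σ : ℤ} (hx : ∀ v, cut s t {v} x = σ) :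
    ew s t (d.S ∩ d.S') (d.S \ d.S') x = ew s t (d.S ∪ d.S')ᶜ (d.S \ d.S') x ∧
    ∀ e, jn s t (d.S \ d.S') (d.S' \ d.S) e = 0 := by
  have hV := hb.rv.even_card hb.tpos
  have h6 := d.six
  obtain ⟨e0⟩ := hb.exE
  have hτ2 : 0 < d.τ2 := by
    have h1 := single_le_star d.x2 d.rv2.nonneg hb.nl e0
    rw [d.rv2.star] at h1
    exact (hpos2 e0).trans_le h1
  have hcS := card_inter_add_card_sdiff d.S d.S'
  have hBe : Even (d.S \ d.S').card := by
    have h1 := d.ntS.1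
    rw [← hcS] at h1
    by_contra hcon
    exact (Nat.not_even_iff_odd.2 h1) (hodd.add_odd (Nat.not_even_iff_odd.1 hcon))
  have hDo : Odd ((d.S ∪ d.S')ᶜ).card := by
    apply odd_compl hV
    have h1 := card_union_add_card_inter d.S d.S'
    have h2 := d.ntS.1.add_odd d.ntS'.1
    rw [← h1] at h2
    by_contra hcon
    exact (Nat.not_even_iff_odd.2 ((Nat.not_odd_iff_even.1 hcon).add_odd hodd)) h2
  have eS := cutS (s := s) (t := t) d.S d.S'
  have eS' := cutS' (s := s) (t := t) d.S d.S'
  have eA := cutA (s := s) (t := t) d.S d.S'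
  have eD := cutD (s := s) (t := t) d.S d.S'
  have eB := crB (s := s) (t := t) d.S d.S'
  have memA : ∀ v, v ∈ d.S ∩ d.S' ↔ v ∈ d.S ∧ v ∈ d.S' := fun v => mem_inter
  have memB : ∀ v, v ∈ d.S \ d.S' ↔ v ∈ d.S ∧ v ∉ d.S' := fun v => mem_sdiff
  have memC : ∀ v, v ∈ d.S' \ d.S ↔ v ∈ d.S' ∧ v ∉ d.S := fun v => mem_sdiff
  have memD : ∀ v, v ∈ (d.S ∪ d.S')ᶜ ↔ v ∉ d.S ∧ v ∉ d.S' := fun v => by simp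
  have hA3 : 3 ≤ ((d.S ∩ d.S')ᶜ).card :=
    d.ntS.2.2.trans (card_le_card (compl_subset_compl.2 inter_subset_left))
  have hD3 : 3 ≤ (((d.S ∪ d.S')ᶜ)ᶜ).card := by
    rw [compl_compl]
    exact d.ntS.2.1.trans (card_le_card subset_union_left)
  set A := d.S ∩ d.S' with hA
  set B := d.S \ d.S' with hB
  set C := d.S' \ d.S with hC
  set D := (d.S ∪ d.S')ᶜ with hD
  have nn : ∀ X Y, 0 ≤ ew s t X Y d.x2 := fun X Y => ew_nonneg X Y d.rv2.nonneg
  have tA := d.rv2.odd A hodd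
  have tD := d.rv2.odd D hDo
  have t2 := d.t2
  have t2' := d.t2'
  have eS2 := eS d.x2
  have eS2' := eS' d.x2
  have eA2 := eA d.x2
  have eD2 := eD d.x2
  have nBC := nn B C
  have tA' : cut s t A d.x2 = d.τ2 := by omega
  have tD' : cut s t D d.x2 = d.τ2 := by omega
  have hBC : ∀ e, jn s t B C e = 0 := jn_zero_of_ew hpos2 (by omega)
  refine ⟨?_, hBC⟩
  have noBC : ∀ e u v, J s t e u v → u ∈ B → v ∈ C → False := by
    intro e u v hJ hu hv
    have := hBC e
    unfold jn at this
    rcases hJ with ⟨rfl, rfl⟩ | ⟨rfl, rfl⟩ <;> simp [hu, hv] at this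
  have idJ := fun e u v => d.idJ (e := e) (u := u) (v := v)
  have inJ : ∀ e u v, J s t e u v → (u ∈ d.S ↔ v ∈ d.S) → (u ∈ d.S' ↔ v ∈ d.S') →
      d.b u + d.b v = 0 := by
    intro e u v hJ h1 h2
    have := idJ e u v hJ
    simp [h1, h2] at this
    exact this.symm
  obtain ⟨a0, hAa, hA0⟩ := hb.constA h6 d.rv2 hτ2 hpos2 hodd hA3 tA' d.b (by
    intro e h1 h2
    rw [memA] at h1 h2
    exact inJ e _ _ (J.st e) (by simp [h1, h2]) (by simp [h1, h2]))
  obtain ⟨d0, hDa, hD0⟩ := hb.constA h6 d.rv2 hτ2 hpos2 hDo hD3 tD' d.b (by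
    intro e h1 h2
    rw [memD] at h1 h2
    exact inJ e _ _ (J.st e) (by simp [h1, h2]) (by simp [h1, h2]))
  by_cases hBn : B = ∅
  · have h1 : ∀ X, ew s t X B x = 0 := fun X => ew_zero_of_jn fun e => by simp [jn, hBn]
    rw [h1, h1]
  obtain ⟨v0, hv0⟩ := nonempty_iff_ne_empty.2 hBn
  have jAB : ∀ e u v, J s t e u v → u ∈ B → v ∈ A → d.b u = d.a' - a0 := by
    intro e u v hJ hu hv
    have h1 := idJ e u v hJ
    rw [hAa v hv] at h1
    rw [memB] at hu
    rw [memA] at hv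
    simp [hu, hv] at h1
    rw [h1]; abel
  have jDB : ∀ e u v, J s t e u v → u ∈ B → v ∈ D → d.b u = d.a - d0 := by
    intro e u v hJ hu hv
    have h1 := idJ e u v hJ
    rw [hDa v hv] at h1
    rw [memB] at hu
    rw [memD] at hv
    simp [hu, hv] at h1
    rw [h1]; abel
  have jBB : ∀ e u v, J s t e u v → u ∈ B → v ∈ B → d.b u = - d.b v := by
    intro e u v hJ hu hv
    rw [memB] at hu hv
    exact eq_neg_of_add_eq_zero_left (inJ e u v hJ (by simp [hu, hv]) (by simp [hu, hv]))
  have loc : ∀ v, v ∉ B → v ∉ C → v ∉ A → v ∈ D := by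
    intro v h1 h2 h3
    rw [memB] at h1; rw [memC] at h2; rw [memA] at h3; rw [memD]
    tauto
  have dAB : ∀ v, v ∈ B → v ∉ A := by
    intro v h1; rw [memB] at h1; rw [memA]; tauto
  have dDB : ∀ v, v ∈ B → v ∉ D := by
    intro v h1; rw [memB] at h1; rw [memD]; tauto
  have dAD : ∀ v, v ∈ A → v ∉ D := by
    intro v h1; rw [memA] at h1; rw [memD]; tauto
  set ξ := d.a' - a0 with hξ
  set η := d.a - d0 with hη
  have hAne : A.Nonempty := card_pos.1 hodd.pos
  have hDne : D.Nonempty := card_pos.1 hDo.pos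
  have lev : ∀ v ∈ B, (ξ = d.b v ∨ ξ = - d.b v) ∧ (η = d.b v ∨ η = - d.b v) := by
    intro v hv
    set X := B.filter (fun w => d.b w = d.b v ∨ d.b w = - d.b v) with hX
    have hvX : v ∈ X := by simp [hX, hv]
    have hXB : X ⊆ B := filter_subset _ _
    have hcl : ∀ e u w, J s t e u w → u ∈ X → w ∉ X → w ∉ B := by
      intro e u w hJ hu hw hwB
      apply hw
      have h1 := jBB e u w hJ (hXB hu) hwB
      have h2 := (mem_filter.1 hu).2
      simp only [hX, mem_filter, hwB, true_and]
      rw [h1] at h2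
      rcases h2 with h2 | h2
      · right; rw [← h2, neg_neg]
      · left; exact neg_inj.1 h2
    constructor
    · by_contra hcon
      have : X = ∅ := by
        refine hb.one h6 d.rv2 hτ2 hpos2 hDo tD' (disjoint_left.2 fun w h1 h2 => dDB w (hXB h1) h2) ?_ ?_
        · intro e u w hJ hu hw
          refine loc w (hcl e u w hJ hu hw) (fun h => noBC e u w hJ (hXB hu) h) fun hwA => ?_
          have h1 := jAB e u w hJ (hXB hu) hwA
          rw [← h1] at hcon
          exact hcon (mem_filter.1 hu).2
        · intro h
          obtain ⟨w, hw⟩ := hAne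
          have : w ∈ X ∪ D := h ▸ mem_univ w
          rcases mem_union.1 this with h | h
          · exact dAB w (hXB h) hw
          · exact dAD w hw h
      rw [this] at hvX; simp at hvX
    · by_contra hcon
      have : X = ∅ := by
        refine hb.one h6 d.rv2 hτ2 hpos2 hodd tA' (disjoint_left.2 fun w h1 h2 => dAB w (hXB h1) h2) ?_ ?_
        · intro e u w hJ hu hw
          by_contra hwA
          have hwD := loc w (hcl e u w hJ hu hw) (fun h => noBC e u w hJ (hXB hu) h) hwA
          have h1 := jDB e u w hJ (hXB hu) hwD
          rw [← h1] at hcon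
          exact hcon (mem_filter.1 hu).2
        · intro h
          obtain ⟨w, hw⟩ := hDne
          have : w ∈ X ∪ A := h ▸ mem_univ w
          rcases mem_union.1 this with h | h
          · exact dDB w (hXB h) hw
          · exact dAD w h hw
      rw [this] at hvX; simp at hvX
  have hηξ : η = ξ ∨ η = -ξ := by
    obtain ⟨h1 | h1, h2 | h2⟩ := lev v0 hv0 <;> rw [h1, h2] <;> simp
  have hbξ : ∀ v ∈ B, d.b v = ξ ∨ d.b v = -ξ := by
    intro v hv
    obtain ⟨h1 | h1, -⟩ := lev v hv <;> rw [h1] <;> simp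
  have sS := hb.strict d.S d.ntS
  have sS' := hb.strict d.S' d.ntS'
  have eSc := eS c
  have eSc' := eS' c
  have eAc := eA c
  have eDc := eD c
  have eBCc : ew s t B C c = 0 := ew_zero_of_jn hBC
  by_cases hξ0 : ξ = 0
  · exfalso
    have hη0 : η = 0 := by rcases hηξ with h | h <;> simp [h, hξ0]
    have h1 : A.card = 1 := by
      by_contra hcon
      have := hA0 hcon
      rw [hξ, this, sub_zero] at hξ0
      exact d.ha' hξ0
    have h2 : D.card = 1 := by
      by_contra hcon
      have := hD0 hcon
      rw [hη, this, sub_zero] at hη0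
      exact d.ha hη0
    obtain ⟨v, hv⟩ := card_eq_one.1 h1
    obtain ⟨w, hw⟩ := card_eq_one.1 h2
    have h3 := hb.rv.star v
    have h4 := hb.rv.star w
    rw [← hv] at h3
    rw [← hw] at h4
    omega
  have hξn : -ξ ≠ ξ := fun h => hξ0 (QD_eq_neg h.symm)
  obtain ⟨ε, hε, hεη⟩ : ∃ ε : ℤ, (ε = 1 ∨ ε = -1) ∧ ∀ v, d.b v = η → (if d.b v = ξ then (1:ℤ) else -1) = ε := by
    rcases hηξ with h | h
    · exact ⟨1, Or.inl rfl, fun v hv => by simp [hv, h]⟩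
    · exact ⟨-1, Or.inr rfl, fun v hv => by simp [hv, h, hξn]⟩
  set bb : V → ℤ := fun v => if v ∈ B then (if d.b v = ξ then 1 else -1) else 0 with hbb
  have pwJ : ∀ e u v, J s t e u v → u ∈ B → bb u + bb v =
      (if v ∈ A then 1 else 0) + ε * (if v ∈ D then 1 else 0) := by
    intro e u v hJ hu
    by_cases hvA : v ∈ A
    · have h1 : v ∉ B := fun h => dAB v h hvA
      simp [hbb, hu, h1, hvA, dAD v hvA, jAB e u v hJ hu hvA]
    · by_cases hvD : v ∈ D
      · have h1 : v ∉ B := fun h => dDB v h hvD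
        simp only [hbb, hu, h1, hvA, hvD, if_true, if_false]
        rw [hεη u (jDB e u v hJ hu hvD)]; ring
      · have hvB : v ∈ B := by
          by_contra hvB
          exact hvD (loc v hvB (fun h => noBC e u v hJ hu h) hvA)
        have h1 := jBB e u v hJ hu hvB
        rcases hbξ v hvB with h | h
        · simp [hbb, hu, hvB, hvA, hvD, h1, h, hξn]
        · simp [hbb, hu, hvB, hvA, hvD, h1, h, hξn]
  have pw : ∀ e, bb (s e) + bb (t e) = jn s t A B e + ε * jn s t D B e := by
    intro e
    by_cases h1 : s e ∈ B
    · rw [pwJ e _ _ (J.st e) h1]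
      have h2 := dAB _ h1
      have h3 := dDB _ h1
      simp [jn, h1, h2, h3]
    · by_cases h4 : t e ∈ B
      · rw [add_comm, pwJ e _ _ (J.ts e) h4]
        have h2 := dAB _ h4
        have h3 := dDB _ h4
        simp [jn, h1, h2, h3, h4]
      · simp [hbb, jn, h1, h4]
  have hsumeq : ∀ (y : E → ℤ) (ρ : ℤ), (∀ v, cut s t {v} y = ρ) →
      ρ * ∑ v, bb v = ew s t A B y + ε * ew s t D B y := by
    intro y ρ hy
    have := pot (s := s) (t := t) y (fun e he => absurd he (hb.nl e)) bb
    simp only [hy, smul_eq_mul] at this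
    rw [mul_sum, this]
    unfold ew
    rw [mul_sum, ← sum_add_distrib]
    refine sum_congr rfl fun e _ => ?_
    rw [pw]; ring
  have hh2 := hsumeq d.x2 d.τ2 d.rv2.star
  have hαβ : ew s t A B d.x2 = ew s t D B d.x2 := by omega
  rcases hε with hε | hε
  · exfalso
    have heven := odd_sum_pm (A := B) bb (by
      intro v hv
      simp only [hbb, hv, if_true]
      split_ifs <;> simp) (by intro v hv; simp [hbb, hv])
    have heven' : Even (∑ v, bb v) := by
      have h1 : Even ((B.card : ℤ)) := by exact_mod_cast hBe
      have := heven.add h1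
      simpa using this
    obtain ⟨h', hh'⟩ := heven'
    rw [hh', hε] at hh2
    have hα : ew s t A B d.x2 = d.τ2 * h' := by linarith
    have n1 := nn A B
    have n2 := nn A C
    have n3 := nn A D
    have n4 := nn D C
    have h0 : 0 ≤ h' := by
      by_contra hcon
      push Not at hcon
      have : d.τ2 * h' < 0 := mul_neg_of_pos_of_neg hτ2 hcon
      omega
    have h1 : h' ≤ 1 := by
      by_contra hcon
      push Not at hcon
      have : d.τ2 * 1 < d.τ2 * h' := by gcongr
      omega
    obtain rfl | rfl : h' = 0 ∨ h' = 1 := by omega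
    · have z1 : ∀ e, jn s t A B e = 0 := jn_zero_of_ew hpos2 (by omega)
      have z2 : ∀ e, jn s t D B e = 0 := jn_zero_of_ew hpos2 (by omega)
      rcases hb.conn h6 (X := B) (fun e => by rw [eB, z1, z2, hBC]; rfl) with h | h
      · exact hBn h
      · obtain ⟨w, hw⟩ := hAne
        exact dAB w (h ▸ mem_univ w) hw
    · rw [mul_one] at hα
      have z1 : ∀ e, jn s t A C e = 0 := jn_zero_of_ew hpos2 (by omega)
      have z2 : ∀ e, jn s t A D e = 0 := jn_zero_of_ew hpos2 (by omega)
      have z3 : ∀ e, jn s t D C e = 0 := jn_zero_of_ew hpos2 (by omega)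
      have hhc := hsumeq c τ hb.rv.star
      rw [hh', hε] at hhc
      have w1 := ew_zero_of_jn (x := c) z1
      have w2 := ew_zero_of_jn (x := c) z2
      have w3 := ew_zero_of_jn (x := c) z3
      omega
  · rw [hε, hαβ] at hh2
    have hh0 : ∑ v, bb v = 0 := by
      have : d.τ2 * ∑ v, bb v = 0 := by rw [hh2]; ring
      rcases mul_eq_zero.1 this with h | h
      · omega
      · exact h
    have := hsumeq x σ hx
    rw [hh0, hε] at this
    linarith

lemma RD.case2' (hb : Brick s t c τ) (d : RD s t c τ) (hpos2 : ∀ e, 0 < d.x2 e)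
    (hodd : Odd (d.S ∩ d.S').card) : False := by
  obtain ⟨h1, hBC⟩ := d.bside hb hpos2 hodd d.rv1.star
  obtain ⟨h2, -⟩ := d.swap.bside hb hpos2 (by simpa [RD.swap, inter_comm] using hodd) d.rv1.star
  have e1 := cutS (s := s) (t := t) d.S d.S' d.x1
  have e2 := cutS' (s := s) (t := t) d.S d.S' d.x1
  simp only [RD.swap] at h2
  rw [inter_comm, union_comm] at h2
  have t1 := d.t1
  have t1' := d.t1'
  omega

lemma RD.case2 (hb : Brick s t c τ) (d : RD s t c τ) (hpos2 : ∀ e, 0 < d.x2 e) : False := by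
  have hV := hb.rv.even_card hb.tpos
  by_cases hodd : Odd (d.S ∩ d.S').card
  · exact d.case2' hb hpos2 hodd
  · refine (d.compl hV).case2' hb hpos2 ?_
    simp only [RD.compl]
    have h1 := d.ntS.1
    have h2 : (d.S ∩ d.S').card + (d.S ∩ d.S'ᶜ).card = d.S.card := by
      rw [← card_inter_add_card_sdiff d.S d.S', sdiff_eq_inter_compl]
    rw [← h2] at h1
    by_contra hcon
    exact (Nat.not_even_iff_odd.2 h1) ((Nat.not_odd_iff_even.1 hodd).add (Nat.not_odd_iff_even.1 hcon))

end case2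

end TDD

namespace TDD

section case1
variable {V E : Type} [Fintype V] [Fintype E] {s t : E → V} {c : E → ℤ} {τ : ℤ}

lemma RD.six_r (hb : Brick s t c τ) (d : RD s t c τ) {f : E} {p q r : ℤ} (hp : 0 < p)
    (hr : 0 < r) (h : ∀ x σ, (∀ v, cut s t {v} x = σ) →
    p * x f = q * (cut s t d.S x - σ) + r * (cut s t d.S' x - σ)) :
    ∃ M ∈ PM s t, M f = 1 ∧ cut s t d.S M = 1 ∧ p = r * (cut s t d.S' M - 1) ∧
      6 ≤ cut s t d.S' M - 1 := by
  obtain ⟨M, hM, hMf, -, hMS⟩ := exPM hb d.rv1 f (d.pos1 f)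
  have h1 := hMS d.S d.ntS.1 d.t1
  have h2 := h M 1 (PM.rv hM).star
  rw [hMf, h1] at h2
  have h3 : p = r * (cut s t d.S' M - 1) := by linarith
  refine ⟨M, hM, hMf, h1, h3, ?_⟩
  have h4 := d.hS' M hM
  have h5 := cut_parity (PM.rv hM).loop (PM.rv hM).star d.S'
  have h6 : 0 < cut s t d.S' M - 1 := by
    rw [h3] at hp
    exact (mul_pos_iff_of_pos_left hr).1 hp
  set m := cut s t d.S' M - 1 with hm
  have hm2 : m ≠ 2 := fun h => d.ha' (QD_two (by rw [← h]; exact h4))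
  have hm4 : m ≠ 4 := fun h => d.ha' (QD_pow (k := 2) (by rw [h] at h4; exact_mod_cast h4))
  obtain ⟨k, hk⟩ := h5
  obtain ⟨l, hl⟩ := d.ntS'.1
  omega

lemma RD.same (hb : Brick s t c τ) (d : RD s t c τ) {f f' : E} (hf : d.x2 f = 0)
    (hf' : d.x2 f' = 0) (x : E → ℤ) (σ : ℤ) (hx : ∀ v, cut s t {v} x = σ) : x f = x f' := by
  obtain ⟨p, q, r, hp, hq, hr, h⟩ := d.zr f hf
  obtain ⟨p', q', r', hp', hq', hr', h'⟩ := d.zr f' hf'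
  have aux : ∀ (d : RD s t c τ) (q r q' r' : ℤ), 0 < r → 0 < r' → (∀ x σ, (∀ v, cut s t {v} x = σ) →
      p * x f = q * (cut s t d.S x - σ) + r * (cut s t d.S' x - σ)) →
      (∀ x σ, (∀ v, cut s t {v} x = σ) →
      p' * x f' = q' * (cut s t d.S x - σ) + r' * (cut s t d.S' x - σ)) → p * r' = p' * r := by
    intro d q r q' r' hr hr' h h'
    obtain ⟨M, hM, h1, h2, h3, h4⟩ := d.six_r hb hp hr h
    have h5 := h' M 1 (PM.rv hM).star
    rw [h2] at h5
    have h6 : M f' ≤ 1 := by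
      have := single_le_star M (PM.rv hM).nonneg hb.nl f'
      rwa [(PM.rv hM).star] at this
    have h7 : 0 < M f' := by
      have : 0 < p' * M f' := by rw [h5]; nlinarith
      exact (mul_pos_iff_of_pos_left hp').1 this
    have h8 : M f' = 1 := by omega
    rw [h8] at h5
    rw [h3]
    linear_combination (-r) * h5
  have h1 := aux d q r q' r' hr hr' h h'
  have h2 := aux d.swap r q r' q' hq hq' (fun x σ hx => by rw [h x σ hx]; simp only [RD.swap]; ring)
    (fun x σ hx => by rw [h' x σ hx]; simp only [RD.swap]; ring)
  have e1 := h x σ hx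
  have e2 := h' x σ hx
  have : p * p' * (x f - x f') = 0 := by
    linear_combination p' * e1 - p * e2 - (cut s t d.S x - σ) * h2 - (cut s t d.S' x - σ) * h1
  rcases mul_eq_zero.1 this with h | h
  · exact absurd h (by positivity)
  · omega

/-- `φ_S` is not proportional to a coordinate -/
lemma RD.noprop (hb : Brick s t c τ) (d : RD s t c τ) {f : E} {κ : ℤ}
    (h : ∀ x σ, (∀ v, cut s t {v} x = σ) → cut s t d.S x - σ = κ * x f) : False := by
  have h1 := h _ _ d.rv1.star
  rw [d.t1, sub_self] at h1
  have h2 : κ = 0 := by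
    rcases mul_eq_zero.1 h1.symm with h | h
    · exact h
    · have := d.pos1 f; omega
  have h3 := h _ _ hb.rv.star
  have := hb.strict _ d.ntS
  rw [h2] at h3
  omega

lemma RD.tau2 (hb : Brick s t c τ) (d : RD s t c τ) : 0 < d.τ2 := by
  by_contra hn
  have h0 : ∀ e, d.x2 e = 0 := by
    intro e
    have h1 := single_le_star d.x2 d.rv2.nonneg hb.nl e
    rw [d.rv2.star] at h1
    have := d.rv2.nonneg e
    omega
  obtain ⟨f⟩ := hb.exE
  obtain ⟨v⟩ := hb.nev
  refine d.noprop hb (f := f) (κ := ∑ e, (cr s t d.S e - cr s t {v} e)) ?_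
  intro x σ hx
  rw [← hx v, cut, cut, ← sum_sub_distrib, sum_mul]
  refine sum_congr rfl fun e _ => ?_
  rw [d.same hb (h0 e) (h0 f) x σ hx]; ring

lemma insert_cut {Y : Finset V} {v : V} (hv : v ∉ Y) {x : E → ℤ} (hx : ∀ e, 0 ≤ x e) {f : E}
    {u : V} (hf : J s t f v u) (hu : u ∈ Y) :
    cut s t (insert v Y) x + 2 * x f ≤ cut s t Y x + cut s t {v} x := by
  have h1 : 2 * x f = ∑ e, (if e = f then 2 else 0) * x e := by simp
  rw [h1]
  unfold cut
  rw [← sum_add_distrib, ← sum_add_distrib]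
  refine sum_le_sum fun e _ => ?_
  rw [← add_mul, ← add_mul]
  refine mul_le_mul_of_nonneg_right ?_ (hx e)
  unfold cr
  simp only [mem_insert, mem_singleton]
  have huv : u ≠ v := fun h => hv (h ▸ hu)
  by_cases hef : e = f
  · subst hef
    rcases hf with ⟨h1, h2⟩ | ⟨h1, h2⟩ <;> simp [h1, h2, hu, hv, huv]
  · simp only [hef, if_false, add_zero]
    by_cases h1 : s e = v <;> by_cases h2 : t e = v <;> by_cases h3 : s e ∈ Y <;>
      by_cases h4 : t e ∈ Y <;> simp_all

lemma Brick.twoEdge_aux (hb : Brick s t c τ) {U : Finset V} (hU : Even U.card) {f : E} {u v : V}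
    (hf : J s t f v u) (hu : u ∈ U) (hv : v ∉ U) (hc : cut s t U c ≤ 2 * c f) : Uᶜ.card = 2 := by
  have hV := hb.rv.even_card hb.tpos
  have h1 := insert_cut hv hb.rv.nonneg hf hu
  rw [hb.rv.star] at h1
  have hcard := card_insert_of_notMem hv
  have h2 : ¬ NT (insert v U) := by
    intro hnt
    have := hb.strict _ hnt
    omega
  have hodd : Odd (insert v U).card := by rw [hcard]; exact hU.add_one
  have hodd2 := odd_compl hV hodd
  have hpos := card_pos.2 ⟨u, hu⟩
  have e1 := card_compl (insert v U)
  have e2 := card_compl U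
  have e3 := card_le_univ (insert v U)
  obtain ⟨k, hk⟩ := hU
  obtain ⟨l, hl⟩ := hodd2
  by_contra hcon
  exact h2 ⟨hodd, by omega, by omega⟩

lemma RD.twoEdge (hb : Brick s t c τ) (d : RD s t c τ) {f f' : E} (hf : d.x2 f = 0)
    (hf' : d.x2 f' = 0) {U : Finset V} (h : ∀ e, e ≠ f → e ≠ f' → cr s t U e = 0) :
    U = ∅ ∨ U = univ := by
  have h6 := d.six
  by_contra hn
  have hV := hb.rv.even_card hb.tpos
  have hcf := d.same hb hf hf' c τ hb.rv.star
  have hUe : Even U.card := by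
    by_contra ho
    have h1 := d.rv2.odd U (Nat.not_even_iff_odd.1 ho)
    have h2 := d.tau2 hb
    have h3 : cut s t U d.x2 = 0 := cut_eq_zero_of fun e => by
      by_cases h4 : e = f
      · simp [h4, hf]
      · by_cases h5 : e = f'
        · simp [h5, hf']
        · simp [h e h4 h5]
    omega
  have hcut : cut s t U c ≤ 2 * c f := by
    have e1 : 2 * c f = ∑ e, ((if e = f then 1 else 0) + (if e = f' then 1 else 0)) * c e := by
      simp [add_mul, sum_add_distrib, ← hcf]; ring
    rw [e1]
    refine sum_le_sum fun e _ => mul_le_mul_of_nonneg_right ?_ (hb.pos e).le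
    by_cases h4 : e = f
    · have : cr s t U e ≤ 1 := by unfold cr; split_ifs <;> simp
      simp only [h4, if_true] at *
      split_ifs <;> omega
    · by_cases h5 : e = f'
      · have : cr s t U e ≤ 1 := by unfold cr; split_ifs <;> simp
        simp only [h5, if_true] at *
        split_ifs <;> omega
      · simp [h4, h5, h e h4 h5]
  have hUce : Even Uᶜ.card := by
    rw [card_compl]; exact (Nat.even_sub (card_le_univ U)).2 (by simp [hV, hUe])
  have hcut' : cut s t Uᶜ c ≤ 2 * c f := by rw [cut_compl]; exact hcut
  have key : ∃ g u v, J s t g u v ∧ u ∈ U ∧ v ∉ U ∧ c g = c f := by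
    by_contra hcon
    push Not at hcon
    refine hn (hb.conn h6 fun e => ?_)
    by_cases hce : c e = c f
    · rw [cr_eq_zero_iff]
      constructor
      · intro hs; by_contra ht
        exact hcon e _ _ (J.st e) hs ht hce
      · intro ht; by_contra hs
        exact hcon e _ _ (J.ts e) ht hs hce
    · refine h e ?_ ?_
      · rintro rfl; exact hce rfl
      · rintro rfl; exact hce hcf.symm
  obtain ⟨g, u, v, hg, hu, hv, hcg⟩ := key
  have k1 := hb.twoEdge_aux hUe hg.symm hu hv (by rw [hcg]; exact hcut)
  have k2 := hb.twoEdge_aux hUce hg (by simpa using hv) (by simpa using hu) (by rw [hcg]; exact hcut')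
  rw [compl_compl] at k2
  have := card_compl U
  omega

lemma RD.uniq (hb : Brick s t c τ) (d : RD s t c τ) {f f' : E} (hf : d.x2 f = 0)
    (hf' : d.x2 f' = 0) : f = f' := by
  by_contra hne
  have hτ2 := d.tau2 hb
  obtain ⟨-, b, hbe⟩ : ∃ (_ : ℚ) (b : V → ℚ), ∀ e, b (s e) + b (t e) =
      (if e = f then 1 else 0) - (if e = f' then 1 else 0) := by
    obtain ⟨a, b, h⟩ := potentials (A := ℚ) hb.nl ∅
      { toFun := fun x => (x f : ℚ) - x f'
        map_zero' := by simp
        map_add' := by intro x y; simp; ring } (by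
        intro x hx _
        have := d.same hb hf hf' x 0 hx
        simp [this])
    refine ⟨a, b, fun e => ?_⟩
    have := h e
    have hz : cr s t ∅ e = 0 := by simp [cr]
    rw [hz, zero_smul, zero_add] at this
    rw [← this]
    simp [Pi.single_apply, eq_comm]
  have hbf : b (s f) + b (t f) = 1 := by rw [hbe]; simp [hne]
  have hbf' : b (s f') + b (t f') = -1 := by rw [hbe]; simp [Ne.symm hne]
  have hbo : ∀ e, e ≠ f → e ≠ f' → b (t e) = - b (s e) := fun e h1 h2 => by
    have := hbe e; simp [h1, h2] at this; linarith
  have hall : ∀ v, b v = b (s f) ∨ b v = - b (s f) := by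
    have := d.twoEdge hb hf hf' (U := univ.filter fun v => b v = b (s f) ∨ b v = - b (s f)) (by
      intro e h1 h2
      rw [cr_eq_zero_iff]
      simp only [mem_filter, mem_univ, true_and, hbo e h1 h2]
      rw [neg_inj, neg_eq_iff_eq_neg]
      exact or_comm)
    rcases this with h | h
    · have : s f ∈ (∅ : Finset V) := by rw [← h]; simp
      simp at this
    · intro v
      have := mem_univ v
      rw [← h] at this
      simpa using this
  have hsf : b (s f) = 1 / 2 := by
    rcases hall (t f) with h | h <;> rw [h] at hbf <;> linarith
  have hhalf : ∀ v, b v = 1/2 ∨ b v = -1/2 := by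
    intro v
    have := hall v
    rw [hsf] at this
    rcases this with h | h
    · exact Or.inl h
    · right; rw [h]; norm_num
  set P : V → ℤ := fun v => if v ∈ d.S then (if b v = 1/2 then 1 else -1) else 0 with hP
  have hPle : ∀ e, e ≠ f → e ≠ f' → |P (s e) + P (t e)| ≤ cr s t d.S e := by
    intro e h1 h2
    have h3 := hbo e h1 h2
    simp only [hP, cr, h3]
    by_cases h5 : s e ∈ d.S <;> by_cases h6 : t e ∈ d.S <;> rcases hhalf (s e) with h4 | h4 <;>
      simp [h4, h5, h6] <;> norm_num
  have hpot : ∀ x σ, (∀ v, cut s t {v} x = σ) → σ * ∑ v, P v = ∑ e, x e * (P (s e) + P (t e)) := by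
    intro x σ hx
    have := pot (s := s) (t := t) x (fun e he => absurd he (hb.nl e)) P
    simp only [hx, smul_eq_mul] at this
    rw [← mul_sum] at this
    exact this
  have hx2 := hpot _ _ d.rv2.star
  have hPx : ∀ e, |d.x2 e * (P (s e) + P (t e))| ≤ cr s t d.S e * d.x2 e := by
    intro e
    by_cases h1 : e = f
    · simp [h1, hf]
    · by_cases h2 : e = f'
      · simp [h2, hf']
      · rw [abs_mul, abs_of_nonneg (d.rv2.nonneg e), mul_comm]
        exact mul_le_mul_of_nonneg_right (hPle e h1 h2) (d.rv2.nonneg e)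
  have hsum : |d.τ2 * ∑ v, P v| ≤ d.τ2 := by
    rw [hx2]
    refine (abs_sum_le_sum_abs _ _).trans ?_
    have := d.t2
    unfold cut at this
    conv_rhs => rw [← this]
    exact sum_le_sum fun e _ => hPx e
  have hle1 : |∑ v, P v| ≤ 1 := by
    rw [abs_mul, abs_of_pos hτ2] at hsum
    exact le_of_mul_le_mul_left (by linarith) hτ2
  have hodd : ∑ v, P v ≠ 0 := by
    intro h0
    have := odd_sum_pm (A := d.S) P (fun v hv => by simp only [hP, hv, if_true]; split_ifs <;> simp)
      (fun v hv => by simp [hP, hv])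
    rw [h0, zero_sub, even_neg] at this
    have h2 : Even d.S.card := by exact_mod_cast this
    exact (Nat.not_even_iff_odd.2 d.ntS.1) h2
  set ε := ∑ v, P v with hε
  have hε1 : ε = 1 ∨ ε = -1 := by
    rw [abs_le] at hle1; omega
  have hεε : ε * ε = 1 := by rcases hε1 with h | h <;> rw [h] <;> norm_num
  have hphi : ∀ x σ, (∀ v, cut s t {v} x = σ) → cut s t d.S x - σ =
      ∑ e, (cr s t d.S e - ε * (P (s e) + P (t e))) * x e := by
    intro x σ hx
    have h1 := hpot x σ hx
    have h2 : σ = ε * (σ * ε) := by rw [mul_left_comm, hεε, mul_one]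
    rw [h2, h1, cut, mul_sum, ← sum_sub_distrib]
    exact sum_congr rfl fun e _ => by ring
  have hz := hphi _ _ d.rv2.star
  rw [d.t2, sub_self] at hz
  have hnn : ∀ e ∈ univ, 0 ≤ (cr s t d.S e - ε * (P (s e) + P (t e))) * d.x2 e := by
    intro e _
    have := hPx e
    rw [abs_le] at this
    rcases hε1 with h | h <;> rw [h] <;> nlinarith
  have hz2 := (sum_eq_zero_iff_of_nonneg hnn).1 hz.symm
  refine d.noprop hb (f := f) (κ := ∑ e, (cr s t d.S e - ε * (P (s e) + P (t e)))) ?_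
  intro x σ hx
  rw [hphi x σ hx, sum_mul]
  refine sum_congr rfl fun e _ => ?_
  rcases mul_eq_zero.1 (hz2 e (mem_univ e)) with h | h
  · rw [h]; simp
  · rw [d.same hb h hf x σ hx]

end case1

end TDD

namespace TDD

section case1b
variable {V E : Type} [Fintype V] [Fintype E] {s t : E → V} {c : E → ℤ} {τ : ℤ}

lemma int_denoms (b : V → ℚ) : ∃ N : ℤ, 0 < N ∧ ∃ b' : V → ℤ, ∀ v, (b' v : ℚ) = N * b v := by
  refine ⟨∏ v, ((b v).den : ℤ), prod_pos fun v _ => by exact_mod_cast (b v).pos, ?_⟩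
  have : ∀ v, ∃ n : ℤ, (n : ℚ) = ((∏ v, ((b v).den : ℤ) : ℤ) : ℚ) * b v := by
    intro v
    refine ⟨(∏ u ∈ univ.erase v, ((b u).den : ℤ)) * (b v).num, ?_⟩
    rw [← prod_erase_mul _ _ (mem_univ v)]
    push_cast
    rw [mul_assoc, Rat.den_mul_eq_num]
  choose b' hb' using this
  exact ⟨b', hb'⟩

lemma RD.pot_int (hb : Brick s t c τ) (d : RD s t c τ) {f : E} (hf : d.x2 f = 0) :
    ∃ (b : V → ℤ) (K S1 S2 : ℤ), 0 < S1 ∧ 0 < S2 ∧ 6 * S1 ≤ K ∧ 6 * S2 ≤ K ∧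
      ∀ e, b (s e) + b (t e) = S1 * cr s t d.S e + S2 * cr s t d.S' e - K * (if e = f then 1 else 0) := by
  obtain ⟨p, q, r, hp, hq, hr, h⟩ := d.zr f hf
  have hr6 : 6 * r ≤ p := by
    obtain ⟨M, hM, h1, h2, h3, h4⟩ := d.six_r hb hp hr h
    nlinarith
  have hq6 : 6 * q ≤ p := by
    obtain ⟨M, hM, h1, h2, h3, h4⟩ := d.swap.six_r hb (f := f) (q := r) hp hq (fun x σ hx => by
      rw [h x σ hx]; simp only [RD.swap]; ring)
    nlinarith
  obtain ⟨a, b, hab⟩ := potentials (A := ℚ) hb.nl ∅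
      { toFun := fun x => (q : ℚ) * cut s t d.S x + r * cut s t d.S' x - p * x f
        map_zero' := by simp
        map_add' := by intro x y; simp [cut_add]; ring } (by
        intro x hx _
        have := h x 0 hx
        have h2 : (p : ℚ) * x f = q * (cut s t d.S x - (0:ℤ)) + r * (cut s t d.S' x - (0:ℤ)) := by
          exact_mod_cast this
        simp at h2 ⊢
        linarith)
  obtain ⟨N, hN, b', hb'⟩ := int_denoms b
  refine ⟨b', N * p, N * q, N * r, by positivity, by positivity, by nlinarith, by nlinarith, ?_⟩
  intro e
  have h1 := hab e
  have hz : cr s t ∅ e = 0 := by simp [cr]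
  simp only [hz, zero_smul, zero_add] at h1
  have hs : ∀ S : Finset V, cut s t S (Pi.single e 1) = cr s t S e := by
    intro S; unfold cut; simp [Pi.single_apply]
  simp only [AddMonoidHom.coe_mk, ZeroHom.coe_mk, hs, Pi.single_apply] at h1
  have h3 : ((b' (s e) + b' (t e) : ℤ) : ℚ) = ((N * q * cr s t d.S e + N * r * cr s t d.S' e - N * p * (if e = f then 1 else 0) : ℤ) : ℚ) := by
    push_cast
    rw [hb', hb', ← mul_add, ← h1]
    simp only [eq_comm (a := f)]
    push_cast
    split_ifs <;> ring
  exact_mod_cast h3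

lemma layer (n : ℤ) (B : ℕ) (h1 : n ≤ B) (h2 : -n ≤ B) :
    n = ∑ t ∈ Finset.Icc 1 B, ((if (t : ℤ) ≤ n then (1 : ℤ) else 0) - (if n ≤ -(t : ℤ) then 1 else 0)) := by
  have h : ∀ B : ℕ, ∑ t ∈ Finset.Icc 1 B, ((if (t : ℤ) ≤ n then (1 : ℤ) else 0) - (if n ≤ -(t : ℤ) then 1 else 0)) =
      max (min n B) (-B) := by
    intro B
    induction B with
    | zero => simp
    | succ B ih =>
      rw [Finset.sum_Icc_succ_top (by omega), ih]
      push_cast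
      split_ifs <;> omega
  rw [h]; omega

lemma cross_aux (b : V → ℤ) (S : Finset V) (e : E) (h : 0 ≤ b (s e) + b (t e))
    (hnz : b (s e) = 0 → b (t e) = 0 → (s e ∈ S ↔ t e ∈ S)) :
    cr s t (univ.filter fun v => v ∈ S ∧ b v = 0) e + cr s t (univ.filter fun v => v ∉ S ∧ b v = 0) e ≤
      ne s t (univ.filter fun v => 1 ≤ b v) e - ne s t (univ.filter fun v => b v ≤ -1) e := by
  unfold cr ne
  simp only [mem_filter, mem_univ, true_and]
  by_cases g1 : b (s e) = 0 <;> by_cases g2 : b (t e) = 0 <;> by_cases g3 : s e ∈ S <;>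
      by_cases g4 : t e ∈ S <;> simp [g1, g2, g3, g4] at h hnz ⊢ <;> (try split_ifs) <;> omega

lemma RD.case1 (hb : Brick s t c τ) (d : RD s t c τ) {f : E} (hf : d.x2 f = 0) : False := by
  have hV := hb.rv.even_card hb.tpos
  have h6 := d.six
  have hτ2 := d.tau2 hb
  have hτ1 : 0 < d.τ1 := by
    have := single_le_star d.x1 d.rv1.nonneg hb.nl f
    rw [d.rv1.star] at this
    exact (d.pos1 f).trans_le this
  have hu : ∀ e, e ≠ f → 0 < d.x2 e := fun e he => by
    rcases (d.rv2.nonneg e).lt_or_eq with h | h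
    · exact h
    · exact absurd (d.uniq hb h.symm hf) he
  obtain ⟨b, K, S1, S2, hS1, hS2, hK1, hK2, hbe⟩ := d.pot_int hb hf
  have hbo : ∀ e, e ≠ f → b (s e) + b (t e) = S1 * cr s t d.S e + S2 * cr s t d.S' e := fun e he => by
    rw [hbe]; simp [he]
  have hbnn : ∀ e, e ≠ f → 0 ≤ b (s e) + b (t e) := fun e he => by
    rw [hbo e he]
    have := cr_nonneg (s := s) (t := t) d.S e
    have := cr_nonneg (s := s) (t := t) d.S' e
    positivity
  have hbf : b (s f) + b (t f) = S1 * cr s t d.S f + S2 * cr s t d.S' f - K := by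
    rw [hbe]; simp
  have hloop : ∀ (x : E → ℤ) e, s e = t e → x e = 0 := fun x e he => absurd he (hb.nl e)
  have hQ : ∑ v, b v = S1 + S2 := by
    have := pot (s := s) (t := t) d.x2 (hloop _) b
    simp only [d.rv2.star, smul_eq_mul] at this
    rw [← mul_sum] at this
    have h2 : ∑ e, d.x2 e * (b (s e) + b (t e)) = S1 * cut s t d.S d.x2 + S2 * cut s t d.S' d.x2 := by
      unfold cut
      rw [mul_sum, mul_sum, ← sum_add_distrib]
      refine sum_congr rfl fun e _ => ?_
      by_cases he : e = f
      · simp [he, hf]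
      · rw [hbo e he]; ring
    rw [h2, d.t2, d.t2', ← add_mul, mul_comm] at this
    exact mul_right_cancel₀ hτ2.ne' this
  set P : ℤ → Finset V := fun k => univ.filter fun v => k ≤ b v with hP
  set N : ℤ → Finset V := fun k => univ.filter fun v => b v ≤ -k with hN
  have memP : ∀ k v, v ∈ P k ↔ k ≤ b v := fun k v => by simp [hP]
  have memN : ∀ k v, v ∈ N k ↔ b v ≤ -k := fun k v => by simp [hN]
  have hne : ∀ k e, e ≠ f → ne s t (N k) e ≤ ne s t (P k) e := by
    intro k e he
    have := hbnn e he
    unfold ne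
    simp only [memP, memN]
    split_ifs <;> omega
  have hnx : ∀ k e, d.x2 e * ne s t (N k) e ≤ d.x2 e * ne s t (P k) e := by
    intro k e
    by_cases he : e = f
    · simp [he, hf]
    · exact mul_le_mul_of_nonneg_left (hne k e he) (d.rv2.nonneg e)
  have hge : ∀ k, ((N k).card : ℤ) ≤ (P k).card := by
    intro k
    have h1 := pot_card (hloop d.x2) d.rv2.star (N k)
    have h2 := pot_card (hloop d.x2) d.rv2.star (P k)
    have h3 : d.τ2 * ((N k).card : ℤ) ≤ d.τ2 * (P k).card := by
      rw [h1, h2]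
      exact sum_le_sum fun e _ => hnx k e
    exact le_of_mul_le_mul_left h3 hτ2
  have hgt : ∀ k, 1 ≤ k → (b (s f) ≤ -k ∨ b (t f) ≤ -k) → ((N k).card : ℤ) + 1 ≤ (P k).card := by
    intro k hk hfk
    by_contra hcon
    have heq : ((N k).card : ℤ) = (P k).card := by have := hge k; omega
    have h1 := pot_card (hloop d.x2) d.rv2.star (N k)
    have h2 := pot_card (hloop d.x2) d.rv2.star (P k)
    rw [heq, h2] at h1
    have h3 := (sum_eq_sum_iff_of_le (fun e _ => hnx k e)).1 h1.symm
    have h4 : ∀ e, e ≠ f → ne s t (N k) e = ne s t (P k) e := fun e he =>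
      mul_left_cancel₀ (hu e he).ne' (h3 e (mem_univ e))
    have h5 := pot_card (hloop c) hb.rv.star (N k)
    have h6' := pot_card (hloop c) hb.rv.star (P k)
    rw [heq, h6'] at h5
    have h7 : ne s t (N k) f = ne s t (P k) f := by
      have e1 := add_sum_erase univ (fun e => c e * ne s t (N k) e) (mem_univ f)
      have e2 := add_sum_erase univ (fun e => c e * ne s t (P k) e) (mem_univ f)
      have e3 : ∑ e ∈ univ.erase f, c e * ne s t (N k) e = ∑ e ∈ univ.erase f, c e * ne s t (P k) e :=
        sum_congr rfl fun e he => by rw [h4 e (ne_of_mem_erase he)]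
      exact mul_left_cancel₀ (hb.pos f).ne' (by linarith)
    have h8 : ∀ e, ne s t (N k) e = ne s t (P k) e := fun e => by
      by_cases he : e = f
      · rw [he, h7]
      · exact h4 e he
    have h9 : ∀ e, (k ≤ b (s e) ∧ b (t e) ≤ -k) ∨ (k ≤ b (t e) ∧ b (s e) ≤ -k) ∨
        (-k < b (s e) ∧ b (s e) < k ∧ -k < b (t e) ∧ b (t e) < k) := by
      intro e
      have := h8 e
      unfold ne at this
      simp only [memP, memN] at this
      split_ifs at this <;> omega
    have hall : P k ∪ N k = univ := by
      rcases hb.conn h6 (X := P k ∪ N k) (fun e => by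
        rw [cr_eq_zero_iff]; simp only [mem_union, memP, memN]
        have := h9 e
        omega) with h | h
      · exfalso
        rcases hfk with h' | h'
        · have : s f ∈ (∅ : Finset V) := by rw [← h]; simp [memN, h']
          simp at this
        · have : t f ∈ (∅ : Finset V) := by rw [← h]; simp [memN, h']
          simp at this
      · exact h
    have hall' : ∀ v, k ≤ b v ∨ b v ≤ -k := fun v => by
      have := mem_univ v
      rw [← hall] at this
      simpa [memP, memN] using this
    refine hb.bip' d.rv1 hτ1 d.pos1 d.ntS d.t1 (fun v => if k ≤ b v then 1 else -1) ?_ ?_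
    · intro v hv; beta_reduce; split_ifs <;> simp
    · intro e _ _
      have := h9 e
      have := hall' (s e)
      beta_reduce
      split_ifs <;> omega
  -- layer cake
  set T : ℤ := max (-b (s f)) (-b (t f)) with hT
  have hgT : ∀ k, 1 ≤ k → k ≤ T → ((N k).card : ℤ) + 1 ≤ (P k).card := fun k h1 h2 => hgt k h1 (by omega)
  obtain ⟨B, hB⟩ : ∃ B : ℕ, ∀ v, b v ≤ B ∧ -b v ≤ B := by
    refine ⟨∑ v, (b v).natAbs, fun v => ?_⟩
    have : (b v).natAbs ≤ ∑ v, (b v).natAbs := single_le_sum (f := fun v => (b v).natAbs) (fun _ _ => Nat.zero_le _) (mem_univ v)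
    omega
  have hlay : S1 + S2 = ∑ k ∈ Finset.Icc 1 B, (((P k).card : ℤ) - (N k).card) := by
    rw [← hQ]
    have h1 : ∀ v, b v = ∑ t ∈ Finset.Icc 1 B, ((if (t : ℤ) ≤ b v then (1 : ℤ) else 0) - (if b v ≤ -(t : ℤ) then 1 else 0)) :=
      fun v => layer (b v) B (hB v).1 (hB v).2
    rw [sum_congr rfl fun v _ => h1 v, sum_comm]
    refine sum_congr rfl fun k _ => ?_
    rw [sum_sub_distrib]
    simp [hP, hN]
  have hTB : T ≤ B := by
    have := (hB (s f)).2
    have := (hB (t f)).2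
    omega
  have crle : ∀ S : Finset V, cr s t S f ≤ 1 := fun S => by unfold cr; split_ifs <;> simp
  have cS := crle d.S
  have cS' := crle d.S'
  have hT2 : 2 * (S1 + S2) ≤ 2 * T := by
    have : -b (s f) - b (t f) ≤ 2 * T := by omega
    nlinarith
  have hT1 : 1 ≤ T := by omega
  have hsplit : ∀ k ∈ Finset.Icc 1 B, (if (k : ℤ) ≤ T then (1 : ℤ) else 0) ≤ ((P k).card : ℤ) - (N k).card := by
    intro k hk
    rw [mem_Icc] at hk
    split_ifs with h
    · have := hgT k (by exact_mod_cast hk.1) h; omega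
    · have := hge k; omega
  have hTs : ∑ k ∈ Finset.Icc 1 B, (if (k : ℤ) ≤ T then (1 : ℤ) else 0) = T := by
    have := layer T B hTB (by omega)
    conv_rhs => rw [this]
    refine sum_congr rfl fun k hk => ?_
    rw [if_neg (c := T ≤ -(k:ℤ)) (by omega), sub_zero]
  have hTle : T ≤ S1 + S2 := by
    rw [hlay, ← hTs]
    exact sum_le_sum hsplit
  have hTeq : T = S1 + S2 := by omega
  have hgap : ((P 1).card : ℤ) = (N 1).card + 1 := by
    have h1 := (sum_eq_sum_iff_of_le hsplit).1 (by rw [hTs, ← hlay, hTeq])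
    have h2 := h1 1 (by rw [mem_Icc]; omega)
    rw [if_pos (by exact_mod_cast hT1)] at h2
    push_cast at h2
    omega
  have m1 : S1 * cr s t d.S f ≤ S1 := by nlinarith
  have m2 : S2 * cr s t d.S' f ≤ S2 := by nlinarith
  have q1 : S1 = S2 := by omega
  have q2 : S1 * cr s t d.S f = S1 := by omega
  have q3 : S2 * cr s t d.S' f = S2 := by omega
  have hcf : cr s t d.S f = 1 := mul_left_cancel₀ hS1.ne' (by linarith)
  have hbs : b (s f) = - (2 * S1) := by omega
  have hbt : b (t f) = - (2 * S1) := by omega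
  subst q1
  have hdvd : ∀ v, S1 ∣ b v := by
    rcases hb.conn h6 (X := univ.filter fun v => S1 ∣ b v) (fun e => by
      rw [cr_eq_zero_iff]
      simp only [mem_filter, mem_univ, true_and]
      by_cases he : e = f
      · rw [he, hbs, hbt]
      · have h1 : S1 ∣ b (s e) + b (t e) := by
          rw [hbo e he, ← mul_add]; exact dvd_mul_right _ _
        constructor
        · intro h; exact (dvd_add_right h).1 h1
        · intro h; exact (dvd_add_left h).1 h1) with h | h
    · exfalso
      have : s f ∈ (∅ : Finset V) := by rw [← h]; simp [hbs]
      simp at this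
    · intro v
      have := mem_univ v
      rw [← h] at this
      simpa using this
  have hz : ∀ A : Finset V, NT A → cut s t A d.x1 = d.τ1 → (∀ e, cr s t A e = cr s t d.S e) →
      ∃ v ∈ A, b v = 0 := by
    intro A hA hA1 hAcr
    by_contra hcon
    push Not at hcon
    refine hb.bip' d.rv1 hτ1 d.pos1 hA hA1 (fun v => if 0 < b v then 1 else -1) ?_ ?_
    · intro v hv; beta_reduce; split_ifs <;> simp
    · intro e h1 h2
      have hc0 : cr s t A e = 0 := by rw [cr_eq_zero_iff]; simp [h1, h2]
      have hef : e ≠ f := by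
        rintro rfl
        rw [hAcr] at hc0
        omega
      have h3 := hbo e hef
      rw [← hAcr, hc0] at h3
      have h4 := hcon _ h1
      have h5 := hcon _ h2
      obtain ⟨i, hi⟩ := hdvd (s e)
      obtain ⟨j, hj⟩ := hdvd (t e)
      have hcr : cr s t d.S' e = 0 ∨ cr s t d.S' e = 1 := by unfold cr; split_ifs <;> simp
      have h7 : 0 < b (s e) → 0 < b (t e) → False := by
        intro h7 h8
        have e1 := Int.le_of_dvd h7 (hdvd _)
        have e2 := Int.le_of_dvd h8 (hdvd _)
        rcases hcr with h | h <;> rw [h] at h3 <;> omega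
      have h8 := hbnn e hef
      beta_reduce
      split_ifs with g1 g2 g2
      · exact (h7 g1 g2).elim
      · rfl
      · rfl
      · omega
  obtain ⟨v1, hv1, hv1z⟩ := hz d.S d.ntS d.t1 (fun _ => rfl)
  obtain ⟨v2, hv2, hv2z⟩ := hz d.Sᶜ (d.ntS.compl hV) (by rw [cut_compl]; exact d.t1) (fun e => cr_compl _ e)
  rw [mem_compl] at hv2
  set Z1 := univ.filter fun v => v ∈ d.S ∧ b v = 0 with hZ1
  set Z2 := univ.filter fun v => v ∉ d.S ∧ b v = 0 with hZ2
  have hZodd : Odd (Z1.card + Z2.card) := by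
    have h1 : (P 1).card + (N 1).card + (Z1.card + Z2.card) = Fintype.card V := by
      simp only [card_filter, hP, hN, hZ1, hZ2, ← sum_add_distrib]
      rw [Fintype.card_eq_sum_ones]
      refine sum_congr rfl fun v _ => ?_
      by_cases hvS : v ∈ d.S <;> simp only [hvS, true_and, false_and, not_true, not_false_iff, if_false] <;> split_ifs <;> omega
    obtain ⟨k, hk⟩ := hV
    have : (P 1).card = (N 1).card + 1 := by exact_mod_cast hgap
    exact ⟨k - (N 1).card - 1, by omega⟩
  have hcross : ∀ e, e ≠ f → cr s t Z1 e + cr s t Z2 e ≤ ne s t (P 1) e - ne s t (N 1) e := by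
    intro e he
    have h1 := hbo e he
    have h2 := hbnn e he
    have h3 := cr_nonneg (s := s) (t := t) d.S' e
    have hnz : b (s e) = 0 → b (t e) = 0 → (s e ∈ d.S ↔ t e ∈ d.S) := by
      intro h4 h5
      rw [← cr_eq_zero_iff]
      have h6 := cr_nonneg (s := s) (t := t) d.S e
      rw [h4, h5] at h1
      nlinarith
    exact cross_aux b d.S e h2 hnz
  have hfz : cr s t Z1 f = 0 ∧ cr s t Z2 f = 0 := by
    rw [cr_eq_zero_iff, cr_eq_zero_iff]
    simp only [hZ1, hZ2, mem_filter, mem_univ, true_and, hbs, hbt]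
    have : ¬ (-(2 * S1) = 0) := by omega
    simp [this]
  have hsum : cut s t Z1 d.x2 + cut s t Z2 d.x2 ≤ d.τ2 := by
    have h1 := pot_card (hloop d.x2) d.rv2.star (N 1)
    have h2 := pot_card (hloop d.x2) d.rv2.star (P 1)
    have h3 : d.τ2 = ∑ e, d.x2 e * ne s t (P 1) e - ∑ e, d.x2 e * ne s t (N 1) e := by
      rw [← h1, ← h2, hgap]; ring
    rw [h3, ← sum_sub_distrib]
    unfold cut
    rw [← sum_add_distrib]
    refine sum_le_sum fun e _ => ?_
    by_cases he : e = f
    · simp [he, hf]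
    · rw [← add_mul, ← mul_sub, mul_comm]
      exact mul_le_mul_of_nonneg_left (hcross e he) (d.rv2.nonneg e)
  have fin : ∀ X Y : Finset V, cr s t X f = 0 → cut s t X d.x2 + cut s t Y d.x2 ≤ d.τ2 → Odd Y.card →
      X.Nonempty → X ≠ univ → False := by
    intro X Y h1 h2 h3 h4 h5
    have h7 := d.rv2.odd Y h3
    rcases hb.conn h6 (X := X) (fun e => by
      by_cases he : e = f
      · rw [he, h1]
      · exact nocross_of_cut d.rv2.nonneg (by omega) e (hu e he)) with h | h
    · exact h4.ne_empty h
    · exact h5 h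
  have n1 : v1 ∈ Z1 := by simp [hZ1, hv1, hv1z]
  have n2 : v2 ∈ Z2 := by simp [hZ2, hv2, hv2z]
  have u1 : Z1 ≠ univ := by
    intro h
    have : v2 ∈ Z1 := by rw [h]; simp
    simp [hZ1, hv2] at this
  have u2 : Z2 ≠ univ := by
    intro h
    have : v1 ∈ Z2 := by rw [h]; simp
    simp [hZ2, hv1] at this
  by_cases ho : Odd Z2.card
  · exact fin Z1 Z2 hfz.1 hsum ho ⟨v1, n1⟩ u1
  · have ho1 : Odd Z1.card := by
      by_contra hcon
      exact (Nat.not_even_iff_odd.2 hZodd) ((Nat.not_odd_iff_even.1 hcon).add (Nat.not_odd_iff_even.1 ho))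
    exact fin Z2 Z1 hfz.2 (by linarith) ho1 ⟨v2, n2⟩ u2

theorem Brick.main (hb : Brick s t c τ) :
    ∃ k : ℕ, (2 ^ k : ℤ) • c ∈ AddSubmonoid.closure (PM s t) := by
  refine brick_main hb fun d => ?_
  by_cases h : ∃ f, d.x2 f = 0
  · obtain ⟨f, hf⟩ := h
    exact d.case1 hb hf
  · push Not at h
    exact d.case2 hb fun e => lt_of_le_of_ne (d.rv2.nonneg e) (h e).symm

end case1b

end TDD

namespace TDD

section contract
variable {V E W W1 W2 : Type} [Fintype V] [Fintype E] [Fintype W] [Fintype W1] [Fintype W2]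
  {s t : E → V} {c : E → ℤ} {τ : ℤ}

/-- contracted vector -/
noncomputable def cvec (s t : E → V) (π : V → W) (c : E → ℤ) (e : E) : ℤ :=
  if π (s e) = π (t e) then 0 else c e

lemma cut_cvec (π : V → W) (S1 : Finset W) :
    cut (π ∘ s) (π ∘ t) S1 (cvec s t π c) = cut s t (univ.filter fun v => π v ∈ S1) c := by
  unfold cut
  refine sum_congr rfl fun e _ => ?_
  unfold cr cvec
  simp only [Function.comp, mem_filter, mem_univ, true_and]
  by_cases h : π (s e) = π (t e) <;> simp [h]

lemma RV.contract (hc : RV s t c τ) (π : V → W) (hodd : ∀ w, Odd (univ.filter fun v => π v = w).card)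
    (hcut : ∀ w, cut s t (univ.filter fun v => π v = w) c = τ) :
    RV (π ∘ s) (π ∘ t) (cvec s t π c) τ where
  nonneg e := by
    unfold cvec; split_ifs
    · exact le_rfl
    · exact hc.nonneg e
  loop e h := by unfold cvec; exact if_pos h
  star w := by
    rw [cut_cvec, ← hcut w]; simp
  odd S1 hS1 := by
    rw [cut_cvec]
    apply hc.odd
    rw [card_eq_sum_card_fiberwise (f := π) (t := S1) (fun v hv => by simpa using hv)]
    rw [Finset.odd_sum_iff_odd_card_odd]
    have : (S1.filter fun w => Odd ((univ.filter fun v => π v ∈ S1).filter fun v => π v = w).card) = S1 := by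
      rw [filter_eq_self]
      intro w hw
      have h2 : ((univ.filter fun v => π v ∈ S1).filter fun v => π v = w) = univ.filter fun v => π v = w := by
        ext v; simp; rintro rfl; exact hw
      rw [h2]; exact hodd w
    convert hS1

/-- glued vector -/
noncomputable def glue (s t : E → V) (S : Finset V) (x1 x2 : E → ℤ) (e : E) : ℤ :=
  if s e ∈ S ∨ t e ∈ S then x1 e else x2 e

lemma glue_add (S : Finset V) (x1 x2 y1 y2 : E → ℤ) :
    glue s t S (x1 + y1) (x2 + y2) = glue s t S x1 x2 + glue s t S y1 y2 := by
  ext e; unfold glue; simp only [Pi.add_apply]; split_ifs <;> rfl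

lemma glue_PM {S : Finset V} {π1 : V → W1} {π2 : V → W2} 
    (h1' : ∀ u v, u ∈ S → (π1 v = π1 u ↔ v = u)) 
    (h2' : ∀ u v, u ∉ S → (π2 v = π2 u ↔ v = u)) {m1 m2 : E → ℤ}
    (hm1 : m1 ∈ PM (π1 ∘ s) (π1 ∘ t)) (hm2 : m2 ∈ PM (π2 ∘ s) (π2 ∘ t))
    (hag : ∀ e, cr s t S e = 1 → m1 e = m2 e) : glue s t S m1 m2 ∈ PM s t := by
  refine ⟨fun e => ?_, fun e he => ?_, fun v => ?_⟩
  · unfold glue; split_ifs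
    · exact hm1.1 e
    · exact hm2.1 e
  · unfold glue; split_ifs
    · exact hm1.2.1 e (by simp [he])
    · exact hm2.2.1 e (by simp [he])
  · by_cases hv : v ∈ S
    · rw [← hm1.2.2 (π1 v)]
      unfold cut
      refine sum_congr rfl fun e _ => ?_
      unfold cr glue
      simp only [Function.comp, mem_singleton, h1' v _ hv]
      by_cases g1 : s e = v
      · simp [g1, hv]
      · by_cases g2 : t e = v
        · simp [g2, hv]
        · simp [g1, g2]
    · rw [← hm2.2.2 (π2 v)]
      unfold cut
      refine sum_congr rfl fun e _ => ?_
      have hae := hag e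
      rw [cr_eq_one_iff] at hae
      unfold cr glue
      simp only [Function.comp, mem_singleton, h2' v _ hv]
      by_cases g1 : s e = v
      · by_cases g3 : t e ∈ S
        · simp [g1, hv, g3, hae]
        · simp [g1, hv, g3]
      · by_cases g2 : t e = v
        · by_cases g3 : s e ∈ S
          · simp [g2, hv, g3, hae]
          · simp [g2, hv, g3]
        · simp [g1, g2]

lemma RV.zero_of {x : E → ℤ} (hx : RV s t x 0) : x = 0 := by
  ext e
  by_cases h : s e = t e
  · exact hx.loop e h
  · have h1 := hx.star (s e)
    have h2 : cr s t {s e} e * x e ≤ cut s t {s e} x :=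
      single_le_sum (f := fun e' => cr s t {s e} e' * x e') (fun e' _ => mul_nonneg (cr_nonneg _ e') (hx.nonneg e')) (mem_univ e)
    have h3 : cr s t {s e} e = 1 := by rw [cr_eq_one_iff]; simp; exact fun h' => h h'.symm
    rw [h1, h3, one_mul] at h2
    exact le_antisymm h2 (hx.nonneg e)

lemma RV.tau_nonneg {x : E → ℤ} {σ : ℤ} (hx : RV s t x σ) (v : V) : 0 ≤ σ := by
  rw [← hx.star v]; exact cut_nonneg _ hx.nonneg

lemma RV.sub_PM {x y z : E → ℤ} {σ ζ : ℤ} [Nonempty V] (hx : RV s t x σ) (hy : y ∈ PM s t) (hz : RV s t z ζ)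
    (h : x = y + z) : σ = 1 + ζ := by
  obtain ⟨v⟩ := ‹Nonempty V›
  rw [← hx.star v, h, cut_add, (PM.rv hy).star, hz.star]

lemma glue_closure {S : Finset V} {π1 : V → W1} {π2 : V → W2} {w1 : W1} {w2 : W2}
    (h1 : ∀ v, π1 v = w1 ↔ v ∉ S) (h2 : ∀ v, π2 v = w2 ↔ v ∈ S)
    (h1' : ∀ u v, u ∈ S → (π1 v = π1 u ↔ v = u)) 
    (h2' : ∀ u v, u ∉ S → (π2 v = π2 u ↔ v = u)) (n : ℕ) : ∀ {x1 x2 : E → ℤ}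
    (_ : x1 ∈ AddSubmonoid.closure (PM (π1 ∘ s) (π1 ∘ t)))
    (_ : x2 ∈ AddSubmonoid.closure (PM (π2 ∘ s) (π2 ∘ t)))
    (_ : ∀ e, cr s t S e = 1 → x1 e = x2 e) (_ : RV (π1 ∘ s) (π1 ∘ t) x1 n)
    (_ : RV (π2 ∘ s) (π2 ∘ t) x2 n), glue s t S x1 x2 ∈ AddSubmonoid.closure (PM s t) := by
  have c1 : ∀ e, cr (π1 ∘ s) (π1 ∘ t) {w1} e = cr s t S e := by
    intro e; unfold cr; simp only [Function.comp, mem_singleton, h1]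
    by_cases g1 : s e ∈ S <;> by_cases g2 : t e ∈ S <;> simp [g1, g2]
  have c2 : ∀ e, cr (π2 ∘ s) (π2 ∘ t) {w2} e = cr s t S e := by
    intro e; unfold cr; simp only [Function.comp, mem_singleton, h2]
  induction n with
  | zero =>
    intro x1 x2 hx1 hx2 hag hr1 hr2
    have e1 := RV.zero_of (by exact_mod_cast hr1)
    have e2 := RV.zero_of (by exact_mod_cast hr2)
    have : glue s t S x1 x2 = 0 := by
      ext e; unfold glue; simp [e1, e2]
    rw [this]; exact zero_mem _
  | succ n ih =>
    intro x1 x2 hx1 hx2 hag hr1 hr2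
    obtain ⟨e, he, hx1e⟩ : ∃ e, cr s t S e = 1 ∧ 0 < x1 e := by
      by_contra hcon
      push Not at hcon
      have h3 := hr1.star w1
      have h4 : cut (π1 ∘ s) (π1 ∘ t) {w1} x1 ≤ 0 := by
        refine sum_nonpos fun e _ => ?_
        rw [c1]
        rcases (show cr s t S e = 0 ∨ cr s t S e = 1 by unfold cr; split_ifs <;> simp) with h | h
        · simp [h]
        · rw [h, one_mul]; exact hcon e h
      rw [h3] at h4
      push_cast at h4
      omega
    obtain ⟨M, hM, hMe, z, hz, hxz⟩ := closure_split hx1 e hx1e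
    obtain ⟨M', hM', hMe', z', hz', hxz'⟩ := closure_split hx2 e (by rw [← hag e he]; exact hx1e)
    obtain ⟨ζ, hζ⟩ := closure_rv hz
    obtain ⟨ζ', hζ'⟩ := closure_rv hz'
    have n1 : ((n + 1 : ℕ) : ℤ) = 1 + ζ := @RV.sub_PM _ _ _ _ _ _ _ _ _ _ _ ⟨w1⟩ hr1 hM hζ hxz
    have n2 : ((n + 1 : ℕ) : ℤ) = 1 + ζ' := @RV.sub_PM _ _ _ _ _ _ _ _ _ _ _ ⟨w2⟩ hr2 hM' hζ' hxz'
    have single : ∀ (M : E → ℤ), (∀ e, 0 ≤ M e) → ∑ e', cr s t S e' * M e' = 1 → 0 < M e →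
        ∀ e', cr s t S e' = 1 → M e' = if e' = e then 1 else 0 := by
      intro M hM0 hsum hMe e' he'
      have p1 := add_sum_erase univ (fun e' => cr s t S e' * M e') (mem_univ e)
      have p2 : ∀ e' ∈ univ.erase e, 0 ≤ cr s t S e' * M e' := fun e' _ => mul_nonneg (cr_nonneg _ _) (hM0 _)
      have p3 := sum_nonneg p2
      rw [hsum, he, one_mul] at p1
      split_ifs with h
      · rw [h]; omega
      · have p4 := single_le_sum p2 (mem_erase.2 ⟨h, mem_univ e'⟩)
        simp only [he', one_mul] at p4
        have := hM0 e'
        omega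
    have s1 := single M hM.1 (by rw [← hM.2.2 w1, cut]; exact sum_congr rfl fun e _ => by rw [c1]) hMe
    have s2 := single M' hM'.1 (by rw [← hM'.2.2 w2, cut]; exact sum_congr rfl fun e _ => by rw [c2]) hMe'
    have agM : ∀ e', cr s t S e' = 1 → M e' = M' e' := fun e' h => by rw [s1 e' h, s2 e' h]
    rw [hxz, hxz', glue_add]
    refine add_mem (AddSubmonoid.subset_closure (glue_PM h1' h2' hM hM' agM)) (ih hz hz' ?_ ?_ ?_)
    · intro e' h
      have := hag e' h
      rw [hxz, hxz'] at this
      simp only [Pi.add_apply, agM e' h] at this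
      omega
    · have : ζ = n := by push_cast at n1; omega
      rw [← this]; exact hζ
    · have : ζ' = n := by push_cast at n2; omega
      rw [← this]; exact hζ'

/-- shrink complement of `A` -/
noncomputable def shr (A : Finset V) (v : V) : Option {v // v ∈ A} :=
  if h : v ∈ A then some ⟨v, h⟩ else none

lemma shr_none {A : Finset V} {v : V} : shr A v = none ↔ v ∉ A := by
  unfold shr; split_ifs with h <;> simp [h]

lemma shr_some {A : Finset V} {v : V} {u : {v // v ∈ A}} : shr A v = some u ↔ v = u.1 := by
  unfold shr; split_ifs with h
  · simp [Subtype.ext_iff]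
  · simp; rintro rfl; exact h u.2

lemma shr_eq {A : Finset V} {u v : V} (hu : u ∈ A) : shr A v = shr A u ↔ v = u := by
  have : shr A u = some ⟨u, hu⟩ := shr_some.2 rfl
  rw [this, shr_some]

lemma RV.shrink (hc : RV s t c τ) {A : Finset V} (hA : Odd Aᶜ.card) (hcut : cut s t A c = τ) :
    RV (shr A ∘ s) (shr A ∘ t) (cvec s t (shr A) c) τ := by
  apply hc.contract
  · rintro (_ | w)
    · convert hA using 2
      ext v; simp [shr_none]
    · have : (univ.filter fun v => shr A v = some w).card = 1 :=
        card_eq_one.2 ⟨w.1, by ext v; simp [shr_some]⟩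
      convert odd_one using 1
      convert this
  · rintro (_ | w)
    · rw [← hcut, ← cut_compl]
      congr 1
      ext v; simp [shr_none]
    · rw [← hc.star w.1]
      congr 1
      ext v; simp [shr_some]

lemma closure_smul_pow {P : Set (E → ℤ)} {x : E → ℤ} {k : ℕ}
    (h : (2 ^ k : ℤ) • x ∈ AddSubmonoid.closure P) (l : ℕ) :
    (2 ^ (k + l) : ℤ) • x ∈ AddSubmonoid.closure P := by
  have := AddSubmonoid.nsmul_mem _ h (2 ^ l)
  rw [← natCast_zsmul, smul_smul] at this
  convert this using 2
  push_cast
  ring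

lemma tight_step (hτ : 0 < τ) (hc : RV s t c τ) {S : Finset V} (hS : NT S) (hcut : cut s t S c = τ)
    (ih : ∀ (W : Type) [Fintype W] (s' t' : E → W) (c' : E → ℤ), Fintype.card W < Fintype.card V →
      RV s' t' c' τ → ∃ k : ℕ, (2 ^ k : ℤ) • c' ∈ AddSubmonoid.closure (PM s' t')) :
    ∃ k : ℕ, (2 ^ k : ℤ) • c ∈ AddSubmonoid.closure (PM s t) := by
  have hV := hc.even_card hτ
  have hS' := hS.compl hV
  have r1 := hc.shrink (A := S) hS'.1 hcut
  have r2 := hc.shrink (A := Sᶜ) (by simpa using hS.1) (by rw [cut_compl]; exact hcut)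
  have cS := card_compl S
  have lS := card_le_univ S
  obtain ⟨k, hk⟩ := ih _ _ _ _ (by
    rw [Fintype.card_option, Fintype.card_coe]
    have := hS.2.2
    omega) r1
  obtain ⟨l, hl⟩ := ih _ _ _ _ (by
    rw [Fintype.card_option, Fintype.card_coe]
    have := hS.2.1
    omega) r2
  have hk' := closure_smul_pow hk l
  have hl' := closure_smul_pow hl k
  rw [add_comm l k] at hl'
  refine ⟨k + l, ?_⟩
  have q1 := r1.smul (n := 2 ^ (k + l)) (by positivity)
  have q2 := r2.smul (n := 2 ^ (k + l)) (by positivity)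
  have hn : (2 ^ (k + l) * τ) = ((2 ^ (k + l) * τ).toNat : ℤ) := by
    rw [Int.toNat_of_nonneg (by positivity)]
  rw [hn] at q1 q2
  have := glue_closure (S := S) (w1 := none) (w2 := none) (fun v => shr_none)
    (fun v => by rw [shr_none]; simp) (fun u v hu => shr_eq hu) (fun u v hu => shr_eq (by simpa using hu))
    _ hk' hl' ?_ q1 q2
  · convert this using 1
    ext e
    unfold glue cvec
    by_cases h : s e = t e
    · simp [hc.loop e h, h]
    · simp only [Pi.smul_apply]
      split_ifs with g1 g2 g3
      · exfalso
        rcases g1 with g1 | g1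
        · rw [eq_comm, shr_eq g1] at g2; exact h g2.symm
        · rw [shr_eq g1] at g2; exact h g2
      · rfl
      · exfalso
        push Not at g1
        rw [shr_eq (by simpa using g1.2)] at g3
        exact h g3
      · rfl
  · intro e he
    rw [cr_eq_one_iff] at he
    simp only [Pi.smul_apply]
    congr 1
    unfold cvec
    rw [if_neg, if_neg]
    · intro h
      by_cases g1 : s e ∈ S
      · have := shr_none (A := Sᶜ) (v := s e)
        rw [h, shr_none] at this
        simp at this
        exact he this.symm
      · have := shr_none (A := Sᶜ) (v := s e)
        rw [h, shr_none] at this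
        simp at this
        exact he this.symm
    · intro h
      have := shr_none (A := S) (v := s e)
      rw [h, shr_none] at this
      exact he (not_iff_not.1 this.symm)

/-- extension by zero -/
noncomputable def ext0 (p : E → Prop) (x : {e // p e} → ℤ) (e : E) : ℤ := if h : p e then x ⟨e, h⟩ else 0

lemma cut_ext0 (p : E → Prop) (x : {e // p e} → ℤ) (S : Finset V) :
    cut s t S (ext0 p x) = cut (fun e : {e // p e} => s e.1) (fun e => t e.1) S x := by
  unfold cut
  have h1 : ∑ e, cr s t S e * ext0 p x e = ∑ e ∈ univ.filter p, cr s t S e * ext0 p x e := by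
    rw [sum_filter]
    refine sum_congr rfl fun e _ => ?_
    split_ifs with h
    · rfl
    · simp [ext0, h]
  rw [h1, ← sum_subtype_of_mem (p := p) _ (fun e he => (mem_filter.1 he).2)]
  have : (univ.filter p).subtype p = univ := by ext e; simp [e.2]
  rw [this]
  refine sum_congr rfl fun e _ => ?_
  simp [ext0, e.2, cr]

lemma closure_ext0 (p : E → Prop) {x : {e // p e} → ℤ}
    (hx : x ∈ AddSubmonoid.closure (PM (fun e : {e // p e} => s e.1) (fun e => t e.1))) :
    ext0 p x ∈ AddSubmonoid.closure (PM s t) := by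
  induction hx using AddSubmonoid.closure_induction with
  | mem m h =>
    apply AddSubmonoid.subset_closure
    refine ⟨fun e => ?_, fun e he => ?_, fun v => ?_⟩
    · unfold ext0; split_ifs
      · exact h.1 _
      · exact le_rfl
    · unfold ext0; split_ifs
      · exact h.2.1 _ he
      · rfl
    · rw [cut_ext0]; exact h.2.2 v
  | zero =>
    have : ext0 p (0 : {e // p e} → ℤ) = 0 := by ext e; simp [ext0]
    rw [this]; exact zero_mem _
  | add a b _ _ ha hb =>
    have : ext0 p (a + b) = ext0 p a + ext0 p b := by
      ext e; simp only [ext0, Pi.add_apply]; split_ifs <;> simp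
    rw [this]; exact add_mem ha hb

end contract

theorem pm_main (n : ℕ) : ∀ (V : Type) [Fintype V], Fintype.card V = n → ∀ (E : Type) [Fintype E]
    (s t : E → V) (c : E → ℤ) (τ : ℤ),
    RV s t c τ → ∃ k : ℕ, (2 ^ k : ℤ) • c ∈ AddSubmonoid.closure (PM s t) := by
  induction n using Nat.strong_induction_on with
  | _ n ihn =>
  intro V _ hVn
  suffices h : ∀ (m : ℕ) (E : Type) [Fintype E] (s t : E → V) (c : E → ℤ) (τ : ℤ),
      (univ.filter fun e => c e ≠ 0).card = m →
      RV s t c τ → ∃ k : ℕ, (2 ^ k : ℤ) • c ∈ AddSubmonoid.closure (PM s t) by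
    intro E _ s t c τ hc
    exact h _ E s t c τ rfl hc
  intro m
  induction m using Nat.strong_induction_on with
  | _ m ihm =>
  intro E _ s t c τ hm hc
  have zc : c = 0 → ∃ k : ℕ, (2 ^ k : ℤ) • c ∈ AddSubmonoid.closure (PM s t) := by
    rintro rfl; exact ⟨0, by simp⟩
  by_cases hne : Nonempty V
  swap
  · apply zc
    ext e
    exact absurd ⟨s e⟩ hne
  by_cases hτ : 0 < τ
  swap
  · apply zc
    obtain ⟨v⟩ := hne
    have := hc.tau_nonneg v
    have h0 : τ = 0 := by omega
    subst h0
    exact hc.zero_of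
  have tight : ∀ (E : Type) [Fintype E] (s t : E → V) (c : E → ℤ) (τ : ℤ), 0 < τ → RV s t c τ →
      (∃ S, NT S ∧ cut s t S c = τ) → ∃ k : ℕ, (2 ^ k : ℤ) • c ∈ AddSubmonoid.closure (PM s t) := by
    rintro E _ s t c τ hτ hc ⟨S, hS, hcut⟩
    exact tight_step hτ hc hS hcut fun W _ s' t' c' hW hr => ihn _ (hVn ▸ hW) W rfl E s' t' c' τ hr
  by_cases ht : ∃ S, NT S ∧ cut s t S c = τ
  · exact tight E s t c τ hτ hc ht
  obtain ⟨p, hp⟩ : ∃ p : E → Prop, ∀ e, p e ↔ c e ≠ 0 := ⟨_, fun e => Iff.rfl⟩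
  set c' : {e // p e} → ℤ := fun e => c e.1 with hc'
  have hcc : ext0 p c' = c := by
    ext e; unfold ext0; split_ifs with h
    · rfl
    · rw [hp, not_not] at h; exact h.symm
  have hcut : ∀ S : Finset V, cut (fun e : {e // p e} => s e.1) (fun e => t e.1) S c' = cut s t S c := by
    intro S; rw [← cut_ext0, hcc]
  have hcard : Fintype.card {e // p e} = m := by rw [← hm, Fintype.card_subtype]; simp only [hp]
  have hrv : RV (fun e : {e // p e} => s e.1) (fun e => t e.1) c' τ :=
    ⟨fun e => hc.nonneg _, fun e he => hc.loop _ he, fun v => by rw [hcut]; exact hc.star v,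
      fun S hS => by rw [hcut]; exact hc.odd S hS⟩
  have hb : Brick (fun e : {e // p e} => s e.1) (fun e => t e.1) c' τ :=
    { nev := hne
      nl := fun e he => (hp _).1 e.2 (hc.loop _ he)
      pos := fun e => lt_of_le_of_ne (hc.nonneg _) (Ne.symm ((hp _).1 e.2))
      rv := hrv
      tpos := hτ
      strict := fun S hS => by
        rw [hcut]
        refine lt_of_le_of_ne (hc.odd S hS.1) fun h => ht ⟨S, hS, h.symm⟩
      hB := by
        rintro x σ hx (⟨e, he⟩ | hS)
        · refine ihm _ ?_ _ _ _ x σ rfl hx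
          rw [← hcard, ← card_univ]
          apply card_lt_card
          rw [ssubset_univ_iff]
          intro h
          have : e ∈ univ.filter fun e => x e ≠ 0 := by rw [h]; simp
          simp [he] at this
        · rcases (hx.tau_nonneg hne.some).lt_or_eq with h | h
          · exact tight _ _ _ _ _ h hx hS
          · subst h
            rw [hx.zero_of]
            exact ⟨0, by simp⟩ }
  obtain ⟨k, hk⟩ := hb.main
  refine ⟨k, ?_⟩
  have := closure_ext0 p hk
  convert this using 1
  rw [← hcc]
  ext e
  simp only [ext0, Pi.smul_apply]
  split_ifs <;> simp

end TDD

namespace TDD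

section tj
variable {V : Type} [Fintype V]

/-- T-join vectors with a counter -/
def TJ (T : Finset V) : Set ((V × V → ℤ) × ℤ) :=
  {j | (∀ e, 0 ≤ j.1 e) ∧ (∀ v, Odd (cut Prod.fst Prod.snd {v} j.1) ↔ v ∈ T) ∧ j.2 = 1}

lemma TJ_split {T : Finset V} {y : (V × V → ℤ) × ℤ} (hy : y ∈ AddSubmonoid.closure (TJ T)) :
    ∀ e, 0 < y.1 e → ∃ M ∈ TJ T, 0 < M.1 e ∧ ∃ z ∈ AddSubmonoid.closure (TJ T), y = M + z := by
  induction hy using AddSubmonoid.closure_induction with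
  | mem x h => intro e he; exact ⟨x, h, he, 0, zero_mem _, by simp⟩
  | zero => intro e he; simp at he
  | add x y hx' hy' hx hy =>
    intro e he
    by_cases h : 0 < x.1 e
    · obtain ⟨M, hM, hMe, z, hz, h2⟩ := hx e h
      exact ⟨M, hM, hMe, z + y, add_mem hz hy', by rw [h2, add_assoc]⟩
    · obtain ⟨M, hM, hMe, z, hz, h2⟩ := hy e (by simp at he; omega)
      exact ⟨M, hM, hMe, x + z, add_mem hx' hz, by rw [h2, add_left_comm]⟩

lemma cut_single' {E : Type} [Fintype E] [DecidableEq E] {s t : E → V} (S : Finset V) (e : E) :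
    cut s t S (Pi.single e 1) = cr s t S e := by
  unfold cut; simp [Pi.single_apply]

lemma cr_J {E : Type} {s t : E → V} {e : E} {u v : V} (h : J s t e u v) (X : Finset V) :
    cr s t X e = if (u ∈ X ↔ v ∈ X) then 0 else 1 := by
  unfold cr
  rcases h with ⟨rfl, rfl⟩ | ⟨rfl, rfl⟩
  · rfl
  · simp only [Iff.comm]

/-- the exchange vector -/
noncomputable def xv (g e1 e2 : V × V) : V × V → ℤ := Pi.single e1 1 + Pi.single e2 1 - Pi.single g 1

lemma cut_xv {u v1 v2 : V} {e1 e2 : V × V} (h1 : J Prod.fst Prod.snd e1 u v1)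
    (h2 : J Prod.fst Prod.snd e2 u v2) {X : Finset V} (hX : u ∉ X) :
    cut Prod.fst Prod.snd X (xv (v1, v2) e1 e2) = if v1 ∈ X ∧ v2 ∈ X then 2 else 0 := by
  unfold xv
  rw [cut_sub, cut_add, cut_single', cut_single', cut_single', cr_J h1, cr_J h2,
    cr_J (J.st (v1, v2))]
  by_cases g1 : v1 ∈ X <;> by_cases g2 : v2 ∈ X <;> simp [g1, g2, hX]

lemma cut_xv_even {u v1 v2 : V} {e1 e2 : V × V} (h1 : J Prod.fst Prod.snd e1 u v1)
    (h2 : J Prod.fst Prod.snd e2 u v2) (X : Finset V) :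
    Even (cut Prod.fst Prod.snd X (xv (v1, v2) e1 e2)) := by
  by_cases hX : u ∈ X
  · rw [← cut_compl, cut_xv h1 h2 (by simpa using hX)]
    split_ifs <;> decide
  · rw [cut_xv h1 h2 hX]
    split_ifs <;> decide

lemma TJ_exchange {T : Finset V} {u v1 v2 : V} {e1 e2 : V × V} (h1 : J Prod.fst Prod.snd e1 u v1)
    (h2 : J Prod.fst Prod.snd e2 u v2) {n : ℤ} (a : ℕ) : ∀ {y : V × V → ℤ},
    (y, n) ∈ AddSubmonoid.closure (TJ T) → (a : ℤ) ≤ y (v1, v2) → e1 ≠ (v1, v2) → e2 ≠ (v1, v2) →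
    (y + (a : ℤ) • xv (v1, v2) e1 e2, n) ∈ AddSubmonoid.closure (TJ T) := by
  induction a with
  | zero => intro y hy _ _ _; simpa using hy
  | succ a ih =>
    intro y hy ha n1 n2
    push_cast at ha
    obtain ⟨M, hM, hMe, z, hz, h⟩ := TJ_split hy (v1, v2) (by simp; omega)
    have hM' : (M.1 + xv (v1, v2) e1 e2, M.2) ∈ TJ T := by
      refine ⟨fun e => ?_, fun v => ?_, hM.2.2⟩
      · have := hM.1 e
        have e1 : 0 ≤ (Pi.single e1 1 : V × V → ℤ) e := by
          rw [Pi.single_apply]; split_ifs <;> simp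
        have e2 : 0 ≤ (Pi.single e2 1 : V × V → ℤ) e := by
          rw [Pi.single_apply]; split_ifs <;> simp
        simp only [xv, Pi.add_apply, Pi.sub_apply]
        by_cases he : e = (v1, v2)
        · subst he; simp only [Pi.single_eq_same]; omega
        · rw [Pi.single_eq_of_ne (i := (v1, v2)) he]; omega
      · rw [cut_add, Int.odd_add, ← hM.2.1 v]
        simp [cut_xv_even h1 h2]
    have hy' : (y + xv (v1, v2) e1 e2, n) ∈ AddSubmonoid.closure (TJ T) := by
      have := add_mem (AddSubmonoid.subset_closure hM') hz
      convert this using 1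
      have h3 : y = M.1 + z.1 := congrArg Prod.fst h
      have h4 : n = M.2 + z.2 := congrArg Prod.snd h
      ext1
      · simp only [Prod.fst_add]; rw [h3]; abel
      · simpa using h4
    have := ih hy' (by
      simp only [xv, Pi.add_apply, Pi.sub_apply, Pi.single_eq_same]
      rw [Pi.single_eq_of_ne n1.symm, Pi.single_eq_of_ne n2.symm]
      omega) n1 n2
    convert this using 2
    push_cast
    rw [add_smul, one_smul]; abel

lemma posi (X Y : Finset V) {E : Type} [Fintype E] {s t : E → V} {x : E → ℤ} (hx : ∀ e, 0 ≤ x e)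
    {f : E} {v u : V} (hf : J s t f v u)
    (hv : v ∈ X ∩ Y) (hu : u ∉ X ∪ Y) :
    cut s t (X \ Y) x + cut s t (Y \ X) x + 2 * x f ≤ cut s t X x + cut s t Y x := by
  have h1 : 2 * x f = ∑ e, (if e = f then 2 else 0) * x e := by simp
  rw [h1]
  unfold cut
  rw [← sum_add_distrib, ← sum_add_distrib, ← sum_add_distrib]
  refine sum_le_sum fun e _ => ?_
  rw [← add_mul, ← add_mul, ← add_mul]
  refine mul_le_mul_of_nonneg_right ?_ (hx e)
  simp only [mem_inter, mem_union, not_or] at hv hu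
  by_cases hef : e = f
  · subst hef
    rw [cr_J hf, cr_J hf, cr_J hf, cr_J hf]
    simp [hv.1, hv.2, hu.1, hu.2]
  · simp only [hef, if_false, add_zero]
    unfold cr
    simp only [mem_sdiff]
    by_cases h1 : s e ∈ X <;> by_cases h2 : t e ∈ X <;> by_cases h3 : s e ∈ Y <;>
      by_cases h4 : t e ∈ Y <;> simp [h1, h2, h3, h4]

lemma odd_inter_union {T X Y : Finset V} (hX : Odd (X ∩ T).card) (hY : Odd (Y ∩ T).card) :
    (Odd ((X ∩ Y) ∩ T).card → Odd ((X ∪ Y) ∩ T).card) ∧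
    (¬ Odd ((X ∩ Y) ∩ T).card → Odd ((X \ Y) ∩ T).card ∧ Odd ((Y \ X) ∩ T).card) := by
  have h1 := card_union_add_card_inter (X ∩ T) (Y ∩ T)
  have h2 := card_sdiff_add_card_inter (X ∩ T) (Y ∩ T)
  have h3 := card_sdiff_add_card_inter (Y ∩ T) (X ∩ T)
  have e1 : (X ∩ T) ∪ (Y ∩ T) = (X ∪ Y) ∩ T := by ext; simp <;> tauto
  have e2 : (X ∩ T) ∩ (Y ∩ T) = (X ∩ Y) ∩ T := by ext; simp <;> tauto
  have e2' : (Y ∩ T) ∩ (X ∩ T) = (X ∩ Y) ∩ T := by ext; simp <;> tauto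
  have e3 : (X ∩ T) \ (Y ∩ T) = (X \ Y) ∩ T := by ext; simp <;> tauto
  have e4 : (Y ∩ T) \ (X ∩ T) = (Y \ X) ∩ T := by ext; simp <;> tauto
  rw [e1, e2] at h1
  rw [e3, e2] at h2
  rw [e4, e2'] at h3
  simp only [Nat.odd_iff] at *
  omega

/-- the data for the T-join packing -/
structure TI (T : Finset V) (c : V × V → ℤ) (τ : ℤ) : Prop where
  tne : T.Nonempty
  tpos : 0 < τ
  teven : Even τ
  nonneg : ∀ e, 0 ≤ c e
  loop : ∀ e : V × V, e.1 = e.2 → c e = 0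
  deg : ∀ v, Even (cut Prod.fst Prod.snd {v} c)
  odd : ∀ X : Finset V, Odd (X ∩ T).card → τ ≤ cut Prod.fst Prod.snd X c

variable {T : Finset V} {c : V × V → ℤ} {τ : ℤ}

lemma TI.even (h : TI T c τ) (X : Finset V) : Even (cut Prod.fst Prod.snd X c) := by
  have h1 := pot (s := Prod.fst) (t := Prod.snd) c h.loop (fun v => if v ∈ X then (1:ℤ) else 0)
  have h2 : Even (∑ v, cut Prod.fst Prod.snd {v} c • (if v ∈ X then (1:ℤ) else 0)) := by
    refine even_sum _ fun v _ => ?_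
    rw [smul_eq_mul]
    exact (h.deg v).mul_right _
  rw [h1] at h2
  have h3 : Even (∑ e, c e • ((if e.1 ∈ X then (1:ℤ) else 0) + (if e.2 ∈ X then (1:ℤ) else 0)) - cut Prod.fst Prod.snd X c) := by
    unfold cut
    rw [← sum_sub_distrib]
    refine even_sum _ fun e _ => ?_
    unfold cr
    by_cases g1 : e.1 ∈ X <;> by_cases g2 : e.2 ∈ X <;> simp [g1, g2]
  have := h2.sub h3
  simpa using this

lemma TI.Teven (h : TI T c τ) : Even T.card := by
  by_contra hn
  have := h.odd univ (by simpa using hn)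
  have := h.tpos
  simp at *
  omega

lemma TI.oddc (h : TI T c τ) {X : Finset V} (hX : Odd (X ∩ T).card) : Odd (Xᶜ ∩ T).card := by
  have h1 := card_sdiff_add_card_inter T X
  have e1 : T \ X = Xᶜ ∩ T := by ext; simp <;> tauto
  rw [e1, inter_comm T X] at h1
  have := h.Teven
  simp only [Nat.odd_iff, Nat.even_iff] at *
  omega

/-- other end -/
lemma ex_J {u : V} {e : V × V} (h : cr Prod.fst Prod.snd {u} e = 1) : ∃ v, v ≠ u ∧ J Prod.fst Prod.snd e u v := by
  rw [cr_eq_one_iff] at h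
  simp only [mem_singleton] at h
  by_cases g1 : e.1 = u
  · exact ⟨e.2, fun h2 => h (by simp [g1, h2]), Or.inl ⟨g1, rfl⟩⟩
  · by_cases g2 : e.2 = u
    · exact ⟨e.1, g1, Or.inr ⟨rfl, g2⟩⟩
    · simp [g1, g2] at h

lemma TI.choose (h : TI T c τ) {u : V} (hu : 0 < cut Prod.fst Prod.snd {u} c)
    (hu2 : u ∈ T → τ < cut Prod.fst Prod.snd {u} c) :
    ∃ e1 e2 v1 v2, v1 ≠ u ∧ v2 ≠ u ∧ J Prod.fst Prod.snd e1 u v1 ∧ J Prod.fst Prod.snd e2 u v2 ∧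
      0 < c e1 ∧ 0 < c e2 ∧ (e1 = e2 → 2 ≤ c e1) ∧
      ∀ X : Finset V, Odd (X ∩ T).card → u ∉ X → v1 ∈ X → v2 ∈ X → τ < cut Prod.fst Prod.snd X c := by
  have h2 : 2 ≤ cut Prod.fst Prod.snd {u} c := by
    obtain ⟨k, hk⟩ := h.deg u; omega
  have cr01 : ∀ e : V × V, cr Prod.fst Prod.snd {u} e = 0 ∨ cr Prod.fst Prod.snd {u} e = 1 := fun e => by
    unfold cr; split_ifs <;> simp
  have hnn : ∀ e ∈ univ, 0 ≤ cr Prod.fst Prod.snd {u} e * c e :=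
    fun e _ => mul_nonneg (cr_nonneg _ _) (h.nonneg e)
  obtain ⟨e1, he1, hc1⟩ : ∃ e, cr Prod.fst Prod.snd {u} e = 1 ∧ 0 < c e := by
    by_contra hcon
    push Not at hcon
    have : cut Prod.fst Prod.snd {u} c ≤ 0 := sum_nonpos fun e _ => by
      rcases cr01 e with g | g
      · simp [g]
      · rw [g, one_mul]; exact hcon e g
    omega
  obtain ⟨v1, hv1, hJ1⟩ := ex_J he1
  by_cases htight : ∃ X : Finset V, Odd (X ∩ T).card ∧ u ∉ X ∧ v1 ∈ X ∧ cut Prod.fst Prod.snd X c ≤ τ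
  swap
  · push Not at htight
    -- second unit
    obtain ⟨e2, he2, hc2, hd⟩ : ∃ e, cr Prod.fst Prod.snd {u} e = 1 ∧ 0 < c e ∧ (e1 = e → 2 ≤ c e1) := by
      by_cases g : 2 ≤ c e1
      · exact ⟨e1, he1, hc1, fun _ => g⟩
      · by_contra hcon
        push Not at hcon
        have hs := add_sum_erase univ (fun e => cr Prod.fst Prod.snd {u} e * c e) (mem_univ e1)
        have : ∑ e ∈ univ.erase e1, cr Prod.fst Prod.snd {u} e * c e ≤ 0 := sum_nonpos fun e he => by
          rcases cr01 e with g' | g'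
          · simp [g']
          · rw [g', one_mul]
            by_contra hpos
            exact (ne_of_mem_erase he) (hcon e g' (by omega)).1.symm
        unfold cut at h2
        rw [he1, one_mul] at hs
        omega
    obtain ⟨v2, hv2, hJ2⟩ := ex_J he2
    exact ⟨e1, e2, v1, v2, hv1, hv2, hJ1, hJ2, hc1, hc2, hd, fun X hX hXu hX1 _ => htight X hX hXu hX1⟩
  · set F := univ.filter fun X : Finset V => Odd (X ∩ T).card ∧ u ∉ X ∧ v1 ∈ X ∧ cut Prod.fst Prod.snd X c ≤ τ with hF
    obtain ⟨X, hXF, hmax⟩ := exists_max_image F card (by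
      obtain ⟨X, hX⟩ := htight
      exact ⟨X, by rw [hF, mem_filter]; exact ⟨mem_univ _, hX⟩⟩)
    obtain ⟨-, hXo, hXu, hX1, hXt⟩ := mem_filter.1 hXF
    by_cases hout : ∃ e2 v2, J Prod.fst Prod.snd e2 u v2 ∧ v2 ≠ u ∧ 0 < c e2 ∧ v2 ∉ X
    · obtain ⟨e2, v2, hJ2, hv2, hc2, hv2X⟩ := hout
      have hne : v1 ≠ v2 := fun h => hv2X (h ▸ hX1)
      refine ⟨e1, e2, v1, v2, hv1, hv2, hJ1, hJ2, hc1, hc2, ?_, ?_⟩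
      · rintro rfl
        exfalso
        rcases hJ1 with ⟨a1, a2⟩ | ⟨a1, a2⟩ <;> rcases hJ2 with ⟨b1, b2⟩ | ⟨b1, b2⟩
        · exact hne (a2.symm.trans b2)
        · exact hv1 (a2.symm.trans b2)
        · exact hv1 (a1.symm.trans b1)
        · exact hne (a1.symm.trans b1)
      · intro Y hYo hYu hY1 hY2
        by_contra hYt
        push Not at hYt
        obtain ⟨o1, o2⟩ := odd_inter_union hXo hYo
        by_cases ho : Odd ((X ∩ Y) ∩ T).card
        · have q1 := h.odd _ ho
          have q3 := uncross1 (s := Prod.fst) (t := Prod.snd) X Y h.nonneg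
          have hmem : X ∪ Y ∈ F := by
            rw [hF, mem_filter]
            refine ⟨mem_univ _, o1 ho, ?_, ?_, by omega⟩
            · simp [hXu, hYu]
            · simp [hX1]
          have h5 := hmax _ hmem
          have h6 : X.card < (X ∪ Y).card := card_lt_card (by
            refine ⟨subset_union_left, fun hh => hv2X (hh (by simp [hY2]))⟩)
          omega
        · obtain ⟨p1, p2⟩ := o2 ho
          have q1 := h.odd _ p1
          have q2 := h.odd _ p2
          have q3 := posi (s := Prod.fst) (t := Prod.snd) X Y h.nonneg hJ1.symm (by simp [hX1, hY1]) (by simp [hXu, hYu])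
          omega
    · exfalso
      push Not at hout
      have hin : ∀ e, 0 < c e → (e.1 = u → e.2 ∈ X) ∧ (e.2 = u → e.1 ∈ X) := by
        intro e he
        have hl : e.1 ≠ e.2 := fun hl => by have := h.loop e hl; omega
        constructor
        · intro h1
          exact hout e e.2 (Or.inl ⟨h1, rfl⟩) (fun h3 => hl (h1.trans h3.symm)) he
        · intro h1
          exact hout e e.1 (Or.inr ⟨rfl, h1⟩) (fun h3 => hl (h3.trans h1.symm)) he
      by_cases huT : u ∈ T
      · have hlt := hu2 huT
        have : cut Prod.fst Prod.snd {u} c ≤ cut Prod.fst Prod.snd X c := by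
          refine sum_le_sum fun e _ => ?_
          rcases (h.nonneg e).lt_or_eq with he | he
          · refine mul_le_mul_of_nonneg_right ?_ he.le
            obtain ⟨i1, i2⟩ := hin e he
            unfold cr
            simp only [mem_singleton]
            by_cases g1 : e.1 = u <;> by_cases g2 : e.2 = u <;> simp_all
            · split_ifs <;> simp
          · simp [← he]
        omega
      · have hins : Odd ((insert u X) ∩ T).card := by
          rw [insert_inter_of_notMem huT]; exact hXo
        have q1 := h.odd _ hins
        have : cut Prod.fst Prod.snd (insert u X) c + cut Prod.fst Prod.snd {u} c ≤ cut Prod.fst Prod.snd X c := by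
          unfold cut
          rw [← sum_add_distrib]
          refine sum_le_sum fun e _ => ?_
          rcases (h.nonneg e).lt_or_eq with he | he
          · rw [← add_mul]
            refine mul_le_mul_of_nonneg_right ?_ he.le
            obtain ⟨i1, i2⟩ := hin e he
            unfold cr
            simp only [mem_singleton, mem_insert]
            by_cases g1 : e.1 = u <;> by_cases g2 : e.2 = u <;> by_cases g3 : e.1 ∈ X <;>
              by_cases g4 : e.2 ∈ X <;> simp_all
          · simp [← he]
        omega

end tj

end TDD

namespace TDD

section tj2
variable {V : Type} [Fintype V] {T : Finset V} {c : V × V → ℤ} {τ : ℤ}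

lemma cut_sub' (p : V × V → Prop) (hp : ∀ e, p e ↔ (e.1 ∈ T ∧ e.2 ∈ T)) (x : {e // p e} → ℤ)
    (S : Finset V) (S' : Finset {v // v ∈ T}) (hS : ∀ v : {v // v ∈ T}, v ∈ S' ↔ v.1 ∈ S) :
    cut Prod.fst Prod.snd S (ext0 p x) =
      cut (fun e : {e // p e} => (⟨e.1.1, ((hp _).1 e.2).1⟩ : {v // v ∈ T}))
        (fun e => ⟨e.1.2, ((hp _).1 e.2).2⟩) S' x := by
  rw [cut_ext0]
  unfold cut
  refine sum_congr rfl fun e _ => ?_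
  unfold cr
  simp only [hS]

lemma TI.base (h : TI T c τ) (h0 : ∀ u, u ∉ T → cut Prod.fst Prod.snd {u} c = 0)
    (h1 : ∀ u, u ∈ T → cut Prod.fst Prod.snd {u} c = τ) :
    ∃ k : ℕ, ((2 ^ k : ℤ) • c, 2 ^ k * τ) ∈ AddSubmonoid.closure (TJ T) := by
  obtain ⟨p, hp⟩ : ∃ p : V × V → Prop, ∀ e, p e ↔ (e.1 ∈ T ∧ e.2 ∈ T) := ⟨_, fun _ => Iff.rfl⟩
  have hc0 : ∀ e, ¬ p e → c e = 0 := by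
    intro e he
    by_contra hne
    have hl : e.1 ≠ e.2 := fun hl => hne (h.loop e hl)
    have key : ∀ u, u ∉ T → (e.1 = u ∨ e.2 = u) → False := by
      intro u hu hor
      have hh := (sum_eq_zero_iff_of_nonneg (fun e _ => mul_nonneg (cr_nonneg (s := Prod.fst) (t := Prod.snd) {u} e) (h.nonneg e))).1 (h0 u hu) e (mem_univ _)
      have : cr Prod.fst Prod.snd {u} e = 1 := by
        rw [cr_eq_one_iff]
        simp only [mem_singleton]
        rcases hor with rfl | rfl
        · simp [Ne.symm hl]
        · simp [hl]
      rw [this, one_mul] at hh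
      exact hne hh
    rw [hp] at he
    by_cases g : e.1 ∈ T
    · exact key e.2 (fun g2 => he ⟨g, g2⟩) (Or.inr rfl)
    · exact key e.1 g (Or.inl rfl)
  set c' : {e // p e} → ℤ := fun e => c e.1 with hc'
  have hcc : ext0 p c' = c := by
    ext e; unfold ext0; split_ifs with h
    · rfl
    · exact (hc0 e h).symm
  set s' : {e // p e} → {v // v ∈ T} := fun e => ⟨e.1.1, ((hp _).1 e.2).1⟩ with hs'
  set t' : {e // p e} → {v // v ∈ T} := fun e => ⟨e.1.2, ((hp _).1 e.2).2⟩ with ht'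
  have hstar : ∀ (x : {e // p e} → ℤ) (v : {v // v ∈ T}), cut Prod.fst Prod.snd {v.1} (ext0 p x) = cut s' t' {v} x := by
    intro x v
    refine cut_sub' p hp x _ _ fun u => ?_
    rw [mem_singleton, mem_singleton]; exact Subtype.ext_iff
  have hrv : RV s' t' c' τ := by
    refine ⟨fun e => h.nonneg _, fun e he => h.loop _ ?_, fun v => ?_, fun S hS => ?_⟩
    · exact congrArg Subtype.val he
    · rw [← hstar, hcc]; exact h1 _ v.2
    · rw [← cut_sub' p hp c' (S.map ⟨Subtype.val, Subtype.val_injective⟩) S (fun v => by simp), hcc]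
      apply h.odd
      rw [inter_eq_left.2, card_map]
      · exact hS
      · intro v hv
        simp only [mem_map, Function.Embedding.coeFn_mk] at hv
        obtain ⟨a, _, rfl⟩ := hv
        exact a.2
  obtain ⟨k, hk⟩ := pm_main _ _ rfl _ s' t' c' τ hrv
  have key : ∀ z ∈ AddSubmonoid.closure (PM s' t'), ∃ n, (ext0 p z, n) ∈ AddSubmonoid.closure (TJ T) ∧
      ∀ v ∈ T, cut Prod.fst Prod.snd {v} (ext0 p z) = n := by
    intro z hz
    induction hz using AddSubmonoid.closure_induction with
    | mem m hm =>
      have a1 : ∀ v ∈ T, cut Prod.fst Prod.snd {v} (ext0 p m) = 1 := fun v hv => by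
        rw [hstar m ⟨v, hv⟩]; exact hm.2.2 _
      refine ⟨1, AddSubmonoid.subset_closure ⟨fun e => ?_, fun v => ?_, rfl⟩, a1⟩
      · simp only [ext0]; split_ifs
        · exact hm.1 _
        · exact le_rfl
      · by_cases hv : v ∈ T
        · simp only [a1 v hv, hv, iff_true]; decide
        · have : cut Prod.fst Prod.snd {v} (ext0 p m) = 0 := by
            rw [cut_sub' p hp m {v} ∅ (fun u => by
              simp only [notMem_empty, mem_singleton, false_iff]
              rintro rfl; exact hv u.2)]
            simp
          simp [this, hv]
    | zero =>
      have : ext0 p (0 : {e // p e} → ℤ) = 0 := by ext e; simp [ext0]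
      rw [this]
      exact ⟨0, zero_mem _, fun v _ => by simp⟩
    | add a b _ _ ha hb =>
      have : ext0 p (a + b) = ext0 p a + ext0 p b := by
        ext e; simp only [ext0, Pi.add_apply]; split_ifs <;> simp
      rw [this]
      obtain ⟨n, i1, i2⟩ := ha
      obtain ⟨m, j1, j2⟩ := hb
      refine ⟨n + m, add_mem i1 j1, fun v hv => ?_⟩
      rw [cut_add, i2 v hv, j2 v hv]
  obtain ⟨n, hn1, hn2⟩ := key _ hk
  have he : ext0 p ((2 ^ k : ℤ) • c') = (2 ^ k : ℤ) • c := by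
    rw [← hcc]
    ext e
    simp only [ext0, Pi.smul_apply]
    split_ifs <;> simp
  rw [he] at hn1 hn2
  obtain ⟨v, hv⟩ := h.tne
  have := hn2 v hv
  rw [cut_smul, h1 v hv] at this
  exact ⟨k, by rw [this]; exact hn1⟩

theorem tj_main (n : ℕ) : ∀ c : V × V → ℤ, TI T c τ → (∑ e, c e).toNat = n →
    ∃ (k : ℕ) (y : V × V → ℤ), (y, 2 ^ k * τ) ∈ AddSubmonoid.closure (TJ T) ∧ ∀ e, y e ≤ 2 ^ k * c e := by
  induction n using Nat.strong_induction_on with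
  | _ n ih =>
  intro c h hn
  by_cases hop : ∃ u, 0 < cut Prod.fst Prod.snd {u} c ∧ (u ∈ T → τ < cut Prod.fst Prod.snd {u} c)
  swap
  · push Not at hop
    have h0 : ∀ u, u ∉ T → cut Prod.fst Prod.snd {u} c = 0 := fun u hu => by
      have a := cut_nonneg (s := Prod.fst) (t := Prod.snd) {u} h.nonneg
      by_contra hne
      exact hu (hop u (by omega)).1
    have h1 : ∀ u, u ∈ T → cut Prod.fst Prod.snd {u} c = τ := fun u hu => by
      have a := h.odd {u} (by simp [singleton_inter_of_mem hu])
      have := h.tpos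
      have b := (hop u (by omega)).2
      omega
    obtain ⟨k, hk⟩ := h.base h0 h1
    exact ⟨k, _, hk, fun e => by simp⟩
  obtain ⟨u, hu, hu2⟩ := hop
  obtain ⟨e1, e2, v1, v2, hv1, hv2, hJ1, hJ2, hc1, hc2, hd, hX⟩ := h.choose hu hu2
  have hne : ∀ {e : V × V} {v}, J Prod.fst Prod.snd e u v → e ≠ (v1, v2) := by
    rintro e v hJ rfl
    rcases hJ with ⟨a, b⟩ | ⟨a, b⟩
    · exact hv1 a
    · exact hv2 b
  have n1 := hne hJ1
  have n2 := hne hJ2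
  set g := (v1, v2) with hg
  obtain ⟨b, hb⟩ : ∃ b : ℤ, b = if v1 = v2 then 0 else 1 := ⟨_, rfl⟩
  -- indicator of an edge
  obtain ⟨δ, hδ⟩ : ∃ δ : V × V → V × V → ℤ, δ = fun f => Pi.single f 1 := ⟨_, rfl⟩
  have hδ1 : ∀ f, δ f f = 1 := fun f => by simp [hδ]
  have hδ0 : ∀ f e, e ≠ f → δ f e = 0 := fun f e hh => by rw [hδ]; exact Pi.single_eq_of_ne hh _
  have hδs : ∀ f, ∑ e, δ f e = 1 := fun f => by simp [hδ]
  have hxv : xv g e1 e2 = δ e1 + δ e2 - δ g := by rw [hδ]; rfl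
  set c' : V × V → ℤ := c - xv g e1 e2 - (1 - b) • δ g with hc'
  have hc'e : ∀ e, c' e = c e - δ e1 e - δ e2 e + b * δ g e := by
    intro e; rw [hc', hxv]; simp; ring
  have hcut : ∀ X, cut Prod.fst Prod.snd X c' = cut Prod.fst Prod.snd X c - cut Prod.fst Prod.snd X (xv g e1 e2) := by
    intro X
    rw [hc', cut_sub, cut_sub, cut_smul]
    have : (1 - b) * cut Prod.fst Prod.snd X (δ g) = 0 := by
      rw [hδ, cut_single', cr_J (J.st g), hb]
      by_cases hh : v1 = v2 <;> simp [hh, hg]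
    omega
  have hb01 : b = 0 ∨ b = 1 := by rw [hb]; split_ifs <;> simp
  have hδnn : ∀ f e, 0 ≤ δ f e := fun f e => by
    by_cases hh : e = f
    · rw [hh, hδ1]; omega
    · rw [hδ0 _ _ hh]
  have h' : TI T c' τ := by
    refine ⟨h.tne, h.tpos, h.teven, fun e => ?_, fun e he => ?_, fun v => ?_, ?_⟩
    · rw [hc'e]
      have a1 : 0 ≤ b * δ g e := mul_nonneg (by omega) (hδnn _ _)
      have a2 := h.nonneg e
      by_cases g1 : e = e1
      · by_cases g2 : e = e2
        · have := hd (g1.symm.trans g2)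
          rw [← g1] at this
          rw [← g1, ← g2, hδ1]; omega
        · rw [hδ0 _ _ g2, g1, hδ1]; rw [g1] at a1; omega
      · by_cases g2 : e = e2
        · rw [hδ0 _ _ g1, g2, hδ1]; rw [g2] at a1; omega
        · rw [hδ0 _ _ g1, hδ0 _ _ g2]; omega
    · rw [hc'e, h.loop e he]
      have g1 : e ≠ e1 := fun hh => by have := h.loop e he; rw [hh] at this; omega
      have g2 : e ≠ e2 := fun hh => by have := h.loop e he; rw [hh] at this; omega
      rw [hδ0 _ _ g1, hδ0 _ _ g2]
      by_cases g3 : e = g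
      · have : v1 = v2 := by rw [g3] at he; exact he
        rw [hb, if_pos this]; simp
      · rw [hδ0 _ _ g3]; simp
    · rw [hcut]; exact (h.deg v).sub (cut_xv_even hJ1 hJ2 _)
    · have key : ∀ X : Finset V, Odd (X ∩ T).card → u ∉ X → τ ≤ cut Prod.fst Prod.snd X c' := by
        intro X hXo huX
        rw [hcut, cut_xv hJ1 hJ2 huX]
        split_ifs with hh
        · have a1 := hX X hXo huX hh.1 hh.2
          obtain ⟨r, hr⟩ := h.even X
          obtain ⟨q, hq⟩ := h.teven
          omega
        · have := h.odd X hXo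
          omega
      intro X hXo
      by_cases huX : u ∈ X
      · rw [← cut_compl]
        exact key _ (h.oddc hXo) (by simpa using huX)
      · exact key X hXo huX
  have hsum : ∑ e, c' e = ∑ e, c e - 1 - 1 + b := by
    simp only [hc'e]
    rw [sum_add_distrib, sum_sub_distrib, sum_sub_distrib, hδs, hδs, ← mul_sum, hδs, mul_one]
  have hsn : 0 ≤ ∑ e, c' e := sum_nonneg fun e _ => h'.nonneg e
  obtain ⟨k, y, hy, hle⟩ := ih (∑ e, c' e).toNat (by omega) c' h' rfl
  have hpow : (0:ℤ) < 2 ^ k := by positivity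
  rcases hb01 with hb0 | hb1
  · refine ⟨k, y, hy, fun e => (hle e).trans ?_⟩
    refine mul_le_mul_of_nonneg_left ?_ hpow.le
    rw [hc'e, hb0]
    have := hδnn e1 e
    have := hδnn e2 e
    omega
  · obtain ⟨a, ha⟩ : ∃ a : ℕ, (a : ℤ) = max 0 (y g - 2 ^ k * c g) := ⟨(max 0 (y g - 2 ^ k * c g)).toNat, by omega⟩
    have hlg := hle g
    rw [hc'e, hδ0 _ _ n1.symm, hδ0 _ _ n2.symm, hδ1, hb1] at hlg
    have hak : (a : ℤ) ≤ 2 ^ k := by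
      rw [ha]; apply max_le hpow.le; linarith
    have hyn : 0 ≤ 2 ^ k * c g := mul_nonneg hpow.le (h.nonneg g)
    have hynn : 0 ≤ y g := by
      have : ∀ z ∈ AddSubmonoid.closure (TJ T), ∀ e, 0 ≤ z.1 e := by
        intro z hz
        induction hz using AddSubmonoid.closure_induction with
        | mem m hm => exact hm.1
        | zero => intro e; simp
        | add a b _ _ ha hb => intro e; have := ha e; have := hb e; simp; omega
      exact this _ hy g
    refine ⟨k, _, TJ_exchange hJ1 hJ2 a hy ?_ n1 n2, fun e => ?_⟩
    · show (a:ℤ) ≤ y g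
      omega
    · show y e + a • (xv g e1 e2 e) ≤ _
      rw [hxv]
      simp only [Pi.add_apply, Pi.sub_apply, smul_eq_mul, nsmul_eq_mul]
      by_cases he : e = g
      · rw [he, hδ0 _ _ n1.symm, hδ0 _ _ n2.symm, hδ1]
        have : y g - 2 ^ k * c g ≤ a := by rw [ha]; exact le_max_right _ _
        linarith
      · have := hle e
        rw [hc'e, hδ0 _ _ he] at this
        rw [hδ0 _ _ he]
        have i1 := mul_le_mul_of_nonneg_right hak (hδnn e1 e)
        have i2 := mul_le_mul_of_nonneg_right hak (hδnn e2 e)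
        nlinarith

end tj2

end TDD

namespace TDD

section fin
variable {V E : Type} [Fintype V] [Fintype E] {a b : E → V} {ends : E → Sym2 V}

/-- capacities on the subdivided graph -/
noncomputable def cap (a b : E → V) (x z : E → ℤ) : (V ⊕ E) × (V ⊕ E) → ℤ
  | (Sum.inl u, Sum.inr e) => (if u = a e then x e else 0) + (if u = b e then z e else 0)
  | _ => 0

/-- the terminal set -/
noncomputable def TT (b : E → V) : Finset (V ⊕ E) :=
  univ.filter fun q => ∀ u, q = Sum.inl u → Odd (univ.filter fun e => b e = u).card

lemma cap_loop {x z : E → ℤ} (q : (V ⊕ E) × (V ⊕ E)) (h : q.1 = q.2) : cap a b x z q = 0 := by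
  obtain ⟨q1 | q1, q2 | q2⟩ := q <;> simp_all [cap]

lemma cap_nonneg {x z : E → ℤ} (hx : ∀ e, 0 ≤ x e) (hz : ∀ e, 0 ≤ z e) (q : (V ⊕ E) × (V ⊕ E)) :
    0 ≤ cap a b x z q := by
  obtain ⟨q1 | q1, q2 | q2⟩ := q <;> simp only [cap] <;> try exact le_rfl
  have := hx q2
  have := hz q2
  split_ifs <;> omega

lemma cut_cap (x z : E → ℤ) (X : Finset (V ⊕ E)) :
    cut Prod.fst Prod.snd X (cap a b x z) =
      ∑ e, ((if (Sum.inl (a e) ∈ X ↔ Sum.inr e ∈ X) then 0 else x e) +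
        (if (Sum.inl (b e) ∈ X ↔ Sum.inr e ∈ X) then 0 else z e)) := by
  unfold cut
  rw [Fintype.sum_prod_type, Fintype.sum_sum_type]
  simp only [Fintype.sum_sum_type]
  simp only [cap, mul_zero, sum_const_zero, zero_add, add_zero]
  rw [sum_comm]
  refine sum_congr rfl fun e _ => ?_
  simp only [mul_add, sum_add_distrib, mul_ite, mul_zero, sum_ite_eq', mem_univ, if_true]
  unfold cr
  congr 1 <;> split_ifs <;> simp

lemma cut_inr (x z : E → ℤ) (e : E) :
    cut Prod.fst Prod.snd {Sum.inr e} (cap a b x z) = x e + z e := by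
  rw [cut_cap]
  simp only [mem_singleton, reduceCtorEq, false_iff, Sum.inr.injEq]
  rw [sum_add_distrib]
  simp

lemma cut_inl (x z : E → ℤ) (u : V) :
    cut Prod.fst Prod.snd {Sum.inl u} (cap a b x z) =
      ∑ e, ((if a e = u then x e else 0) + (if b e = u then z e else 0)) := by
  rw [cut_cap]
  simp

lemma cyc_par (hends : ∀ e, ends e = s(a e, b e)) (hab : ∀ e, a e ≠ b e) (C : Finset E) {x z : E → ℤ}
    (hx : ∀ e, Even (x e - if e ∈ C then 1 else 0)) (hz : ∀ e, Even (z e - if e ∈ C then 0 else 1)) (u : V) :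
    Even (cut Prod.fst Prod.snd {Sum.inl u} (cap a b x z) - ((univ.filter fun e => b e = u).card : ℤ)
      - ((univ.filter (fun e => e ∈ C ∧ u ∈ ends e)).card : ℤ)) := by
  rw [cut_inl, card_filter, card_filter]
  push_cast
  rw [← sum_sub_distrib, ← sum_sub_distrib]
  refine even_sum _ fun e _ => ?_
  have h1 := hx e
  have h2 := hz e
  have h3 := hab e
  rw [hends]
  simp only [Sym2.mem_iff]
  by_cases g1 : a e = u
  · have g2 : b e ≠ u := fun h => h3 (g1.trans h.symm)
    by_cases g3 : e ∈ C <;> simp_all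
  · by_cases g2 : b e = u
    · by_cases g3 : e ∈ C <;> simp_all [Ne.symm]
    · have g1' : u ≠ a e := Ne.symm g1
      have g2' : u ≠ b e := Ne.symm g2
      simp [g1, g2, g1', g2']

lemma cyc_iff (hends : ∀ e, ends e = s(a e, b e)) (hab : ∀ e, a e ≠ b e) (C : Finset E) {x z : E → ℤ}
    (hx : ∀ e, Even (x e - if e ∈ C then 1 else 0)) (hz : ∀ e, Even (z e - if e ∈ C then 0 else 1)) :
    (∀ q, Odd (cut Prod.fst Prod.snd {q} (cap a b x z)) ↔ q ∈ TT b) ↔ IsCycleSet ends C := by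
  have hr : ∀ e, Odd (cut Prod.fst Prod.snd {Sum.inr e} (cap a b x z)) ∧ Sum.inr e ∈ TT b := by
    intro e
    constructor
    · rw [cut_inr]
      have h1 := hx e
      have h2 := hz e
      by_cases g : e ∈ C
      · simp only [g, if_true] at h1 h2
        obtain ⟨r, hr⟩ := h1
        obtain ⟨t, ht⟩ := h2
        exact ⟨r + t, by omega⟩
      · simp only [g, if_false] at h1 h2
        obtain ⟨r, hr⟩ := h1
        obtain ⟨t, ht⟩ := h2
        exact ⟨r + t, by omega⟩
    · simp [TT]
  have hl : ∀ u : V, Sum.inl u ∈ TT b ↔ Odd (univ.filter fun e => b e = u).card := by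
    intro u; simp [TT]
  have key : ∀ u, (Odd (cut Prod.fst Prod.snd {Sum.inl u} (cap a b x z)) ↔ Sum.inl u ∈ TT b) ↔
      Even ((Finset.univ.filter (fun e => e ∈ C ∧ u ∈ ends e)).card) := by
    intro u
    have := cyc_par hends hab C hx hz u
    rw [hl]
    simp only [Int.odd_iff, Nat.odd_iff, Int.even_iff, Nat.even_iff] at *
    omega
  constructor
  · intro h u
    exact (key u).1 (h _)
  · intro h q
    rcases q with u | e
    · exact (key u).2 (h u)
    · exact ⟨fun _ => (hr e).2, fun _ => (hr e).1⟩

/-- T-odd cuts of T-joins are odd -/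
lemma TJ_cut {W : Type} [Fintype W] {T : Finset W} {j : W × W → ℤ} (h0 : ∀ e, 0 ≤ j e)
    (hl : ∀ e : W × W, e.1 = e.2 → j e = 0)
    (h : ∀ v, Odd (cut Prod.fst Prod.snd {v} j) ↔ v ∈ T) {X : Finset W} (hX : Odd (X ∩ T).card) :
    1 ≤ cut Prod.fst Prod.snd X j := by
  have h1 := pot (s := Prod.fst) (t := Prod.snd) j hl (fun v => if v ∈ X then (1:ℤ) else 0)
  have h3 : Even (∑ e, j e • ((if e.1 ∈ X then (1:ℤ) else 0) + (if e.2 ∈ X then (1:ℤ) else 0)) - cut Prod.fst Prod.snd X j) := by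
    unfold cut
    rw [← sum_sub_distrib]
    refine even_sum _ fun e _ => ?_
    unfold cr
    by_cases g1 : e.1 ∈ X <;> by_cases g2 : e.2 ∈ X <;> simp [g1, g2]
  have h2 : Even (∑ v, cut Prod.fst Prod.snd {v} j • (if v ∈ X then (1:ℤ) else 0) - ((X ∩ T).card : ℤ)) := by
    have : X ∩ T = univ.filter fun v => v ∈ X ∧ v ∈ T := by ext; simp
    rw [this, card_filter]
    push_cast
    rw [← sum_sub_distrib]
    refine even_sum _ fun v _ => ?_
    have hv := h v
    by_cases g1 : v ∈ X
    · by_cases g2 : v ∈ T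
      · have := hv.2 g2
        simp only [g1, g2, smul_eq_mul, if_true, and_self, mul_one]
        obtain ⟨r, hr⟩ := this
        exact ⟨r, by omega⟩
      · have : Even (cut Prod.fst Prod.snd {v} j) := by
          rw [← Int.not_odd_iff_even]; exact fun hh => g2 (hv.1 hh)
        simpa [g1, g2] using this
    · simp [g1]
  rw [h1] at h2
  have h4 := cut_nonneg (s := Prod.fst) (t := Prod.snd) X h0
  simp only [Int.even_iff, Nat.odd_iff] at *
  omega

lemma TJ_count (hends : ∀ e, ends e = s(a e, b e)) (hab : ∀ e, a e ≠ b e)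
    {y : ((V ⊕ E) × (V ⊕ E) → ℤ) × ℤ} (hy : y ∈ AddSubmonoid.closure (TJ (TT b))) :
    (∀ q, 0 ≤ y.1 q) ∧ ((∀ q, cap a b 1 1 q = 0 → y.1 q = 0) →
      ∃ N : {C : Finset E // IsCycleSet ends C} → ℕ, ((∑ C, N C : ℕ) : ℤ) = y.2 ∧
        (∀ e, ∑ C : {C : Finset E // IsCycleSet ends C}, (if e ∈ C.1 then (N C : ℤ) else 0) ≤ y.1 (Sum.inl (a e), Sum.inr e)) ∧
        (∀ e, ∑ C : {C : Finset E // IsCycleSet ends C}, (if e ∉ C.1 then (N C : ℤ) else 0) ≤ y.1 (Sum.inl (b e), Sum.inr e))) := by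
  induction hy using AddSubmonoid.closure_induction with
  | mem j hj =>
    refine ⟨hj.1, fun hsupp => ?_⟩
    obtain ⟨h0, hodd, h1⟩ := hj
    set x : E → ℤ := fun e => j.1 (Sum.inl (a e), Sum.inr e) with hx
    set z : E → ℤ := fun e => j.1 (Sum.inl (b e), Sum.inr e) with hz
    have hjc : j.1 = cap a b x z := by
      ext q
      obtain ⟨q1 | q1, q2 | q2⟩ := q
      · exact hsupp _ rfl
      · have := hsupp (Sum.inl q1, Sum.inr q2)
        simp only [cap, Pi.one_apply] at this ⊢
        by_cases g1 : q1 = a q2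
        · have : q1 ≠ b q2 := fun h => hab q2 (g1.symm.trans h)
          simp [this, g1, hx, hab]
        · by_cases g2 : q1 = b q2
          · simp [g2, hz, (hab q2).symm]
          · simp [g1, g2] at this ⊢
            exact this
      · exact hsupp _ rfl
      · exact hsupp _ rfl
    set C : Finset E := univ.filter fun e => Odd (x e) with hC
    have hsum : ∀ e, Odd (x e + z e) := by
      intro e
      rw [← cut_inr (a := a) (b := b), ← hjc, hodd]
      simp [TT]
    have p1 : ∀ e, Even (x e - if e ∈ C then 1 else 0) := by
      intro e
      by_cases g : Odd (x e)
      · have : e ∈ C := by simp [hC, g]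
        simp only [this, if_true]
        obtain ⟨r, hr⟩ := g
        exact ⟨r, by omega⟩
      · have : e ∉ C := by simp [hC] at g ⊢; exact g
        simp only [this, if_false, sub_zero]
        simpa using g
    have p2 : ∀ e, Even (z e - if e ∈ C then 0 else 1) := by
      intro e
      have h3 := hsum e
      have h4 := p1 e
      simp only [Int.even_iff, Int.odd_iff] at *
      by_cases g : e ∈ C <;> simp only [g, if_true, if_false] at * <;> omega
    have hcyc : IsCycleSet ends C := by
      rw [← cyc_iff hends hab C p1 p2, ← hjc]; exact hodd
    have hx0 : ∀ e, 0 ≤ x e := fun e => h0 _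
    have hz0 : ∀ e, 0 ≤ z e := fun e => h0 _
    refine ⟨fun D => if D = ⟨C, hcyc⟩ then 1 else 0, by simp [h1], fun e => ?_, fun e => ?_⟩
    · rw [sum_eq_single ⟨C, hcyc⟩ (fun D _ hD => by simp [hD]) (fun h => absurd (mem_univ _) h)]
      have h4 := p1 e
      have h5 := hx0 e
      show _ ≤ x e
      by_cases g : e ∈ C
      · simp only [g, if_true, Int.even_iff] at *; simp; omega
      · simpa [g] using h5
    · rw [sum_eq_single ⟨C, hcyc⟩ (fun D _ hD => by simp [hD]) (fun h => absurd (mem_univ _) h)]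
      have h4 := p2 e
      have h5 := hz0 e
      show _ ≤ z e
      by_cases g : e ∈ C
      · simpa [g] using h5
      · simp only [g, if_false, Int.even_iff] at *; simp; omega
  | zero => exact ⟨fun q => by simp, fun _ => ⟨0, by simp, by simp, by simp⟩⟩
  | add y z _ _ hy hz =>
    obtain ⟨hy0, hy⟩ := hy
    obtain ⟨hz0, hz⟩ := hz
    refine ⟨fun q => add_nonneg (hy0 q) (hz0 q), fun hsupp => ?_⟩
    have hs : ∀ q, cap a b 1 1 q = 0 → y.1 q = 0 ∧ z.1 q = 0 := fun q hq => by
      have h1 := hsupp q hq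
      have h2 := hy0 q
      have h3 := hz0 q
      simp at h1
      omega
    obtain ⟨N, n1, n2, n3⟩ := hy fun q hq => (hs q hq).1
    obtain ⟨M, m1, m2, m3⟩ := hz fun q hq => (hs q hq).2
    refine ⟨N + M, ?_, fun e => ?_, fun e => ?_⟩
    · simp only [Pi.add_apply, sum_add_distrib]; push_cast at *; simp [n1, m1]
    · refine le_trans (le_of_eq ?_) (add_le_add (n2 e) (m2 e))
      rw [← sum_add_distrib]
      refine sum_congr rfl fun C _ => ?_
      split_ifs <;> simp
    · refine le_trans (le_of_eq ?_) (add_le_add (n3 e) (m3 e))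
      rw [← sum_add_distrib]
      refine sum_congr rfl fun C _ => ?_
      split_ifs <;> simp

/-- weak duality -/
lemma weak (hends : ∀ e, ends e = s(a e, b e)) (hab : ∀ e, a e ≠ b e) {w v : E → ℤ} {X : Finset (V ⊕ E)}
    (hX : Odd (X ∩ TT b).card) (y : {C : Finset E // IsCycleSet ends C} → ℝ) (h0 : ∀ C, 0 ≤ y C)
    (h1 : ∀ e, ∑ C : {C : Finset E // IsCycleSet ends C}, (if e ∈ C.1 then y C else 0) ≤ (w e : ℝ))
    (h2 : ∀ e, ∑ C : {C : Finset E // IsCycleSet ends C}, (if e ∉ C.1 then y C else 0) ≤ (v e : ℝ)) :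
    ∑ C, y C ≤ ((cut Prod.fst Prod.snd X (cap a b w v) : ℤ) : ℝ) := by
  have hC : ∀ C : {C : Finset E // IsCycleSet ends C}, y C ≤ ∑ e,
      ((if (Sum.inl (a e) ∈ X ↔ Sum.inr e ∈ X) then 0 else (if e ∈ C.1 then y C else 0)) +
        (if (Sum.inl (b e) ∈ X ↔ Sum.inr e ∈ X) then 0 else (if e ∉ C.1 then y C else 0))) := by
    intro C
    set x : E → ℤ := fun e => if e ∈ C.1 then 1 else 0 with hx
    set z : E → ℤ := fun e => if e ∈ C.1 then 0 else 1 with hz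
    have h3 := (cyc_iff (x := x) (z := z) hends hab C.1 (fun e => by simp [hx]) (fun e => by simp [hz])).2 C.2
    have h4 := TJ_cut (cap_nonneg (fun e => by simp only [hx]; split_ifs <;> simp) (fun e => by simp only [hz]; split_ifs <;> simp)) cap_loop h3 (by convert hX)
    rw [cut_cap] at h4
    have h5 : (1:ℝ) ≤ ((∑ e, ((if (Sum.inl (a e) ∈ X ↔ Sum.inr e ∈ X) then 0 else x e) +
        (if (Sum.inl (b e) ∈ X ↔ Sum.inr e ∈ X) then 0 else z e)) : ℤ) : ℝ) := by exact_mod_cast h4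
    have h6 := mul_le_mul_of_nonneg_left h5 (h0 C)
    rw [mul_one] at h6
    refine h6.trans (le_of_eq ?_)
    push_cast
    rw [mul_sum]
    refine sum_congr rfl fun e _ => ?_
    simp only [hx, hz]
    split_ifs <;> simp
  refine (sum_le_sum fun C _ => hC C).trans ?_
  rw [sum_comm, cut_cap]
  push_cast
  refine sum_le_sum fun e _ => ?_
  rw [sum_add_distrib]
  refine add_le_add ?_ ?_
  · split_ifs
    · simp
    · exact h1 e
  · split_ifs
    · simp
    · exact h2 e

theorem main_aux [Nonempty E] (hends : ∀ e, ends e = s(a e, b e)) (hab : ∀ e, a e ≠ b e) {w v : E → ℤ}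
    (hw : ∀ e, 0 ≤ w e) (hv : ∀ e, 0 ≤ v e) :
    ∃ y : {C : Finset E // IsCycleSet ends C} → ℝ,
      ((∀ C, 0 ≤ y C) ∧
        (∀ e, ∑ C : {C : Finset E // IsCycleSet ends C},
          (if e ∈ C.1 then y C else 0) ≤ (w e : ℝ)) ∧
        (∀ e, ∑ C : {C : Finset E // IsCycleSet ends C},
          (if e ∉ C.1 then y C else 0) ≤ (v e : ℝ))) ∧
      (∀ y' : {C : Finset E // IsCycleSet ends C} → ℝ,
        ((∀ C, 0 ≤ y' C) ∧
          (∀ e, ∑ C : {C : Finset E // IsCycleSet ends C},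
            (if e ∈ C.1 then y' C else 0) ≤ (w e : ℝ)) ∧
          (∀ e, ∑ C : {C : Finset E // IsCycleSet ends C},
            (if e ∉ C.1 then y' C else 0) ≤ (v e : ℝ))) →
        ∑ C, y' C ≤ ∑ C, y C) ∧
      (∀ C, IsDyadic (y C)) := by
  obtain ⟨e0⟩ := ‹Nonempty E›
  have hmem : (Sum.inr e0 : V ⊕ E) ∈ TT b := by simp [TT]
  obtain ⟨X, hX, hmin⟩ := exists_min_image (univ.filter fun X : Finset (V ⊕ E) => Odd (X ∩ TT b).card)
    (fun X => cut Prod.fst Prod.snd X (cap a b w v))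
    ⟨{Sum.inr e0}, by simp [singleton_inter_of_mem hmem]⟩
  simp only [mem_filter, mem_univ, true_and] at hX hmin
  have hcn : ∀ q, 0 ≤ cap a b w v q := cap_nonneg hw hv
  have hτ0 := cut_nonneg (s := Prod.fst) (t := Prod.snd) X hcn
  set τ := cut Prod.fst Prod.snd X (cap a b w v) with hτ
  have hweak : ∀ y' : {C : Finset E // IsCycleSet ends C} → ℝ,
        ((∀ C, 0 ≤ y' C) ∧
          (∀ e, ∑ C : {C : Finset E // IsCycleSet ends C},
            (if e ∈ C.1 then y' C else 0) ≤ (w e : ℝ)) ∧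
          (∀ e, ∑ C : {C : Finset E // IsCycleSet ends C},
            (if e ∉ C.1 then y' C else 0) ≤ (v e : ℝ))) →
        ∑ C, y' C ≤ (τ : ℝ) := fun y' hy' => weak hends hab hX y' hy'.1 hy'.2.1 hy'.2.2
  rcases hτ0.eq_or_lt with h0 | hpos
  · refine ⟨0, ⟨by simp, fun e => ?_, fun e => ?_⟩, fun y' hy' => ?_, fun C => ⟨0, 0, by simp⟩⟩
    · simpa using hw e
    · simpa using hv e
    · have := hweak y' hy'
      rw [← h0] at this
      simpa using this
  have hTI : TI (TT b) ((2:ℤ) • cap a b w v) (2 * τ) := by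
    refine ⟨⟨_, hmem⟩, by omega, ⟨τ, by ring⟩, fun q => ?_, fun q hq => ?_, fun q => ?_, fun Y hY => ?_⟩
    · have := hcn q
      simp; omega
    · simp [cap_loop q hq]
    · rw [cut_smul]; exact ⟨_, two_mul _⟩
    · rw [cut_smul]
      have := hmin Y (by convert hY)
      omega
  obtain ⟨k, y, hy, hle⟩ := tj_main _ _ hTI rfl
  obtain ⟨hy0, hcount⟩ := TJ_count hends hab hy
  obtain ⟨N, n1, n2, n3⟩ := hcount fun q hq => by
    have h1 : cap a b w v q = 0 := by
      obtain ⟨q1 | q1, q2 | q2⟩ := q <;> simp only [cap] at hq ⊢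
      by_cases g1 : q1 = a q2
      · exfalso; simp only [g1, if_true, Pi.one_apply] at hq; split_ifs at hq <;> omega
      · by_cases g2 : q1 = b q2
        · exfalso; simp only [g2, if_true, Pi.one_apply] at hq; split_ifs at hq <;> omega
        · simp [g1, g2]
    have h2 := hle q
    have h3 := hy0 q
    simp [h1] at h2
    simp at h3 ⊢
    omega
  simp only at n1 n2 n3
  have hpw : (0:ℝ) < 2 ^ (k + 1) := by positivity
  have capA : ∀ e, cap a b w v (Sum.inl (a e), Sum.inr e) = w e := fun e => by simp [cap, hab]
  have capB : ∀ e, cap a b w v (Sum.inl (b e), Sum.inr e) = v e := fun e => by simp [cap, (hab e).symm]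
  refine ⟨fun C => (N C : ℝ) / 2 ^ (k + 1), ⟨fun C => by positivity, fun e => ?_, fun e => ?_⟩, fun y' hy' => ?_, fun C => ⟨N C, k + 1, by simp⟩⟩
  · have h1 := (n2 e).trans (hle _)
    rw [Pi.smul_apply, capA] at h1
    have h2 : (((∑ C : {C : Finset E // IsCycleSet ends C}, (if e ∈ C.1 then (N C : ℤ) else 0)) : ℤ) : ℝ) ≤ ((2 ^ k * (2 • w e) : ℤ) : ℝ) := by exact_mod_cast h1
    have h3 : ∑ C : {C : Finset E // IsCycleSet ends C}, (if e ∈ C.1 then (N C : ℝ) / 2 ^ (k + 1) else 0) =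
        (((∑ C : {C : Finset E // IsCycleSet ends C}, (if e ∈ C.1 then (N C : ℤ) else 0)) : ℤ) : ℝ) / 2 ^ (k + 1) := by
      push_cast
      rw [sum_div]
      refine sum_congr rfl fun C _ => ?_
      split_ifs <;> simp
    rw [h3, div_le_iff₀ hpw]
    refine h2.trans (le_of_eq ?_)
    push_cast; simp only [nsmul_eq_mul]; push_cast; ring
  · have h1 := (n3 e).trans (hle _)
    rw [Pi.smul_apply, capB] at h1
    have h2 : (((∑ C : {C : Finset E // IsCycleSet ends C}, (if e ∉ C.1 then (N C : ℤ) else 0)) : ℤ) : ℝ) ≤ ((2 ^ k * (2 • v e) : ℤ) : ℝ) := by exact_mod_cast h1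
    have h3 : ∑ C : {C : Finset E // IsCycleSet ends C}, (if e ∉ C.1 then (N C : ℝ) / 2 ^ (k + 1) else 0) =
        (((∑ C : {C : Finset E // IsCycleSet ends C}, (if e ∉ C.1 then (N C : ℤ) else 0)) : ℤ) : ℝ) / 2 ^ (k + 1) := by
      push_cast
      rw [sum_div]
      refine sum_congr rfl fun C _ => ?_
      split_ifs <;> simp
    rw [h3, div_le_iff₀ hpw]
    refine h2.trans (le_of_eq ?_)
    push_cast; simp only [nsmul_eq_mul]; push_cast; ring
  · refine (hweak y' hy').trans (le_of_eq ?_)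
    rw [← sum_div, eq_div_iff hpw.ne']
    have h2 : (((∑ C, N C : ℕ) : ℤ) : ℝ) = ((2 ^ k * (2 * τ) : ℤ) : ℝ) := by exact_mod_cast n1
    push_cast at h2
    rw [h2]; ring

end fin

end TDD


/-- For a finite (loopless) graph `G = (V, E)`, the system
`x(C) + z(E \ C) ≥ 1` for all cycles `C`, `x ≥ 0`, `z ≥ 0` is totally dual dyadic: for all
integral objectives `w, v` for which the covering LP
`min {wᵀx + vᵀz : x(C) + z(E \ C) ≥ 1 ∀ cycles C, x, z ≥ 0}` has an optimal solution, the
dual LP has a dyadic optimal solution. -/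
theorem cycle_system_totally_dual_dyadic {V E : Type} [Fintype V] [Fintype E]
    (ends : E → Sym2 V) (hloopless : ∀ e, ¬ (ends e).IsDiag)
    (w v : E → ℤ)
    (hopt : ∃ xz : (E → ℝ) × (E → ℝ),
      ((∀ e, 0 ≤ xz.1 e) ∧ (∀ e, 0 ≤ xz.2 e) ∧
        ∀ C : Finset E, IsCycleSet ends C →
          1 ≤ ∑ e ∈ C, xz.1 e + ∑ e ∈ Cᶜ, xz.2 e) ∧
      ∀ xz' : (E → ℝ) × (E → ℝ),
        ((∀ e, 0 ≤ xz'.1 e) ∧ (∀ e, 0 ≤ xz'.2 e) ∧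
          ∀ C : Finset E, IsCycleSet ends C →
            1 ≤ ∑ e ∈ C, xz'.1 e + ∑ e ∈ Cᶜ, xz'.2 e) →
        ∑ e, (w e : ℝ) * xz.1 e + ∑ e, (v e : ℝ) * xz.2 e ≤
          ∑ e, (w e : ℝ) * xz'.1 e + ∑ e, (v e : ℝ) * xz'.2 e) :
    ∃ y : {C : Finset E // IsCycleSet ends C} → ℝ,
      ((∀ C, 0 ≤ y C) ∧
        (∀ e, ∑ C : {C : Finset E // IsCycleSet ends C},
          (if e ∈ C.1 then y C else 0) ≤ (w e : ℝ)) ∧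
        (∀ e, ∑ C : {C : Finset E // IsCycleSet ends C},
          (if e ∉ C.1 then y C else 0) ≤ (v e : ℝ))) ∧
      (∀ y' : {C : Finset E // IsCycleSet ends C} → ℝ,
        ((∀ C, 0 ≤ y' C) ∧
          (∀ e, ∑ C : {C : Finset E // IsCycleSet ends C},
            (if e ∈ C.1 then y' C else 0) ≤ (w e : ℝ)) ∧
          (∀ e, ∑ C : {C : Finset E // IsCycleSet ends C},
            (if e ∉ C.1 then y' C else 0) ≤ (v e : ℝ))) →
        ∑ C, y' C ≤ ∑ C, y C) ∧
      (∀ C, IsDyadic (y C)) := by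
  obtain ⟨⟨x, z⟩, ⟨hx, hz, hC⟩, hmin⟩ := hopt
  simp only at hx hz hC hmin
  have hw : ∀ e, 0 ≤ w e := by
    intro e0
    have h := hmin (x + Pi.single e0 1, z) ⟨fun e => ?_, hz, fun C hCC => ?_⟩
    · simp only [Pi.add_apply, mul_add, sum_add_distrib] at h
      have h2 : ∑ e, (w e : ℝ) * (Pi.single e0 1 : E → ℝ) e = w e0 := by simp [Pi.single_apply]
      rw [h2] at h
      have : (0:ℝ) ≤ w e0 := by linarith
      exact_mod_cast this
    · have : 0 ≤ (Pi.single e0 1 : E → ℝ) e := by rw [Pi.single_apply]; split_ifs <;> simp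
      have := hx e
      simp only [Pi.add_apply]; linarith
    · have h1 := hC C hCC
      have h2 : ∑ e ∈ C, x e ≤ ∑ e ∈ C, (x + Pi.single e0 1 : E → ℝ) e := sum_le_sum fun e _ => by
        have : 0 ≤ (Pi.single e0 1 : E → ℝ) e := by rw [Pi.single_apply]; split_ifs <;> simp
        simp only [Pi.add_apply]; linarith
      simp only at h1 h2 ⊢
      linarith
  have hv : ∀ e, 0 ≤ v e := by
    intro e0
    have h := hmin (x, z + Pi.single e0 1) ⟨hx, fun e => ?_, fun C hCC => ?_⟩
    · simp only [Pi.add_apply, mul_add, sum_add_distrib] at h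
      have h2 : ∑ e, (v e : ℝ) * (Pi.single e0 1 : E → ℝ) e = v e0 := by simp [Pi.single_apply]
      rw [h2] at h
      have : (0:ℝ) ≤ v e0 := by linarith
      exact_mod_cast this
    · have : 0 ≤ (Pi.single e0 1 : E → ℝ) e := by rw [Pi.single_apply]; split_ifs <;> simp
      have := hz e
      simp only [Pi.add_apply]; linarith
    · have h1 := hC C hCC
      have h2 : ∑ e ∈ Cᶜ, z e ≤ ∑ e ∈ Cᶜ, (z + Pi.single e0 1 : E → ℝ) e := sum_le_sum fun e _ => by
        have : 0 ≤ (Pi.single e0 1 : E → ℝ) e := by rw [Pi.single_apply]; split_ifs <;> simp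
        simp only [Pi.add_apply]; linarith
      simp only at h1 h2 ⊢
      linarith
  have hne : Nonempty E := by
    by_contra hE
    rw [not_nonempty_iff] at hE
    have h1 := hC ∅ (fun u => by simp)
    have h2 : ∀ D : Finset E, D = ∅ := fun D => Finset.eq_empty_of_isEmpty D
    rw [h2 (∅ᶜ)] at h1
    simp at h1
    linarith
  have hab : ∀ e, ∃ ab : V × V, ends e = s(ab.1, ab.2) := by
    intro e
    induction h : ends e using Sym2.ind with
    | _ p q => exact ⟨(p, q), rfl⟩
  choose ab hab using hab
  refine TDD.main_aux (a := fun e => (ab e).1) (b := fun e => (ab e).2) hab (fun e he => ?_) hw hv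
  apply hloopless e
  rw [hab e]
  exact he
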